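/- Let l be a positive integer, ζ a primitive l-th root of unity, and μ = (1^{m_1}, 2^{m_2}, …, n^{m_n}) a partition of a positive integer n. For each i, write m_i = l·q_i + r_i with 0 ≤ r_i ≤ l−1, and set μ̄ = (1^{r_1}, 2^{r_2}, …, n^{r_n}). Then H̃_μ(x; q, ζ) = (H̃_{(1^l)}(x;q,ζ))^{q_1} · (H̃_{(2^l)}(x;q,ζ))^{q_2} · ⋯ · (H̃_{(n^l)}(x;q,ζ))^{q_n} · H̃_{μ̄}(x; q, ζ). -/

import Mathlib

open MvPolynomial

noncomputable section MacdonaldPreliminaries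

/-! ### Base fields: `KK = ℂ(q)` and `FF = ℂ(q)(t)` -/

/-- The field `ℂ(q)` of rational functions in the indeterminate `q`. -/
abbrev KK : Type := RatFunc ℂ

/-- The field `ℂ(q)(t) = ℂ(q,t)`, rational functions in `t` over `ℂ(q)`. -/
abbrev FF : Type := RatFunc KK

/-- The indeterminate `q`, as an element of `ℂ(q)`. -/
def qK : KK := RatFunc.X

/-- The indeterminate `q`, as an element of `ℂ(q,t)`. -/
def qF : FF := RatFunc.C qK

/-- The indeterminate `t`, as an element of `ℂ(q,t)`. -/
def tF : FF := RatFunc.X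

/-! ### The ring of symmetric functions

We model the ring `Λ_R` of symmetric functions over `R` as the free commutative
`R`-algebra on the power sums `p₁, p₂, p₃, …`, i.e. as the polynomial ring in
countably many variables `X k`, `k : ℕ+`, where `X k` represents the power sum `p_k`. -/

/-- The ring of symmetric functions over `R`: polynomials in the power sums `p_k = X k`. -/
abbrev SymFn (R : Type) [CommSemiring R] : Type := MvPolynomial ℕ+ R

section Core

variable {R : Type} [Field R]

/-- The power sum `p_d` for `d : ℕ`, with `p_0 = 1` by convention. -/
def pN (d : ℕ) : SymFn R := if h : 0 < d then X (⟨d, h⟩ : ℕ+) else 1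

/-- `p_λ = ∏ p_{λᵢ}` for a partition `λ` given as a multiset of positive parts. -/
def pPar (lam : Multiset ℕ+) : SymFn R := (lam.map fun k => (X k : SymFn R)).prod

/-- The complete homogeneous symmetric functions, defined by Newton's recursion
`n·h_n = ∑_{i=1}^n p_i · h_{n-i}` with `h_0 = 1`. -/
def hsym : ℕ → SymFn R
  | 0 => 1
  | (n+1) => (((n : R) + 1)⁻¹) • ∑ i ∈ Finset.range (n+1),
      (X (⟨i+1, Nat.succ_pos i⟩ : ℕ+) : SymFn R) * hsym (n - i)
decreasing_by exact Nat.lt_succ_of_le (Nat.sub_le n i)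

/-- `h_z` for an integer index, vanishing for negative `z` (used in Jacobi–Trudi). -/
def hInt (z : ℤ) : SymFn R := if 0 ≤ z then hsym (R := R) z.toNat else 0

/-- The parts of a partition (a multiset of positive integers), sorted decreasingly. -/
def descParts (lam : Multiset ℕ+) : List ℕ :=
  ((lam.map fun a : ℕ+ => (a : ℕ)).sort (· ≤ ·)).reverse

/-- The weight `|λ|` of a partition. -/
def wt (lam : Multiset ℕ+) : ℕ := (lam.map fun a : ℕ+ => (a : ℕ)).sum

/-- The Schur function `s_λ`, via the Jacobi–Trudi formula
`s_λ = det(h_{λᵢ - i + j})₁≤i,j≤ℓ`. -/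
def schur (lam : Multiset ℕ+) : SymFn R :=
  Matrix.det (Matrix.of fun i j : Fin (Multiset.card lam) =>
    hInt (R := R) ((((descParts lam).getD i 0 : ℕ) : ℤ) + (j : ℤ) - (i : ℤ)))

/-- `h_ν = ∏ h_{νⱼ}` for a partition `ν`. -/
def hPar (nu : Multiset ℕ+) : SymFn R := (nu.map fun a => hsym (R := R) (a : ℕ)).prod

/-! ### Inner products -/

/-- The `(q,t)`-deformed weight `z_λ(q,t)` attached to the monomial `∏ (X k)^(m k)`,
namely `∏_k (m k)! · k^(m k) · ((1-q^k)/(1-t^k))^(m k)`. -/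
def zwtQT (q t : R) (m : ℕ+ →₀ ℕ) : R :=
  ∏ k ∈ m.support,
    ((Nat.factorial (m k) : R) * ((k : ℕ) : R) ^ (m k) *
      ((1 - q ^ (k : ℕ)) / (1 - t ^ (k : ℕ))) ^ (m k))

/-- The Macdonald inner product `⟨·,·⟩_{q,t}`, defined on the power sum basis by
`⟨p_λ, p_μ⟩_{q,t} = δ_{λμ} z_λ(q,t)`. -/
def innerQT (q t : R) (f g : SymFn R) : R :=
  ∑ m ∈ f.support, MvPolynomial.coeff m f * MvPolynomial.coeff m g * zwtQT q t m

/-- The classical weight `z_λ = ∏_k (m k)! k^(m k)` attached to a monomial. -/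
def zwtH (m : ℕ+ →₀ ℕ) : R :=
  ∏ k ∈ m.support, ((Nat.factorial (m k) : R) * ((k : ℕ) : R) ^ (m k))

/-- The standard Hall inner product, `⟨p_λ, p_μ⟩ = δ_{λμ} z_λ`. -/
def innerH (f g : SymFn R) : R :=
  ∑ m ∈ f.support, MvPolynomial.coeff m f * MvPolynomial.coeff m g * zwtH (R := R) m

/-- The internal (Kronecker) product `⋆`, determined by `p_λ ⋆ p_μ = δ_{λμ} z_λ p_λ`. -/
def star (f g : SymFn R) : SymFn R :=
  ∑ m ∈ f.support,
    MvPolynomial.monomial m (MvPolynomial.coeff m f * MvPolynomial.coeff m g * zwtH (R := R) m)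

/-! ### Dominance order and the Macdonald basis -/

/-- Sum of the `k` largest parts of `λ`. -/
def pSum (lam : Multiset ℕ+) (k : ℕ) : ℕ := ((descParts lam).take k).sum

/-- `μ` is strictly dominated by `λ`: same weight, `μ ≠ λ`, and all partial sums of the
decreasingly sorted parts of `μ` are at most those of `λ`. -/
def StrictDom (mu lam : Multiset ℕ+) : Prop :=
  mu ≠ lam ∧ wt mu = wt lam ∧ ∀ k, pSum mu k ≤ pSum lam k

/-- Characterization of the Macdonald basis `P_λ(x;q,t)` (obtained from the Schur basis by
Gram–Schmidt orthogonalization w.r.t. `⟨·,·⟩_{q,t}`): `P_λ` is unitriangular with respect to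
the Schur functions of strictly dominated partitions, and the `P_λ` are pairwise orthogonal. -/
def IsMacdonaldBasis (q t : R) (P : Multiset ℕ+ → SymFn R) : Prop :=
  (∀ lam, P lam - schur lam ∈
      Submodule.span R ((schur (R := R)) '' {mu | StrictDom mu lam})) ∧
  (∀ lam mu, lam ≠ mu → innerQT q t (P lam) (P mu) = 0)

/-- `Q_λ = P_λ / ⟨P_λ, P_λ⟩_{q,t}`. -/
def Qfam (q t : R) (P : Multiset ℕ+ → SymFn R) (lam : Multiset ℕ+) : SymFn R :=
  (innerQT q t (P lam) (P lam))⁻¹ • P lam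

/-- The algebra endomorphism of `Λ_R` rescaling each power sum: `p_k ↦ g k · p_k`. -/
def scaleHom (g : ℕ+ → R) : SymFn R →ₐ[R] SymFn R :=
  aeval fun k : ℕ+ => (C (g k) * X k : SymFn R)

/-- The modified Macdonald polynomial `Q'_λ(x;q,t) = Q_λ(((1-q)/(1-t))·x; q,t)`,
the image of `Q_λ` under `p_k ↦ ((1-q^k)/(1-t^k))·p_k`. -/
def Qprime (q t : R) (P : Multiset ℕ+ → SymFn R) (lam : Multiset ℕ+) : SymFn R :=
  scaleHom (fun k => (1 - q ^ (k : ℕ)) / (1 - t ^ (k : ℕ))) (Qfam q t P lam)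

/-! ### Plethysm -/

/-- Plethysm by the power sum on the left: `p_l ∘ f`, the ring endomorphism `p_k ↦ p_{lk}`
applied to `f`. -/
def plethP (l : ℕ+) : SymFn R →ₐ[R] SymFn R :=
  aeval fun k : ℕ+ => (X (l * k) : SymFn R)

/-- General plethysm `g ∘ f`: the algebra homomorphism in `g` sending `p_k` to `p_k ∘ f`. -/
def pleth (g f : SymFn R) : SymFn R :=
  aeval (fun k : ℕ+ => plethP k f) g

/-! ### Cells of a partition: arms, legs, the constants `c_μ`, `c'_μ` and `n(μ)` -/

/-- Arm length of the (0-indexed) cell `(i,j)` of `λ`: `λ_i - j - 1`. -/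
def armM (lam : Multiset ℕ+) (i j : ℕ) : ℕ := (descParts lam).getD i 0 - (j + 1)

/-- Leg length of the (0-indexed) cell `(i,j)` of `λ`: the number of cells below it
in the same column. -/
def legM (lam : Multiset ℕ+) (i j : ℕ) : ℕ :=
  ((List.range (descParts lam).length).filter
    (fun i' => decide (i < i') && decide (j < (descParts lam).getD i' 0))).length

/-- Product of a quantity over all cells of the partition `λ`. -/
def cellProd {S : Type} [CommMonoid S] (lam : Multiset ℕ+) (f : ℕ → ℕ → S) : S :=
  ∏ i ∈ Finset.range (descParts lam).length,
    ∏ j ∈ Finset.range ((descParts lam).getD i 0), f i j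

/-- `c_μ(q,t) = ∏_{s∈μ} (1 - q^{a(s)} t^{l(s)+1})`. -/
def cLow (q t : R) (lam : Multiset ℕ+) : R :=
  cellProd lam fun i j => 1 - q ^ (armM lam i j) * t ^ (legM lam i j + 1)

/-- `c'_μ(q,t) = ∏_{s∈μ} (1 - q^{a(s)+1} t^{l(s)})`. -/
def cUp (q t : R) (lam : Multiset ℕ+) : R :=
  cellProd lam fun i j => 1 - q ^ (armM lam i j + 1) * t ^ (legM lam i j)

/-- `n(λ) = ∑ (i-1)·λ_i`. -/
def nInv (lam : Multiset ℕ+) : ℕ :=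
  ∑ i ∈ Finset.range (descParts lam).length, i * (descParts lam).getD i 0

/-- The modified Macdonald polynomial of Haglund–Haiman–Loehr,
`H̃_μ(x;q,t) = t^{n(μ)} J_μ(x/(1-t⁻¹); q, t⁻¹)`, where `J_μ(x;q,t) = c_μ(q,t) P_μ(x;q,t)`
and `Pinv` is the Macdonald basis at parameters `(q, t⁻¹)`. -/
def Htilde (q t : R) (Pinv : Multiset ℕ+ → SymFn R) (lam : Multiset ℕ+) : SymFn R :=
  C (t ^ nInv lam) *
    scaleHom (fun k => (1 - (t⁻¹) ^ (k : ℕ))⁻¹) (C (cLow q t⁻¹ lam) * Pinv lam)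

/-! ### Cyclic characters -/

/-- The Ramanujan (Von Sterneck) sum `c(j,d)`: the sum of the `j`-th powers of the primitive
`d`-th roots of unity (computed in the domain `R`). -/
def cRam [IsDomain R] (j d : ℕ) : R := ∑ z ∈ primitiveRoots d R, z ^ j

/-- The Frobenius characteristic `l_k^{(j)} = (1/k) ∑_{d ∣ k} c(j,d) p_d^{k/d}` of the
representation of `S_k` induced from the `j`-th character of the cyclic subgroup generated
by a `k`-cycle. -/
def lchar [IsDomain R] (k j : ℕ) : SymFn R :=
  ((k : R))⁻¹ • ∑ d ∈ Nat.divisors k, (cRam (R := R) j d) • ((pN (R := R) d) ^ (k / d))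

end Core

/-! ### Specialization `t = ζ` and evaluation maps -/

/-- Evaluation of a rational function in `t` over `ℂ(q)` at a point `c : ℂ(q)`. -/
def evalT (c : KK) (x : FF) : KK := RatFunc.eval (RingHom.id KK) c x

/-- Coefficientwise specialization `t = c` of a symmetric function over `ℂ(q,t)`. -/
def specT (c : KK) (f : SymFn FF) : SymFn KK :=
  ∑ m ∈ f.support, MvPolynomial.monomial m (evalT c (MvPolynomial.coeff m f))

/-- Evaluation `f ↦ f(1, ζ, ζ², …, ζ^{l-1}; q, ζ)`: substitute the finite alphabet
`x_i = ζ^{i-1}` (`1 ≤ i ≤ l`) and then specialize `t = ζ`. -/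
def macEvalRoots (l : ℕ) (z : ℂ) (f : SymFn FF) : KK :=
  evalT (RatFunc.C z)
    ((aeval fun k : ℕ+ =>
        ∑ i ∈ Finset.range l, (RatFunc.C (RatFunc.C z) : FF) ^ (i * (k : ℕ))) f)

/-- Evaluation of a symmetric function over `ℂ(q,t)` at the finite alphabet
`(1, t, t², …, t^{l-1})`. -/
def evalAlphT (l : ℕ) : SymFn FF →ₐ[FF] FF :=
  aeval fun k : ℕ+ => ∑ i ∈ Finset.range l, tF ^ (i * (k : ℕ))

/-- Congruence to `0` modulo the cyclotomic polynomial `Φ_l(t)` for a rational function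
in `t`: `x = Φ_l(t) · (a/b)` with `b` coprime to `Φ_l`. -/
def CongrModPhi (l : ℕ) (x : FF) : Prop :=
  ∃ a b : Polynomial KK, IsCoprime b (Polynomial.cyclotomic l KK) ∧
    x = algebraMap (Polynomial KK) FF (Polynomial.cyclotomic l KK) *
      (algebraMap (Polynomial KK) FF a / algebraMap (Polynomial KK) FF b)

/-- The finite set of all partitions of `n`, as multisets of positive integers. -/
def partitionsOf (n : ℕ) : Finset (Multiset ℕ+) :=
  Finset.univ.image fun pi : Nat.Partition n =>
    pi.parts.attach.map fun a => (⟨a.1, pi.parts_pos a.2⟩ : ℕ+)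

end MacdonaldPreliminaries


open MvPolynomial

noncomputable section
namespace HF

/-! ### Partitions as sequences of rows -/

/-- The `i`-th (0-indexed) part of a partition. -/
def part (lam : Multiset ℕ+) (i : ℕ) : ℕ := (descParts lam).getD i 0

theorem descParts_coe (lam : Multiset ℕ+) :
    ((descParts lam : List ℕ) : Multiset ℕ) = lam.map fun a : ℕ+ => (a : ℕ) := by
  unfold descParts
  rw [Multiset.coe_reverse, Multiset.sort_eq]

theorem descParts_length (lam : Multiset ℕ+) : (descParts lam).length = Multiset.card lam := by
  simp [descParts]

theorem descParts_pairwise (lam : Multiset ℕ+) : (descParts lam).Pairwise (· ≥ ·) := by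
  unfold descParts
  rw [List.pairwise_reverse]
  exact Multiset.pairwise_sort _ _

theorem descParts_pos (lam : Multiset ℕ+) {a : ℕ} (h : a ∈ descParts lam) : 0 < a := by
  rw [← Multiset.mem_coe, descParts_coe] at h
  obtain ⟨b, _, rfl⟩ := Multiset.mem_map.1 h
  exact b.2

theorem part_lt (lam : Multiset ℕ+) {i : ℕ} (h : i < (descParts lam).length) :
    part lam i = (descParts lam)[i] := by
  simp [part, h]

theorem part_ge (lam : Multiset ℕ+) {i : ℕ} (h : Multiset.card lam ≤ i) : part lam i = 0 := by
  rw [← descParts_length] at h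
  simp [part, h]

theorem part_pos (lam : Multiset ℕ+) {i : ℕ} (h : i < Multiset.card lam) : 0 < part lam i := by
  rw [← descParts_length] at h
  rw [part_lt lam h]
  exact descParts_pos lam (List.getElem_mem h)

theorem part_antitone (lam : Multiset ℕ+) : Antitone (part lam) := by
  intro i j hij
  by_cases hj : j < (descParts lam).length
  · rw [part_lt lam hj, part_lt lam (lt_of_le_of_lt hij hj)]
    rcases hij.eq_or_lt with rfl | h
    · exact le_rfl
    · exact List.pairwise_iff_getElem.1 (descParts_pairwise lam) i j _ _ h
  · rw [part_ge lam (by rw [← descParts_length]; omega)]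
    exact Nat.zero_le _

theorem list_map_part (lam : Multiset ℕ+) :
    (List.range (Multiset.card lam)).map (part lam) = descParts lam := by
  apply List.ext_getElem
  · simp [descParts_length]
  · intro i h1 h2
    simp [part_lt lam h2]

theorem multiset_part (lam : Multiset ℕ+) (n : ℕ) (h : Multiset.card lam ≤ n) :
    (Multiset.range n).map (part lam) =
      (lam.map fun a : ℕ+ => (a : ℕ)) + Multiset.replicate (n - Multiset.card lam) 0 := by
  obtain ⟨k, rfl⟩ := Nat.exists_eq_add_of_le h
  have hr : Multiset.range (Multiset.card lam + k) = Multiset.range (Multiset.card lam) +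
      (Multiset.range k).map (fun x => Multiset.card lam + x) := by
    simp only [Multiset.range, Multiset.map_coe, Multiset.coe_add, List.range_add]
  rw [hr, Multiset.map_add]
  congr 1
  · rw [← descParts_coe, ← list_map_part]
    simp [Multiset.range]
  · rw [Multiset.map_map]
    simp only [Function.comp_def]
    rw [Multiset.map_congr rfl (g := fun _ => 0)]
    · simp
    · intro x _
      exact part_ge lam (by omega)

theorem filter_part (lam : Multiset ℕ+) (n : ℕ) (h : Multiset.card lam ≤ n) :
    ((Multiset.range n).map (part lam)).filter (fun a => 0 < a) =
      lam.map fun a : ℕ+ => (a : ℕ) := by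
  rw [multiset_part lam n h, Multiset.filter_add]
  rw [Multiset.filter_eq_self.2, Multiset.filter_eq_nil.2, add_zero]
  · intro a ha
    rw [Multiset.eq_of_mem_replicate ha]; simp
  · intro a ha
    obtain ⟨b, _, rfl⟩ := Multiset.mem_map.1 ha
    exact b.2

theorem map_coe_inj {lam mu : Multiset ℕ+}
    (h : (lam.map fun a : ℕ+ => (a : ℕ)) = mu.map fun a : ℕ+ => (a : ℕ)) : lam = mu :=
  Multiset.map_injective PNat.coe_injective h

theorem eq_of_multiset_part {lam mu : Multiset ℕ+} {n : ℕ} (h1 : Multiset.card lam ≤ n)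
    (h2 : Multiset.card mu ≤ n)
    (h : (Multiset.range n).map (part lam) = (Multiset.range n).map (part mu)) : lam = mu := by
  apply map_coe_inj
  rw [← filter_part lam n h1, ← filter_part mu n h2, h]

theorem part_inj {lam mu : Multiset ℕ+} (h : ∀ i, part lam i = part mu i) : lam = mu := by
  apply eq_of_multiset_part (n := Multiset.card lam + Multiset.card mu) (by omega) (by omega)
  exact Multiset.map_congr rfl fun i _ => h i

theorem exists_part (f : ℕ → ℕ) (hf : Antitone f) (n : ℕ) (h0 : ∀ i, n ≤ i → f i = 0) :
    ∃ lam : Multiset ℕ+, Multiset.card lam ≤ n ∧ ∀ i, part lam i = f i := by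
  classical
  obtain ⟨m, hmn, hm, hpos⟩ : ∃ m, m ≤ n ∧ (∀ i, m ≤ i → f i = 0) ∧ ∀ i, i < m → 0 < f i := by
    have hex : ∃ m, f m = 0 := ⟨n, h0 n le_rfl⟩
    refine ⟨Nat.find hex, Nat.find_min' hex (h0 n le_rfl), ?_, ?_⟩
    · intro i hi
      have := hf hi
      rw [Nat.find_spec hex] at this
      omega
    · intro i hi
      exact Nat.pos_of_ne_zero (Nat.find_min hex hi)
  let L : List ℕ+ := (List.range m).map fun i => if h : 0 < f i then ⟨f i, h⟩ else 1
  have hL : (L.map fun a : ℕ+ => (a : ℕ)) = (List.range m).map f := by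
    simp only [L, List.map_map]
    apply List.map_congr_left
    intro i hi
    have := hpos i (List.mem_range.1 hi)
    simp [this]
  have hd : descParts (L : Multiset ℕ+) = (List.range m).map f := by
    apply List.Perm.eq_of_pairwise (le := (· ≥ ·))
    · intro a b _ _ h1 h2
      exact le_antisymm h2 h1
    · exact descParts_pairwise _
    · rw [List.pairwise_map]
      exact List.Pairwise.imp (fun h => hf h.le) (List.pairwise_lt_range (n := m))
    · rw [← Multiset.coe_eq_coe, descParts_coe, Multiset.map_coe, hL]
  refine ⟨(L : Multiset ℕ+), ?_, ?_⟩
  · simp [L, hmn]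
  · intro i
    unfold part
    rw [hd]
    by_cases hi : i < m
    · simp [hi]
    · simp [hi, hm i (by omega)]

theorem sum_part (lam : Multiset ℕ+) (n : ℕ) (h : Multiset.card lam ≤ n) :
    ∑ i ∈ Finset.range n, part lam i = wt lam := by
  have := congrArg Multiset.sum (multiset_part lam n h)
  simp only [Multiset.sum_add, Multiset.sum_replicate, smul_zero, add_zero] at this
  exact this

theorem card_le_wt (lam : Multiset ℕ+) : Multiset.card lam ≤ wt lam := by
  unfold wt
  have := Multiset.card_nsmul_le_sum (s := lam.map fun a : ℕ+ => (a : ℕ)) (a := 1) (by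
    intro x hx
    obtain ⟨b, _, rfl⟩ := Multiset.mem_map.1 hx
    exact b.2)
  simpa using this

theorem pSum_eq (lam : Multiset ℕ+) (k : ℕ) : pSum lam k = ∑ i ∈ Finset.range k, part lam i := by
  unfold pSum part
  generalize descParts lam = L
  induction k with
  | zero => simp
  | succ k ih =>
    rw [Finset.sum_range_succ, ← ih]
    by_cases h : k < L.length
    · rw [List.take_add_one, List.sum_append]
      simp [h]
    · rw [List.take_add_one, List.sum_append]
      simp [h]

/-- The quadratic statistic used for triangularity arguments. -/
def Phi (n : ℕ) (lam : Multiset ℕ+) : ℕ :=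
  ∑ i ∈ Finset.range n, (part lam i + (n - 1 - i)) ^ 2

theorem strictDom_card_le {mu lam : Multiset ℕ+} (h : StrictDom mu lam) :
    Multiset.card lam ≤ Multiset.card mu := by
  by_contra hc
  push Not at hc
  have h1 := h.2.2 (Multiset.card mu)
  rw [pSum_eq, pSum_eq, sum_part mu _ le_rfl, h.2.1, ← sum_part lam _ le_rfl] at h1
  have h2 : ∑ i ∈ Finset.range (Multiset.card mu), part lam i <
      ∑ i ∈ Finset.range (Multiset.card lam), part lam i := by
    apply Finset.sum_lt_sum_of_subset (i := Multiset.card mu)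
    · intro i; simp; omega
    · simpa using hc
    · simp
    · exact part_pos lam hc
    · intros; exact Nat.zero_le _
  omega

/-- Abel summation: a nonnegative strict version. -/
theorem abel_pos (d w : ℕ → ℤ) : ∀ n : ℕ, (∀ k, k ≤ n → 0 ≤ ∑ i ∈ Finset.range k, d i) →
    (∀ i, i + 1 < n → w (i + 1) < w i) → (∑ i ∈ Finset.range n, d i = 0) →
    (∃ i, i < n ∧ d i ≠ 0) → 0 < ∑ i ∈ Finset.range n, d i * w i := by
  -- stronger: for all n, sum d_i w_i ≥ w_{n-1} * D_n, strict if some D_k>0, k<n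
  have key : ∀ n : ℕ, (∀ k, k ≤ n + 1 → 0 ≤ ∑ i ∈ Finset.range k, d i) →
      (∀ i, i + 1 < n + 1 → w (i + 1) < w i) →
      (w n * ∑ i ∈ Finset.range (n + 1), d i ≤ ∑ i ∈ Finset.range (n + 1), d i * w i) ∧
      ((∃ k, k < n + 1 ∧ 0 < ∑ i ∈ Finset.range k, d i) →
        w n * ∑ i ∈ Finset.range (n + 1), d i < ∑ i ∈ Finset.range (n + 1), d i * w i) := by
    intro n
    induction n with
    | zero =>
      intro _ _
      refine ⟨by simp [mul_comm], ?_⟩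
      rintro ⟨k, hk, hk2⟩
      have : k = 0 := by omega
      subst this
      simp at hk2
    | succ n ih =>
      intro h1 h2
      obtain ⟨ih1, ih2⟩ := ih (fun k hk => h1 k (by omega)) (fun i hi => h2 i (by omega))
      have hD := h1 (n + 1) (by omega)
      have hw := h2 n (by omega)
      rw [Finset.sum_range_succ _ (n + 1), Finset.sum_range_succ _ (n + 1)]
      refine ⟨by nlinarith, ?_⟩
      rintro ⟨k, hk, hk2⟩
      by_cases hkn : k = n + 1
      · subst hkn
        nlinarith
      · have := ih2 ⟨k, by omega, hk2⟩
        nlinarith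
  intro n h1 h2 h3 h4
  rcases n with _ | n
  · obtain ⟨i, hi, _⟩ := h4; omega
  · have := (key n h1 h2).2 ?_
    · rw [h3, mul_zero] at this; exact this
    · by_contra hc
      push Not at hc
      have hz : ∀ k, k ≤ n + 1 → ∑ i ∈ Finset.range k, d i = 0 := by
        intro k hk
        rcases hk.eq_or_lt with rfl | h
        · exact h3
        · exact le_antisymm (hc k h) (h1 k hk)
      obtain ⟨i, hi, hi2⟩ := h4
      have ha := hz (i + 1) (by omega)
      rw [Finset.sum_range_succ, hz i (by omega)] at ha
      exact hi2 (by simpa using ha)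

theorem strictDom_Phi_lt {mu lam : Multiset ℕ+} (h : StrictDom mu lam) {n : ℕ}
    (hn : Multiset.card mu ≤ n) : Phi n mu < Phi n lam := by
  have hl : Multiset.card lam ≤ n := (strictDom_card_le h).trans hn
  have := abel_pos (fun i => (part lam i : ℤ) - part mu i)
    (fun i => (part lam i : ℤ) + part mu i + 2 * ((n : ℤ) - 1 - i)) n ?_ ?_ ?_ ?_
  · have e : ((Phi n lam : ℕ) : ℤ) - (Phi n mu : ℕ) = ∑ i ∈ Finset.range n,
        ((part lam i : ℤ) - part mu i) *
          ((part lam i : ℤ) + part mu i + 2 * ((n : ℤ) - 1 - i)) := by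
      unfold Phi
      push_cast
      rw [← Finset.sum_sub_distrib]
      apply Finset.sum_congr rfl
      intro i hi
      have hi' := Finset.mem_range.1 hi
      have : ((n - 1 - i : ℕ) : ℤ) = (n : ℤ) - 1 - i := by omega
      rw [this]
      ring
    omega
  · intro k _
    rw [Finset.sum_sub_distrib]
    have := h.2.2 k
    rw [pSum_eq, pSum_eq] at this
    have h' : ((∑ i ∈ Finset.range k, part mu i : ℕ) : ℤ) ≤ (∑ i ∈ Finset.range k, part lam i : ℕ) := by
      exact_mod_cast this
    push_cast at h'
    linarith
  · intro i _
    have h1 := part_antitone lam (Nat.le_succ i)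
    have h2 := part_antitone mu (Nat.le_succ i)
    simp only [Nat.succ_eq_add_one] at h1 h2
    push_cast
    omega
  · rw [Finset.sum_sub_distrib]
    have : ((∑ i ∈ Finset.range n, part lam i : ℕ) : ℤ) = (∑ i ∈ Finset.range n, part mu i : ℕ) := by
      rw [sum_part _ _ hl, sum_part _ _ hn, h.2.1]
    push_cast at this
    linarith
  · by_contra hc
    push Not at hc
    apply h.1
    apply part_inj
    intro i
    by_cases hi : i < n
    · have := hc i hi
      omega
    · rw [part_ge mu (by omega), part_ge lam (by omega)]

theorem wt_zero : wt (0 : Multiset ℕ+) = 0 := by simp [wt]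

theorem wt_add (a b : Multiset ℕ+) : wt (a + b) = wt a + wt b := by simp [wt]

theorem wt_replicate (l : ℕ) (i : ℕ+) : wt (Multiset.replicate l i) = l * i := by simp [wt]

theorem eq_zero_of_wt {lam : Multiset ℕ+} (h : wt lam = 0) : lam = 0 := by
  have := card_le_wt lam
  rw [h] at this
  exact Multiset.card_eq_zero.1 (by omega)

end HF
end

open MvPolynomial

noncomputable section
namespace HF

/-! ### Alternants and the Macdonald operator on functions -/

section Alt
variable {S : Type} [CommRing S] {n : ℕ}

/-- Power sums of a finite alphabet. -/
def pw (v : Fin n → S) (k : ℕ+) : S := ∑ i, v i ^ (k : ℕ)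

/-- The staircase `n-1, n-2, …, 0`. -/
def dl (n : ℕ) (j : Fin n) : ℕ := n - 1 - (j : ℕ)

/-- Alternant `det (v_i ^ β_j)`. -/
def alt (v : Fin n → S) (b : Fin n → ℕ) : S := Matrix.det (Matrix.of fun i j => v i ^ b j)

/-- The Vandermonde alternant. -/
def av (v : Fin n → S) : S := alt v (dl n)

/-- Scaling a subset of the variables. -/
def sc (s : Fin n → Bool) (c : S) (v : Fin n → S) : Fin n → S :=
  fun i => if s i then c * v i else v i

/-- The Macdonald operator generating function, multiplied by the Vandermonde. -/
def aDf (q t x : S) (F : (Fin n → S) → S) (v : Fin n → S) : S :=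
  ∑ s : Fin n → Bool, (∏ i, if s i then x else 1) * av (sc s t v) * F (sc s q v)

theorem alt_eq (v : Fin n → S) (b : Fin n → ℕ) :
    alt v b = ∑ σ : Equiv.Perm (Fin n), ((Equiv.Perm.sign σ : ℤ) : S) * ∏ i, v i ^ b (σ i) := by
  unfold alt
  rw [← Matrix.det_transpose, Matrix.det_apply']
  rfl

theorem prod_one_add (f : Fin n → S) :
    ∏ i, (1 + f i) = ∑ s : Fin n → Bool, ∏ i, (if s i then f i else 1) := by
  have := Finset.prod_univ_sum (fun _ : Fin n => (Finset.univ : Finset Bool))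
    (fun i b => if b then f i else 1)
  rw [Fintype.piFinset_univ] at this
  rw [← this]
  apply Finset.prod_congr rfl
  intro i _
  simp [add_comm]

/-- Expansion of a determinant of sums as a sum over subsets. -/
theorem sum_alt_sc (v g : Fin n → S) (t : S) (b : Fin n → ℕ) :
    ∑ s : Fin n → Bool, (∏ i, if s i then g i else 1) * alt (sc s t v) b =
      Matrix.det (Matrix.of fun i j => v i ^ b j * (1 + t ^ b j * g i)) := by
  rw [← Matrix.det_transpose, Matrix.det_apply']
  simp only [alt_eq, Finset.mul_sum]
  rw [Finset.sum_comm]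
  apply Finset.sum_congr rfl
  intro σ _
  simp only [Matrix.transpose_apply, Matrix.of_apply]
  rw [Finset.prod_mul_distrib, prod_one_add, Finset.mul_sum, Finset.mul_sum]
  apply Finset.sum_congr rfl
  intro s _
  rw [← mul_assoc, mul_comm _ ((Equiv.Perm.sign σ : ℤ) : S), mul_assoc]
  congr 1
  rw [← Finset.prod_mul_distrib, ← Finset.prod_mul_distrib]
  apply Finset.prod_congr rfl
  intro i _
  unfold sc
  split_ifs <;> ring

theorem alt_perm (v : Fin n → S) (b : Fin n → ℕ) (τ : Equiv.Perm (Fin n)) :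
    alt v (b ∘ τ) = ((Equiv.Perm.sign τ : ℤ) : S) * alt v b := by
  unfold alt
  exact Matrix.det_permute' τ (Matrix.of fun i j => v i ^ b j)

theorem alt_not_inj (v : Fin n → S) (b : Fin n → ℕ) (h : ¬ Function.Injective b) :
    alt v b = 0 := by
  unfold Function.Injective at h
  push Not at h
  obtain ⟨i, j, hij, hne⟩ := h
  exact Matrix.det_zero_of_column_eq hne (by intro k; simp [hij])

theorem alt_eq_rows (v : Fin n → S) (b : Fin n → ℕ) {i j : Fin n} (hne : i ≠ j)
    (h : v i = v j) : alt v b = 0 :=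
  Matrix.det_zero_of_row_eq hne (by ext k; simp [h])

theorem alt_add_one (v : Fin n → S) (b : Fin n → ℕ) :
    alt v (fun j => b j + 1) = (∏ i, v i) * alt v b := by
  unfold alt
  rw [← Matrix.det_mul_column]
  congr 1
  ext i j
  simp [pow_succ, mul_comm]

theorem alt_smul (v : Fin n → S) (b : Fin n → ℕ) (c : S) :
    alt (fun i => c * v i) b = c ^ (∑ j, b j) * alt v b := by
  unfold alt
  rw [← Finset.prod_pow_eq_pow_sum, ← Matrix.det_mul_row]
  congr 1
  ext i j
  simp [mul_pow]

/-- Orbit sums (multiples of monomial symmetric polynomials). -/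
def orb (b : Fin n → ℕ) (v : Fin n → S) : S :=
  ∑ τ : Equiv.Perm (Fin n), ∏ i, v i ^ b (τ i)

theorem aDf_orb (q t x : S) (b : Fin n → ℕ) (v : Fin n → S) :
    aDf q t x (orb b) v = ∑ τ : Equiv.Perm (Fin n),
      (∏ j, (1 + x * t ^ dl n j * q ^ b (τ j))) * alt v (fun j => dl n j + b (τ j)) := by
  have h1 : aDf q t x (orb b) v = ∑ τ : Equiv.Perm (Fin n), (∏ i, v i ^ b (τ i)) *
      Matrix.det (Matrix.of fun i j => v i ^ dl n j * (1 + t ^ dl n j * (x * q ^ b (τ i)))) := by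
    unfold aDf orb
    simp only [Finset.mul_sum]
    rw [Finset.sum_comm]
    apply Finset.sum_congr rfl
    intro τ _
    rw [← sum_alt_sc, Finset.mul_sum]
    apply Finset.sum_congr rfl
    intro s _
    unfold av
    have : (∏ i, if s i then x else 1) * ∏ i, sc s q v i ^ b (τ i) =
        (∏ i, v i ^ b (τ i)) * ∏ i, (if s i then x * q ^ b (τ i) else 1) := by
      rw [← Finset.prod_mul_distrib, ← Finset.prod_mul_distrib]
      apply Finset.prod_congr rfl
      intro i _
      unfold sc
      split_ifs <;> ring
    linear_combination (alt (sc s t v) (dl n)) * this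
  rw [h1]
  have h2 : ∀ τ : Equiv.Perm (Fin n), (∏ i, v i ^ b (τ i)) *
      Matrix.det (Matrix.of fun i j => v i ^ dl n j * (1 + t ^ dl n j * (x * q ^ b (τ i)))) =
      ∑ σ : Equiv.Perm (Fin n), ((Equiv.Perm.sign σ : ℤ) : S) * ∏ i, (v i ^ (dl n (σ i) + b (τ i)) *
        (1 + x * t ^ dl n (σ i) * q ^ b (τ i))) := by
    intro τ
    rw [← Matrix.det_transpose, Matrix.det_apply', Finset.mul_sum]
    apply Finset.sum_congr rfl
    intro σ _
    rw [mul_left_comm, ← Finset.prod_mul_distrib]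
    congr 1
    apply Finset.prod_congr rfl
    intro i _
    simp only [Matrix.transpose_apply, Matrix.of_apply]
    ring
  have h3 : ∀ τ : Equiv.Perm (Fin n),
      (∏ j, (1 + x * t ^ dl n j * q ^ b (τ j))) * alt v (fun j => dl n j + b (τ j)) =
      ∑ σ : Equiv.Perm (Fin n), ((Equiv.Perm.sign σ : ℤ) : S) *
        ∏ i, (v i ^ (dl n (σ i) + b ((τ * σ) i)) *
        (1 + x * t ^ dl n (σ i) * q ^ b ((τ * σ) i))) := by
    intro τ
    rw [alt_eq, Finset.mul_sum]
    apply Finset.sum_congr rfl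
    intro σ _
    rw [mul_left_comm]
    congr 1
    rw [← Equiv.prod_comp σ (fun j => (1 + x * t ^ dl n j * q ^ b (τ j))), mul_comm,
      ← Finset.prod_mul_distrib]
    rfl
  simp only [h2, h3]
  rw [Finset.sum_comm]
  conv_rhs => rw [Finset.sum_comm]
  apply Finset.sum_congr rfl
  intro σ _
  exact (Equiv.sum_comp (Equiv.mulRight σ) (fun τ : Equiv.Perm (Fin n) =>
    ((Equiv.Perm.sign σ : ℤ) : S) * ∏ i, (v i ^ (dl n (σ i) + b (τ i)) *
        (1 + x * t ^ dl n (σ i) * q ^ b (τ i))))).symm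

/-! ### Complete homogeneous functions of a finite alphabet and Jacobi–Trudi -/

/-- Generating series of complete homogeneous polynomials. -/
def hv (v : Fin n → S) : PowerSeries S := ∏ i, PowerSeries.mk fun m => v i ^ m

/-- Integer indexed complete homogeneous polynomials. -/
def hz (v : Fin n → S) (z : ℤ) : S := if 0 ≤ z then PowerSeries.coeff z.toNat (hv v) else 0

/-- `∏_{r ≠ k} (1 - v_r X)`. -/
def Qp (v : Fin n → S) (k : Fin n) : Polynomial S :=
  ∏ r ∈ Finset.univ.erase k, (1 - Polynomial.C (v r) * Polynomial.X)

/-- Coefficient matrix of `Qp`. -/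
def Mq (v : Fin n → S) : Matrix (Fin n) (Fin n) S :=
  Matrix.of fun j k => (Qp v k).coeff (dl n j)

theorem geom_mul (a : S) :
    (1 - PowerSeries.C a * PowerSeries.X) * (PowerSeries.mk fun m => a ^ m) = 1 := by
  have := PowerSeries.mk_one_mul_one_sub_eq_one S
  ext m
  rw [sub_mul, one_mul, mul_assoc, map_sub, PowerSeries.coeff_C_mul]
  rcases m with _ | m
  · simp
  · rw [PowerSeries.coeff_succ_X_mul]
    simp [pow_succ, mul_comm]

theorem Qp_natDegree (v : Fin n → S) (k : Fin n) {m : ℕ} (hm : n ≤ m) : (Qp v k).coeff m = 0 := by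
  apply Polynomial.coeff_eq_zero_of_natDegree_lt
  have h1 : (Qp v k).natDegree ≤ ∑ r ∈ Finset.univ.erase k, 1 := by
    refine (Polynomial.natDegree_prod_le _ _).trans (Finset.sum_le_sum ?_)
    intro i _
    refine (Polynomial.natDegree_sub_le _ _).trans ?_
    simp only [Polynomial.natDegree_one, zero_le, max_eq_right]
    exact (Polynomial.natDegree_C_mul_le _ _).trans Polynomial.natDegree_X_le
  have h2 : ∑ r ∈ (Finset.univ : Finset (Fin n)).erase k, 1 = n - 1 := by simp
  have := k.2
  omega

theorem sum_dl {A : Type} [AddCommMonoid A] (f : ℕ → A) :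
    ∑ j : Fin n, f (dl n j) = ∑ a ∈ Finset.range n, f a := by
  rw [← Finset.sum_range_reflect f n, Finset.sum_range]
  rfl

theorem prod_dl {A : Type} [CommMonoid A] (f : ℕ → A) :
    ∏ j : Fin n, f (dl n j) = ∏ a ∈ Finset.range n, f a := by
  rw [← Finset.prod_range_reflect f n, Finset.prod_range]
  rfl

theorem Qp_eval (v : Fin n → S) (k : Fin n) (x : S) :
    ∑ j : Fin n, x ^ dl n j * Mq v j k = ∏ r ∈ Finset.univ.erase k, (1 - v r * x) := by
  have : ∏ r ∈ Finset.univ.erase k, (1 - v r * x) = (Qp v k).eval x := by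
    unfold Qp
    rw [Polynomial.eval_prod]
    simp
  rw [this]
  unfold Mq
  simp only [Matrix.of_apply]
  rw [sum_dl (fun a => x ^ a * (Qp v k).coeff a)]
  rw [Polynomial.eval_eq_sum_range' (n := n)]
  · simp [mul_comm]
  · by_contra hc
    push Not at hc
    have h0 := Qp_natDegree v k hc
    have h1 : Qp v k = 0 := Polynomial.leadingCoeff_eq_zero.1 h0
    rw [h1] at hc
    simp at hc
    have := k.2
    omega

theorem Qp_mul_hv (v : Fin n → S) (k : Fin n) :
    ((Qp v k : Polynomial S) : PowerSeries S) * hv v = PowerSeries.mk fun m => v k ^ m := by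
  unfold Qp hv
  rw [← Finset.mul_prod_erase Finset.univ _ (Finset.mem_univ k), mul_left_comm]
  have h : ((∏ r ∈ Finset.univ.erase k, (1 - Polynomial.C (v r) * Polynomial.X) : Polynomial S) :
      PowerSeries S) = ∏ r ∈ Finset.univ.erase k, (1 - PowerSeries.C (v r) * PowerSeries.X) := by
    rw [← Polynomial.coeToPowerSeries.ringHom_apply, map_prod]
    simp
  rw [h, ← Finset.prod_mul_distrib, Finset.prod_eq_one (fun r _ => geom_mul (v r)), mul_one]

theorem pow_eq_sum_hz (v : Fin n → S) (k : Fin n) (m : ℕ) :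
    v k ^ m = ∑ j : Fin n, hz v ((m : ℤ) - dl n j) * Mq v j k := by
  have h1 : v k ^ m = PowerSeries.coeff m (((Qp v k : Polynomial S) : PowerSeries S) * hv v) := by
    rw [Qp_mul_hv]; simp
  rw [h1, PowerSeries.coeff_mul, Finset.Nat.sum_antidiagonal_eq_sum_range_succ_mk]
  unfold Mq
  simp only [Matrix.of_apply]
  rw [sum_dl (fun a => hz v ((m : ℤ) - a) * (Qp v k).coeff a)]
  have e1 : ∑ a ∈ Finset.range n, hz v ((m : ℤ) - a) * (Qp v k).coeff a =
      ∑ a ∈ Finset.range (n + (m + 1)), hz v ((m : ℤ) - a) * (Qp v k).coeff a := by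
    apply Finset.sum_subset
    · intro a; simp; omega
    · intro a _ ha
      rw [Qp_natDegree v k (by simpa using ha), mul_zero]
  rw [e1]
  symm
  rw [← Finset.sum_subset (s₁ := Finset.range (m + 1))]
  · apply Finset.sum_congr rfl
    intro a ha
    have ha' := Finset.mem_range.1 ha
    unfold hz
    rw [if_pos (by omega)]
    have : ((m : ℤ) - a).toNat = m - a := by omega
    rw [this, Polynomial.coeff_coe, mul_comm]
  · intro a; simp; omega
  · intro a _ ha
    unfold hz
    rw [if_neg, zero_mul]
    simp at ha; omega

theorem hz_zero (v : Fin n → S) : hz v 0 = 1 := by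
  simp [hz, hv, map_prod]

theorem hz_neg (v : Fin n → S) {z : ℤ} (h : z < 0) : hz v z = 0 := by
  unfold hz; rw [if_neg (by omega)]

theorem alt_eq_det_mul (v : Fin n → S) (b : Fin n → ℕ) :
    alt v b = Matrix.det (Matrix.of fun i j => hz v ((b i : ℤ) - dl n j)) * (Mq v).det := by
  rw [← Matrix.det_mul]
  unfold alt
  rw [← Matrix.det_transpose]
  congr 1
  ext i k
  simp only [Matrix.transpose_apply, Matrix.of_apply, Matrix.mul_apply]
  exact pow_eq_sum_hz v k (b i)

theorem det_Mq (v : Fin n → S) : (Mq v).det = av v := by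
  have h : Matrix.det (Matrix.of fun i j : Fin n => hz v ((dl n i : ℤ) - dl n j)) = 1 := by
    rw [Matrix.det_of_isUpperTriangular]
    · simp [hz_zero]
    · intro i j hij
      have hij' : (j : ℕ) < i := hij
      simp only [Matrix.of_apply]
      apply hz_neg
      have := i.2
      have := j.2
      unfold dl
      omega
  unfold av
  rw [alt_eq_det_mul, h, one_mul]

theorem jacobi_trudi (v : Fin n → S) (b : Fin n → ℕ) :
    alt v b = Matrix.det (Matrix.of fun i j => hz v ((b i : ℤ) - dl n j)) * av v := by
  rw [alt_eq_det_mul, det_Mq]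

end Alt

end HF
end

open MvPolynomial

noncomputable section
set_option linter.unusedSectionVars false
namespace HF

/-! ### The series of complete symmetric functions under a character -/

section HSsec
variable {R : Type} [Field R] [CharZero R]

/-- `∑ h_n[χ] ε^n`. -/
def HS (χ : ℕ+ → R) : PowerSeries R := PowerSeries.mk fun n => eval χ (hsym (R := R) n)

theorem HS_coeff_zero (χ : ℕ+ → R) : PowerSeries.coeff 0 (HS χ) = 1 := by
  simp [HS, hsym]

theorem HS_rec (χ : ℕ+ → R) (n : ℕ) :
    ((n : R) + 1) * PowerSeries.coeff (n + 1) (HS χ) =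
      ∑ i ∈ Finset.range (n + 1), χ (Nat.succPNat i) * PowerSeries.coeff (n - i) (HS χ) := by
  simp only [HS, PowerSeries.coeff_mk]
  rw [hsym, smul_eval, map_sum, ← mul_assoc, mul_inv_cancel₀ (by exact_mod_cast Nat.succ_ne_zero n),
    one_mul]
  apply Finset.sum_congr rfl
  intro i _
  rw [map_mul]
  congr 1
  exact eval_X _

theorem HS_unique (χ : ℕ+ → R) (F : PowerSeries R) (h0 : PowerSeries.coeff 0 F = 1)
    (h : ∀ n : ℕ, ((n : R) + 1) * PowerSeries.coeff (n + 1) F =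
      ∑ i ∈ Finset.range (n + 1), χ (Nat.succPNat i) * PowerSeries.coeff (n - i) F) :
    F = HS χ := by
  ext n
  induction n using Nat.strong_induction_on with
  | _ n ih =>
    rcases n with _ | n
    · rw [h0, HS_coeff_zero]
    · have hne : (n : R) + 1 ≠ 0 := by exact_mod_cast Nat.succ_ne_zero n
      apply mul_left_cancel₀ hne
      rw [h, HS_rec]
      apply Finset.sum_congr rfl
      intro i _
      rw [ih (n - i) (by omega)]

theorem HS_deriv_iff (χ : ℕ+ → R) (F : PowerSeries R) :
    (∀ n : ℕ, ((n : R) + 1) * PowerSeries.coeff (n + 1) F =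
      ∑ i ∈ Finset.range (n + 1), χ (Nat.succPNat i) * PowerSeries.coeff (n - i) F) ↔
    PowerSeries.derivative R F = (PowerSeries.mk fun i => χ (Nat.succPNat i)) * F := by
  rw [PowerSeries.ext_iff]
  apply forall_congr'
  intro n
  rw [PowerSeries.coeff_derivative, PowerSeries.coeff_mul,
    Finset.Nat.sum_antidiagonal_eq_sum_range_succ_mk, mul_comm]
  simp

theorem HS_deriv (χ : ℕ+ → R) :
    PowerSeries.derivative R (HS χ) = (PowerSeries.mk fun i => χ (Nat.succPNat i)) * HS χ :=
  (HS_deriv_iff χ _).1 (HS_rec χ)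

theorem HS_add (χ χ' : ℕ+ → R) : HS (fun k => χ k + χ' k) = HS χ * HS χ' := by
  symm
  apply HS_unique
  · rw [PowerSeries.coeff_mul]
    simp [HS_coeff_zero]
  · refine (HS_deriv_iff (fun k => χ k + χ' k) _).2 ?_
    rw [Derivation.leibniz, HS_deriv, HS_deriv]
    have : (PowerSeries.mk fun i => χ (Nat.succPNat i) + χ' (Nat.succPNat i)) =
      (PowerSeries.mk fun i => χ (Nat.succPNat i)) +
        (PowerSeries.mk fun i => χ' (Nat.succPNat i)) := by
      ext; simp
    rw [this]
    simp only [smul_eq_mul]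
    ring

theorem HS_zero : HS (fun _ => (0 : R)) = 1 := by
  symm
  apply HS_unique
  · simp
  · intro n
    simp [PowerSeries.coeff_one]

theorem HS_sum {ι : Type} (s : Finset ι) (χ : ι → ℕ+ → R) :
    HS (fun k => ∑ i ∈ s, χ i k) = ∏ i ∈ s, HS (χ i) := by
  classical
  induction s using Finset.induction_on with
  | empty => simpa using HS_zero
  | insert a s ha ih =>
    rw [Finset.prod_insert ha, ← ih, ← HS_add]
    congr 1
    ext k
    rw [Finset.sum_insert ha]

theorem HS_geom (a : R) : HS (fun k => a ^ (k : ℕ)) = PowerSeries.mk fun m => a ^ m := by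
  symm
  apply HS_unique
  · simp
  · intro n
    simp only [PowerSeries.coeff_mk, Nat.succPNat_coe, ← pow_add]
    rw [Finset.sum_congr rfl (g := fun _ => a ^ (n + 1))]
    · simp
    · intro i hi
      have := Finset.mem_range.1 hi
      congr 1
      omega

theorem HS_geom_mul (a : R) :
    (1 - PowerSeries.C a * PowerSeries.X) * HS (fun k => a ^ (k : ℕ)) = 1 := by
  rw [HS_geom, geom_mul]

theorem HS_pw {n : ℕ} (v : Fin n → R) : HS (pw v) = hv v := by
  unfold hv
  have : pw v = fun k : ℕ+ => ∑ i, v i ^ (k : ℕ) := rfl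
  rw [this, HS_sum Finset.univ (fun i (k : ℕ+) => v i ^ (k : ℕ))]
  simp only [HS_geom]

theorem eval_hInt {n : ℕ} (v : Fin n → R) (z : ℤ) : eval (pw v) (hInt (R := R) z) = hz v z := by
  unfold hInt hz
  split_ifs
  · rw [← HS_pw]; simp [HS]
  · simp

/-! ### Schur functions as ratios of alternants -/

/-- `δ + λ`. -/
def dlp (n : ℕ) (lam : Multiset ℕ+) (j : Fin n) : ℕ := dl n j + part lam j

theorem det_pad (lam : Multiset ℕ+) (h : ℤ → R) (h0 : h 0 = 1) (hneg : ∀ z, z < 0 → h z = 0)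
    (k : ℕ) :
    Matrix.det (Matrix.of fun i j : Fin (Multiset.card lam + k) =>
      h ((part lam i : ℤ) + j - i)) =
    Matrix.det (Matrix.of fun i j : Fin (Multiset.card lam) =>
      h ((part lam i : ℤ) + j - i)) := by
  induction k with
  | zero => rfl
  | succ k ih =>
    rw [← ih]
    have : (Multiset.card lam + (k + 1)) = (Multiset.card lam + k) + 1 := rfl
    change Matrix.det (Matrix.of fun i j : Fin (Multiset.card lam + k + 1) =>
      h ((part lam i : ℤ) + j - i)) = _
    rw [Matrix.det_succ_row _ (Fin.last _), Finset.sum_eq_single (Fin.last _)]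
    · have e : part lam (Multiset.card lam + k) = 0 := part_ge lam (by omega)
      simp only [Matrix.of_apply, Fin.val_last, e]
      simp only [Nat.cast_zero, zero_add, sub_self, h0, mul_one]
      rw [← two_mul, pow_mul]
      simp only [even_two, Even.neg_pow, one_pow, one_mul]
      congr 1
      ext i j
      simp [Matrix.submatrix, Fin.succAbove_last]
    · intro j _ hj
      have e : part lam (Multiset.card lam + k) = 0 := part_ge lam (by omega)
      have : (j : ℕ) < Multiset.card lam + k := by
        have h1 := j.2
        have h2 : (j : ℕ) ≠ Multiset.card lam + k := fun h => hj (Fin.ext h)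
        omega
      simp only [Matrix.of_apply, Fin.val_last, e]
      rw [hneg _ (by push_cast; omega)]
      simp
    · simp

theorem eval_schur_det {n : ℕ} (v : Fin n → R) (lam : Multiset ℕ+) :
    eval (pw v) (schur (R := R) lam) =
      Matrix.det (Matrix.of fun i j : Fin (Multiset.card lam) =>
        hz v ((part lam i : ℤ) + j - i)) := by
  unfold schur
  rw [RingHom.map_det]
  congr 1
  ext i j
  simp only [RingHom.mapMatrix_apply, Matrix.map_apply, Matrix.of_apply]
  rw [eval_hInt]
  rfl

theorem schur_alt {n : ℕ} (v : Fin n → R) (lam : Multiset ℕ+) (h : Multiset.card lam ≤ n) :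
    alt v (dlp n lam) = eval (pw v) (schur (R := R) lam) * av v := by
  rw [jacobi_trudi, eval_schur_det]
  congr 1
  obtain ⟨k, rfl⟩ := Nat.exists_eq_add_of_le h
  rw [← det_pad lam (hz v) (hz_zero v) (fun z hz => hz_neg v hz) k]
  congr 1
  ext i j
  simp only [Matrix.of_apply]
  congr 1
  unfold dlp dl
  have := i.2
  have := j.2
  push_cast
  omega

end HSsec

section PolyFun
variable {R : Type} [Field R] [CharZero R] {n : ℕ}

/-- Polynomial functions. -/
def IsPoly (f : (Fin n → R) → R) : Prop := ∃ p : MvPolynomial (Fin n) R, ∀ v, f v = eval v p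

theorem eval_alt (v : Fin n → R) (b : Fin n → ℕ) :
    eval v (alt (fun i => (X i : MvPolynomial (Fin n) R)) b) = alt v b := by
  unfold alt
  rw [RingHom.map_det]
  congr 1
  ext i j
  simp

theorem isPoly_alt (b : Fin n → ℕ) : IsPoly (fun v : Fin n → R => alt v b) :=
  ⟨_, fun v => (eval_alt v b).symm⟩

theorem isPoly_eval (f : SymFn R) : IsPoly (fun v : Fin n → R => eval (pw v) f) := by
  refine ⟨aeval (fun k : ℕ+ => ∑ i, (X i : MvPolynomial (Fin n) R) ^ (k : ℕ)) f, fun v => ?_⟩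
  rw [aeval_def, ← coe_eval₂Hom, ← RingHom.comp_apply]
  change (eval (pw v)) f = _
  congr 1
  apply MvPolynomial.ringHom_ext
  · intro r; simp
  · intro k; simp [pw]

theorem IsPoly.sub {f g : (Fin n → R) → R} (hf : IsPoly f) (hg : IsPoly g) :
    IsPoly (fun v => f v - g v) := by
  obtain ⟨p, hp⟩ := hf
  obtain ⟨p', hp'⟩ := hg
  exact ⟨p - p', fun v => by simp [hp, hp']⟩

theorem IsPoly.mul {f g : (Fin n → R) → R} (hf : IsPoly f) (hg : IsPoly g) :
    IsPoly (fun v => f v * g v) := by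
  obtain ⟨p, hp⟩ := hf
  obtain ⟨p', hp'⟩ := hg
  exact ⟨p * p', fun v => by simp [hp, hp']⟩

theorem IsPoly.const_mul {f : (Fin n → R) → R} (c : R) (hf : IsPoly f) :
    IsPoly (fun v => c * f v) := by
  obtain ⟨p, hp⟩ := hf
  exact ⟨C c * p, fun v => by simp [hp]⟩

theorem IsPoly.sum {ι : Type} (s : Finset ι) (f : ι → (Fin n → R) → R) (hf : ∀ i ∈ s, IsPoly (f i)) :
    IsPoly (fun v => ∑ i ∈ s, f i v) := by
  classical
  choose! p hp using hf
  refine ⟨∑ i ∈ s, p i, fun v => ?_⟩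
  rw [map_sum]
  exact Finset.sum_congr rfl fun i hi => hp i hi v

theorem isPoly_prod : IsPoly (fun v : Fin n → R => ∏ i, v i) :=
  ⟨∏ i, X i, fun v => by simp⟩

theorem isPoly_orb (b : Fin n → ℕ) : IsPoly (fun v : Fin n → R => orb b v) :=
  ⟨∑ τ : Equiv.Perm (Fin n), ∏ i, X i ^ b (τ i), fun v => by simp [orb]⟩

theorem strictAnti_perm {b b' : Fin n → ℕ} (hb : StrictAnti b) (hb' : StrictAnti b')
    {σ : Equiv.Perm (Fin n)} (h : b ∘ σ = b') : σ = 1 := by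
  have h1 : StrictMono σ := by
    intro i j hij
    by_contra hc
    push Not at hc
    have h2 := hb.antitone hc
    have h3 := hb' hij
    rw [← h] at h3
    simp only [Function.comp] at h3
    omega
  ext i
  have := Subsingleton.elim (StrictMono.orderIsoOfSurjective σ h1 σ.surjective) (OrderIso.refl _)
  have h4 := DFunLike.congr_fun this i
  exact congrArg Fin.val h4

theorem coeff_alt {b b' : Fin n → ℕ} (hb : StrictAnti b) (hb' : StrictAnti b') :
    coeff (Finsupp.equivFunOnFinite.symm b') (alt (fun i => (X i : MvPolynomial (Fin n) R)) b) =
      if b = b' then 1 else 0 := by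
  rw [alt_eq, coeff_sum]
  have hm : ∀ σ : Equiv.Perm (Fin n), (∏ i, (X i : MvPolynomial (Fin n) R) ^ b (σ i)) =
      monomial (Finsupp.equivFunOnFinite.symm (b ∘ σ)) 1 := by
    intro σ
    rw [monomial_eq, Finsupp.prod_fintype _ _ (by simp)]
    simp
  have hc : ∀ σ : Equiv.Perm (Fin n), coeff (Finsupp.equivFunOnFinite.symm b')
      (((Equiv.Perm.sign σ : ℤ) : MvPolynomial (Fin n) R) *
        ∏ i, (X i : MvPolynomial (Fin n) R) ^ b (σ i)) =
      if b ∘ σ = b' then ((Equiv.Perm.sign σ : ℤ) : R) else 0 := by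
    intro σ
    rw [hm]
    have : ((Equiv.Perm.sign σ : ℤ) : MvPolynomial (Fin n) R) = C ((Equiv.Perm.sign σ : ℤ) : R) := by
      simp
    rw [this, coeff_C_mul, coeff_monomial]
    simp
  simp only [hc]
  rw [Finset.sum_eq_single 1]
  · simp
  · intro σ _ hσ
    rw [if_neg]
    intro h
    exact hσ (strictAnti_perm hb hb' h)
  · simp

theorem dl_strictAnti : StrictAnti (dl n) := by
  intro i j hij
  have : (i : ℕ) < j := hij
  have := j.2
  unfold dl
  omega

theorem dlp_strictAnti (lam : Multiset ℕ+) : StrictAnti (dlp n lam) := by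
  intro i j hij
  have h1 := dl_strictAnti hij
  have h2 := part_antitone lam (show (i : ℕ) ≤ j from hij.le)
  unfold dlp
  omega

theorem dlp_inj {lam mu : Multiset ℕ+} (h1 : Multiset.card lam ≤ n) (h2 : Multiset.card mu ≤ n)
    (h : dlp n lam = dlp n mu) : lam = mu := by
  apply part_inj
  intro i
  by_cases hi : i < n
  · have := congrFun h ⟨i, hi⟩
    simp only [dlp] at this
    omega
  · rw [part_ge lam (by omega), part_ge mu (by omega)]

theorem av_cancel {f : (Fin n → R) → R} (hf : IsPoly f) (h : ∀ v, f v * av v = 0) (v : Fin n → R) :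
    f v = 0 := by
  obtain ⟨p, hp⟩ := hf
  have h1 : p * alt (fun i => (X i : MvPolynomial (Fin n) R)) (dl n) = 0 := by
    apply MvPolynomial.funext
    intro w
    rw [map_mul, eval_alt, ← hp, map_zero]
    exact h w
  have h2 : alt (fun i => (X i : MvPolynomial (Fin n) R)) (dl n) ≠ 0 := by
    intro h0
    have := coeff_alt (R := R) (dl_strictAnti (n := n)) dl_strictAnti
    rw [h0] at this
    simp at this
  rw [hp, (mul_eq_zero.1 h1).resolve_right h2, map_zero]

theorem av_cancel_eq {f g : (Fin n → R) → R} (hf : IsPoly f) (hg : IsPoly g)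
    (h : ∀ v, f v * av v = g v * av v) (v : Fin n → R) : f v = g v := by
  have := av_cancel (hf.sub hg) (fun v => by rw [sub_mul, h, sub_self]) v
  exact sub_eq_zero.1 this

theorem alt_indep (s : Finset (Multiset ℕ+)) (hs : ∀ k ∈ s, Multiset.card k ≤ n)
    (b : Multiset ℕ+ → R) (h : ∀ v : Fin n → R, ∑ k ∈ s, b k * alt v (dlp n k) = 0) :
    ∀ k ∈ s, b k = 0 := by
  intro k hk
  have h1 : ∑ k ∈ s, C (b k) * alt (fun i => (X i : MvPolynomial (Fin n) R)) (dlp n k) = 0 := by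
    apply MvPolynomial.funext
    intro w
    rw [map_sum, map_zero, ← h w]
    apply Finset.sum_congr rfl
    intro k _
    rw [map_mul, eval_alt, eval_C]
  have h2 := congrArg (coeff (Finsupp.equivFunOnFinite.symm (dlp n k))) h1
  rw [coeff_sum, coeff_zero, Finset.sum_eq_single k] at h2
  · rw [coeff_C_mul, coeff_alt (dlp_strictAnti k) (dlp_strictAnti k), if_pos rfl, mul_one] at h2
    exact h2
  · intro k' hk' hne
    rw [coeff_C_mul, coeff_alt (dlp_strictAnti k') (dlp_strictAnti k), if_neg, mul_zero]
    intro hd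
    exact hne (dlp_inj (hs k' hk') (hs k hk) hd)
  · intro h; exact absurd hk h

theorem schur_indep (s : Finset (Multiset ℕ+)) (hs : ∀ k ∈ s, Multiset.card k ≤ n)
    (b : Multiset ℕ+ → R)
    (h : ∀ v : Fin n → R, ∑ k ∈ s, b k * eval (pw v) (schur (R := R) k) = 0) :
    ∀ k ∈ s, b k = 0 := by
  apply alt_indep (n := n) s hs b
  intro v
  have := congrArg (· * av v) (h v)
  simp only [zero_mul, Finset.sum_mul] at this
  rw [← this]
  apply Finset.sum_congr rfl
  intro k hk
  rw [schur_alt v k (hs k hk), mul_assoc]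

/-- Column addition for Schur polynomials. -/
theorem schur_column {lam kap : Multiset ℕ+} (hk : Multiset.card kap ≤ n)
    (hl : Multiset.card lam ≤ n)
    (h : ∀ i, i < n → part lam i = part kap i + 1) (v : Fin n → R) :
    eval (pw v) (schur (R := R) lam) = (∏ i, v i) * eval (pw v) (schur (R := R) kap) := by
  refine av_cancel_eq (isPoly_eval _) (isPoly_prod.mul (isPoly_eval _)) ?_ v
  intro v
  rw [← schur_alt v lam hl, mul_assoc, ← schur_alt v kap hk, ← alt_add_one]
  congr 1
  ext j
  simp only [dlp, h j j.2]
  omega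

theorem exists_column (lam : Multiset ℕ+) : ∃ kap : Multiset ℕ+,
    Multiset.card kap ≤ Multiset.card lam ∧ ∀ i, part kap i = part lam i - 1 := by
  apply exists_part
  · intro i j hij
    have := part_antitone lam hij
    simp only
    omega
  · intro i hi
    rw [part_ge lam hi]

theorem pw_append_zero {m k : ℕ} (v : Fin m → R) :
    pw (Fin.append v (fun _ : Fin k => (0 : R))) = pw v := by
  funext j
  unfold pw
  rw [Fin.sum_univ_add]
  simp

theorem schur_vanish {lam : Multiset ℕ+} (h : n < Multiset.card lam) (v : Fin n → R) :
    eval (pw v) (schur (R := R) lam) = 0 := by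
  obtain ⟨k, hk⟩ := Nat.exists_eq_add_of_lt h
  obtain ⟨kap, hk1, hk2⟩ := exists_column lam
  have e : Multiset.card lam = n + (k + 1) := by omega
  rw [← pw_append_zero (k := k + 1) v]
  rw [schur_column (kap := kap) (by omega) (by omega)]
  · rw [Fin.prod_univ_add]
    simp
  · intro i hi
    rw [hk2]
    have := part_pos lam (i := i) (by omega)
    omega

end PolyFun
end HF
end

open MvPolynomial

noncomputable section
set_option linter.unusedSectionVars false
namespace HF

/-! ### Triangularity of the Macdonald operator on Schur polynomials -/

theorem strictAnti_gap {n : ℕ} {c : Fin n → ℕ} (hc : StrictAnti c) {i j : Fin n} (hij : i ≤ j) :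
    c j + ((j : ℕ) - i) ≤ c i := by
  obtain ⟨i, hi⟩ := i
  obtain ⟨j, hj⟩ := j
  have hij' : i ≤ j := hij
  obtain ⟨k, rfl⟩ := Nat.exists_eq_add_of_le hij'
  clear hij hij'
  induction k with
  | zero => simp
  | succ k ih =>
    have h1 := ih (by omega)
    have h2 := hc (show (⟨i + k, by omega⟩ : Fin n) < ⟨i + (k + 1), hj⟩ from by
      simp [Fin.lt_def])
    simp only at h1 h2 ⊢
    omega

theorem exists_dlp {n : ℕ} {c : Fin n → ℕ} (hc : StrictAnti c) :
    ∃ k : Multiset ℕ+, Multiset.card k ≤ n ∧ dlp n k = c := by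
  have hge : ∀ i : Fin n, dl n i ≤ c i := by
    intro i
    have hi := i.2
    have := strictAnti_gap hc (show i ≤ ⟨n - 1, by omega⟩ from by simp [Fin.le_def]; omega)
    simp only at this
    unfold dl
    omega
  obtain ⟨k, hk1, hk2⟩ := exists_part (fun i => if h : i < n then c ⟨i, h⟩ - dl n ⟨i, h⟩ else 0)
    (by
      intro i j hij
      simp only
      by_cases hj : j < n
      · have hi : i < n := by omega
        rw [dif_pos hj, dif_pos hi]
        have h1 := strictAnti_gap hc (show (⟨i, hi⟩ : Fin n) ≤ ⟨j, hj⟩ from hij)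
        have h2 := hge ⟨i, hi⟩
        have h3 := hge ⟨j, hj⟩
        simp only [dl] at h1 h2 h3 ⊢
        omega
      · rw [dif_neg hj]; exact Nat.zero_le _) n
    (by intro i hi; rw [dif_neg (by omega)])
  refine ⟨k, hk1, ?_⟩
  funext j
  have := hk2 j
  rw [dif_pos j.2] at this
  unfold dlp
  rw [this]
  have := hge j
  simp only [Fin.eta]
  omega

theorem sum_dlp {n : ℕ} (k : Multiset ℕ+) (hk : Multiset.card k ≤ n) :
    ∑ j, dlp n k j = wt k + ∑ j, dl n j := by
  unfold dlp
  rw [Finset.sum_add_distrib, add_comm]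
  congr 1
  rw [← sum_part k n hk, Finset.sum_range]

theorem Phi_eq {n : ℕ} (k : Multiset ℕ+) : Phi n k = ∑ j, dlp n k j ^ 2 := by
  unfold Phi
  rw [Finset.sum_range]
  apply Finset.sum_congr rfl
  intro j _
  unfold dlp dl
  rw [add_comm]

section Tri
variable {R : Type} [Field R] [CharZero R] {n : ℕ}

/-- Span of alternants of given degree and bounded `Phi`. -/
def Low (R : Type) [Field R] (n d N : ℕ) : Submodule R ((Fin n → R) → R) :=
  Submodule.span R {f | ∃ k : Multiset ℕ+, Multiset.card k ≤ n ∧ wt k = d ∧ Phi n k < N ∧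
    f = fun v => alt v (dlp n k)}

theorem Low_mono {d N N' : ℕ} (h : N ≤ N') : Low R n d N ≤ Low R n d N' := by
  apply Submodule.span_mono
  rintro f ⟨k, h1, h2, h3, h4⟩
  exact ⟨k, h1, h2, by omega, h4⟩

theorem alt_mem_Low {d N : ℕ} (b : Fin n → ℕ) (h1 : ∑ j, b j = d + ∑ j, dl n j)
    (h2 : ∑ j, b j ^ 2 < N) : (fun v => alt v b) ∈ Low R n d N := by
  by_cases hb : Function.Injective b
  · let σ : Equiv.Perm (Fin n) := Fin.revPerm.trans (Tuple.sort b)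
    have hanti : StrictAnti (b ∘ σ) := by
      have ha : Antitone (b ∘ σ) := by
        intro i j hij
        exact Tuple.monotone_sort b (Fin.rev_le_rev.2 hij)
      exact ha.strictAnti_of_injective (hb.comp σ.injective)
    obtain ⟨k, hk1, hk2⟩ := exists_dlp hanti
    have h3 : (fun v : Fin n → R => alt v b) =
        ((Equiv.Perm.sign σ : ℤ) : R) • fun v => alt v (dlp n k) := by
      funext v
      simp only [Pi.smul_apply, smul_eq_mul]
      rw [hk2, alt_perm, ← mul_assoc, ← Int.cast_mul, ← Units.val_mul, Int.units_mul_self]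
      simp
    rw [h3]
    apply Submodule.smul_mem
    apply Submodule.subset_span
    refine ⟨k, hk1, ?_, ?_, rfl⟩
    · have := sum_dlp k hk1
      rw [hk2] at this
      rw [show (∑ j, (b ∘ σ) j) = ∑ j, b j from Equiv.sum_comp σ b] at this
      omega
    · rw [Phi_eq, hk2]
      rw [show (∑ j, (b ∘ σ) j ^ 2) = ∑ j, b j ^ 2 from Equiv.sum_comp σ (fun j => b j ^ 2)]
      exact h2
  · have : (fun v : Fin n → R => alt v b) = 0 := by
      funext v; exact alt_not_inj v b hb
    rw [this]
    exact Submodule.zero_mem _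

theorem rearr (b : Fin n → ℕ) (hb : Antitone b) (τ : Equiv.Perm (Fin n)) :
    b ∘ τ = b ∨ ∑ j, (dl n j + b (τ j)) ^ 2 < ∑ j, (dl n j + b j) ^ 2 := by
  by_cases hm : Monovary (dl n) (b ∘ τ)
  · left
    have ha : Antitone (b ∘ τ) := by
      intro i j hij
      by_contra hc
      push Not at hc
      have h1 := hm hc
      have hne : i ≠ j := by rintro rfl; omega
      have h2 := dl_strictAnti (n := n) (lt_of_le_of_ne hij hne)
      omega
    have := Tuple.unique_monotone (f := OrderDual.toDual ∘ b) (σ := τ) (τ := 1)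
      (by intro i j hij; exact ha hij) (by intro i j hij; exact hb hij)
    exact this
  · right
    have hmono : Monovary (dl n) b := by
      intro i j hij
      by_contra hc
      push Not at hc
      have h2 : i < j := by
        by_contra h3
        push Not at h3
        have := (dl_strictAnti (n := n)).antitone h3
        omega
      have := hb h2.le
      omega
    have h := (Monovary.sum_mul_comp_perm_lt_sum_mul_iff (σ := τ) hmono).2 hm
    have e : ∑ j, b (τ j) ^ 2 = ∑ j, b j ^ 2 := Equiv.sum_comp τ (fun j => b j ^ 2)
    have h3 : ∀ c : Fin n → ℕ, ∑ j, (dl n j + c j) ^ 2 =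
        ∑ j, dl n j ^ 2 + 2 * ∑ j, dl n j * c j + ∑ j, c j ^ 2 := by
      intro c
      rw [Finset.mul_sum, ← Finset.sum_add_distrib, ← Finset.sum_add_distrib]
      exact Finset.sum_congr rfl fun j _ => by ring
    rw [h3 (fun j => b (τ j)), h3 b]
    omega

/-- The operator as a linear map. -/
def aDL (q t x : R) : ((Fin n → R) → R) →ₗ[R] ((Fin n → R) → R) where
  toFun := aDf q t x
  map_add' f g := by
    funext v
    simp only [aDf, Pi.add_apply, mul_add, Finset.sum_add_distrib]
  map_smul' c f := by
    funext v
    simp only [aDf, Pi.smul_apply, smul_eq_mul, Finset.mul_sum, RingHom.id_apply]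
    exact Finset.sum_congr rfl fun s _ => by ring

theorem aDL_apply (q t x : R) (f : (Fin n → R) → R) (v : Fin n → R) :
    aDL q t x f v = aDf q t x f v := rfl

theorem aDf_zero (q t : R) (f : (Fin n → R) → R) (v : Fin n → R) :
    aDf q t 0 f v = av v * f v := by
  unfold aDf
  rw [Finset.sum_eq_single (fun _ => false)]
  · have : ∀ c : R, sc (fun _ => false) c v = v := by intro c; funext i; simp [sc]
    simp [this]
  · intro s _ hs
    have : ∃ i, s i = true := by
      by_contra hc
      push Not at hc
      apply hs
      funext i
      simpa using hc i
    obtain ⟨i, hi⟩ := this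
    rw [Finset.prod_eq_zero (Finset.mem_univ i) (by simp [hi])]
    simp
  · simp

/-- Eigenvalue generating function. -/
def Ev (n : ℕ) (q t : R) (lam : Multiset ℕ+) (x : R) : R :=
  ∏ i ∈ Finset.range n, (1 + x * t ^ (n - 1 - i) * q ^ part lam i)

theorem Ev_zero (q t : R) (lam : Multiset ℕ+) : Ev n q t lam 0 = 1 := by simp [Ev]

/-- Evaluation of a symmetric function on `n` variables. -/
def fn (n : ℕ) (f : SymFn R) : (Fin n → R) → R := fun v => eval (pw v) f

theorem orb_split (q t x : R) (lam : Multiset ℕ+) (hl : Multiset.card lam ≤ n) :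
    aDL q t x (orb fun j : Fin n => part lam j) -
      ((Finset.univ.filter fun τ : Equiv.Perm (Fin n) =>
        (fun j : Fin n => part lam j) ∘ τ = fun j : Fin n => part lam j).card : R) •
        (Ev n q t lam x • fun v => alt v (dlp n lam)) ∈ Low R n (wt lam) (Phi n lam) := by
  set b : Fin n → ℕ := fun j => part lam j with hbdef
  have hb : Antitone b := fun i j hij => part_antitone lam hij
  have h1 : aDL q t x (orb b) = ∑ τ : Equiv.Perm (Fin n),
      (∏ j, (1 + x * t ^ dl n j * q ^ b (τ j))) • fun v : Fin n → R =>
        alt v (fun j => dl n j + b (τ j)) := by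
    funext v
    rw [aDL_apply, aDf_orb]
    simp [Finset.sum_apply]
  rw [h1, ← Finset.sum_filter_add_sum_filter_not Finset.univ
    (fun τ : Equiv.Perm (Fin n) => b ∘ τ = b)]
  have h2 : ∀ τ ∈ Finset.univ.filter (fun τ : Equiv.Perm (Fin n) => b ∘ τ = b),
      ((∏ j, (1 + x * t ^ dl n j * q ^ b (τ j))) • fun v : Fin n → R =>
        alt v (fun j => dl n j + b (τ j))) = (Ev n q t lam x • fun v => alt v (dlp n lam)) := by
    intro τ hτ
    have hτ' : ∀ j, b (τ j) = b j := fun j => congrFun (Finset.mem_filter.1 hτ).2 j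
    simp only [hτ']
    congr 1
    unfold Ev
    rw [Finset.prod_range]
    rfl
  rw [Finset.sum_congr rfl h2, Finset.sum_const, ← Nat.cast_smul_eq_nsmul R, add_sub_cancel_left]
  apply Submodule.sum_mem
  intro τ hτ
  apply Submodule.smul_mem
  apply alt_mem_Low
  · rw [Finset.sum_add_distrib, add_comm]
    congr 1
    rw [Equiv.sum_comp τ b, ← sum_part lam n hl, Finset.sum_range]
  · have := (rearr b hb τ).resolve_left (Finset.mem_filter.1 hτ).2
    rw [Phi_eq]
    exact this

theorem schur_tri (q t x : R) (lam : Multiset ℕ+) (hl : Multiset.card lam ≤ n) :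
    aDL q t x (fn n (schur lam)) - (Ev n q t lam x • fun v => alt v (dlp n lam)) ∈
      Low R n (wt lam) (Phi n lam) := by
  induction hN : Phi n lam using Nat.strong_induction_on generalizing lam with
  | _ N ih =>
    subst hN
    set b : Fin n → ℕ := fun j => part lam j with hbdef
    have hx := orb_split q t x lam hl
    have h0 := orb_split q t 0 lam hl
    set c : ℕ := (Finset.univ.filter fun τ : Equiv.Perm (Fin n) => b ∘ τ = b).card with hc
    have hcpos : (c : R) ≠ 0 := by
      have : 0 < c := Finset.card_pos.2 ⟨1, by simp⟩
      exact_mod_cast this.ne'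
    rw [Ev_zero, one_smul] at h0
    have key : ∀ r ∈ Low R n (wt lam) (Phi n lam), ∃ r' : (Fin n → R) → R, IsPoly r' ∧
        (∀ v, r v = r' v * av v) ∧ aDL q t x r' ∈ Low R n (wt lam) (Phi n lam) := by
      intro r hr
      unfold Low at hr
      induction hr using Submodule.span_induction with
      | mem r hr =>
        obtain ⟨k, hk1, hk2, hk3, rfl⟩ := hr
        refine ⟨fn n (schur k), isPoly_eval _, fun v => schur_alt v k hk1, ?_⟩
        have h := ih (Phi n k) hk3 k hk1 rfl
        rw [hk2] at h
        have h' := Low_mono hk3.le h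
        have h2 : (Ev n q t k x • fun v : Fin n → R => alt v (dlp n k)) ∈
            Low R n (wt lam) (Phi n lam) :=
          Submodule.smul_mem _ _ (Submodule.subset_span ⟨k, hk1, hk2, hk3, rfl⟩)
        simpa using Submodule.add_mem _ h' h2
      | zero => exact ⟨0, ⟨0, by simp⟩, by simp, by simp⟩
      | add r1 r2 _ _ h1 h2 =>
        obtain ⟨r1', p1, e1, m1⟩ := h1
        obtain ⟨r2', p2, e2, m2⟩ := h2
        refine ⟨r1' + r2', ?_, ?_, ?_⟩
        · obtain ⟨a1, ha1⟩ := p1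
          obtain ⟨a2, ha2⟩ := p2
          exact ⟨a1 + a2, fun v => by simp [ha1, ha2]⟩
        · intro v; simp [e1, e2, add_mul]
        · rw [map_add]; exact Submodule.add_mem _ m1 m2
      | smul a r1 _ h1 =>
        obtain ⟨r1', p1, e1, m1⟩ := h1
        refine ⟨a • r1', p1.const_mul a, ?_, ?_⟩
        · intro v; simp [e1, mul_assoc]
        · rw [map_smul]; exact Submodule.smul_mem _ _ m1
    obtain ⟨r', p', e', m'⟩ := key _ h0
    have horb : (orb b : (Fin n → R) → R) = (c : R) • fn n (schur lam) + r' := by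
      funext v
      have hp : IsPoly (((c : R) • fn n (schur lam) + r' : (Fin n → R) → R)) := by
        obtain ⟨a1, ha1⟩ := (isPoly_eval (n := n) (schur (R := R) lam)).const_mul (c : R)
        obtain ⟨a2, ha2⟩ := p'
        refine ⟨a1 + a2, fun v => ?_⟩
        rw [map_add, ← ha1, ← ha2]
        rfl
      refine av_cancel_eq (isPoly_orb b) hp ?_ v
      intro w
      have h3 := e' w
      simp only [Pi.sub_apply, Pi.smul_apply, smul_eq_mul, aDL_apply, aDf_zero] at h3
      rw [schur_alt w lam hl] at h3
      simp only [Pi.add_apply, Pi.smul_apply, smul_eq_mul, fn]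
      linear_combination h3
    rw [horb, map_add, map_smul] at hx
    have h4 := Submodule.sub_mem _ hx m'
    have h5 := Submodule.smul_mem _ ((c : R)⁻¹) h4
    convert h5 using 1
    rw [add_sub_right_comm, add_sub_cancel_right, ← smul_sub, smul_smul, inv_mul_cancel₀ hcpos,
      one_smul]

end Tri
end HF
end

open MvPolynomial

noncomputable section
set_option linter.unusedSectionVars false
namespace HF

/-! ### Linear algebra in fixed degree -/

/-- Partitions of `d`. -/
def PS (d : ℕ) : Finset (Multiset ℕ+) := partitionsOf d

theorem mem_PS {d : ℕ} {mu : Multiset ℕ+} : mu ∈ PS d ↔ wt mu = d := by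
  have key : ∀ s : Multiset ℕ, ∀ f : {x // x ∈ s} → ℕ+, (∀ a, (f a : ℕ) = a.1) →
      (s.attach.map f).map (fun a : ℕ+ => (a : ℕ)) = s := by
    intro s f h
    have e : ((fun a : ℕ+ => (a : ℕ)) ∘ f) = fun a => a.1 := by
      funext a; exact h a
    rw [Multiset.map_map, e, Multiset.attach_map_val]
  unfold PS partitionsOf
  rw [Finset.mem_image]
  constructor
  · rintro ⟨p, -, rfl⟩
    unfold wt
    exact (congrArg Multiset.sum (key p.parts _ (fun a => rfl))).trans p.parts_sum
  · intro h
    refine ⟨⟨mu.map fun a : ℕ+ => (a : ℕ), ?_, h⟩, Finset.mem_univ _, ?_⟩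
    · intro i hi
      obtain ⟨b, _, rfl⟩ := Multiset.mem_map.1 hi
      exact b.pos
    · apply map_coe_inj
      exact key (mu.map fun a : ℕ+ => (a : ℕ)) _ (fun a => rfl)

section LA
variable {R : Type} [Field R] [CharZero R]

/-- Weighted homogeneous of degree `d`. -/
def Hom (f : SymFn R) (d : ℕ) : Prop := IsWeightedHomogeneous (fun k : ℕ+ => (k : ℕ)) f d

/-- Coefficient of `p_μ`. -/
def cf (f : SymFn R) (mu : Multiset ℕ+) : R := coeff (Multiset.toFinsupp mu) f

/-- The value of `p_μ` under a character. -/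
def mon (χ : ℕ+ → R) (mu : Multiset ℕ+) : R := (mu.map χ).prod

theorem weight_eq (m : ℕ+ →₀ ℕ) :
    Finsupp.weight (fun k : ℕ+ => (k : ℕ)) m = wt (Finsupp.toMultiset m) := by
  unfold wt
  rw [Finsupp.weight_apply, Finset.sum_multiset_map_count]
  simp [Finsupp.sum, Finsupp.toFinset_toMultiset]

theorem Hom.coeff_ne {f : SymFn R} {d : ℕ} (hf : Hom f d) {m : ℕ+ →₀ ℕ} (h : coeff m f ≠ 0) :
    wt (Finsupp.toMultiset m) = d := by
  rw [← weight_eq]; exact hf h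

theorem hom_of {f : SymFn R} {d : ℕ} (h : ∀ mu, cf f mu ≠ 0 → wt mu = d) : Hom f d := by
  intro m hm
  rw [weight_eq]
  apply h
  simpa [cf] using hm

theorem sum_support {A : Type} [AddCommMonoid A] {f : SymFn R} {d : ℕ} (hf : Hom f d)
    (g : (ℕ+ →₀ ℕ) → A) (hg : ∀ m, coeff m f = 0 → g m = 0) :
    ∑ m ∈ f.support, g m = ∑ mu ∈ PS d, g (Multiset.toFinsupp mu) := by
  classical
  rw [← Finset.sum_image (f := g) (g := fun mu : Multiset ℕ+ => Multiset.toFinsupp mu)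
    (s := PS d) (by intro a _ b _ h; exact Multiset.toFinsupp.injective h)]
  apply Finset.sum_subset
  · intro m hm
    rw [Finset.mem_image]
    refine ⟨Finsupp.toMultiset m, mem_PS.2 (hf.coeff_ne (mem_support_iff.1 hm)), by simp⟩
  · intro m _ hm
    exact hg m (notMem_support_iff.1 hm)

theorem eval_eq_sum {f : SymFn R} {d : ℕ} (hf : Hom f d) (χ : ℕ+ → R) :
    eval χ f = ∑ mu ∈ PS d, cf f mu * mon χ mu := by
  rw [eval_eq]
  rw [sum_support hf (fun m => coeff m f * ∏ i ∈ m.support, χ i ^ m i) (by intro m h; simp [h])]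
  apply Finset.sum_congr rfl
  intro mu _
  unfold cf mon
  congr 1
  rw [Finset.prod_multiset_map_count]
  simp [Multiset.toFinsupp_support]

/-- Norm of `p_μ` for the weight `w`. -/
def zz (w : ℕ+ → R) (mu : Multiset ℕ+) : R :=
  ∏ k ∈ mu.toFinset, ((Nat.factorial (mu.count k) : R) * ((k : ℕ) : R) ^ (mu.count k) *
    (w k) ^ (mu.count k))

theorem zz_superset (w : ℕ+ → R) (mu : Multiset ℕ+) (s : Finset ℕ+) (h : mu.toFinset ⊆ s) :
    zz w mu = ∏ k ∈ s, ((Nat.factorial (mu.count k) : R) * ((k : ℕ) : R) ^ (mu.count k) *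
    (w k) ^ (mu.count k)) := by
  apply Finset.prod_subset h
  intro k _ hk
  have : mu.count k = 0 := Multiset.count_eq_zero.2 (fun h => hk (Multiset.mem_toFinset.2 h))
  simp [this]

theorem zz_cons (w : ℕ+ → R) (k : ℕ+) (nu : Multiset ℕ+) :
    zz w (k ::ₘ nu) = zz w nu * (((k : ℕ) : R) * w k * ((nu.count k : R) + 1)) := by
  classical
  have hs : insert k nu.toFinset = (k ::ₘ nu).toFinset := by simp
  rw [zz_superset w nu (insert k nu.toFinset) (Finset.subset_insert _ _),
    zz_superset w (k ::ₘ nu) (insert k nu.toFinset) (by rw [hs])]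
  rw [← Finset.mul_prod_erase _ _ (Finset.mem_insert_self k nu.toFinset),
    ← Finset.mul_prod_erase (insert k nu.toFinset) _ (Finset.mem_insert_self k nu.toFinset)]
  have : ∏ x ∈ (insert k nu.toFinset).erase k,
      ((Nat.factorial ((k ::ₘ nu).count x) : R) * ((x : ℕ) : R) ^ ((k ::ₘ nu).count x) *
        (w x) ^ ((k ::ₘ nu).count x)) = ∏ x ∈ (insert k nu.toFinset).erase k,
      ((Nat.factorial (nu.count x) : R) * ((x : ℕ) : R) ^ (nu.count x) *
        (w x) ^ (nu.count x)) := by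
    apply Finset.prod_congr rfl
    intro x hx
    rw [Multiset.count_cons_of_ne (Finset.ne_of_mem_erase hx)]
  rw [this, Multiset.count_cons_self, Nat.factorial_succ]
  push_cast
  ring

theorem zz_ne_zero (w : ℕ+ → R) (hw : ∀ k, w k ≠ 0) (mu : Multiset ℕ+) : zz w mu ≠ 0 := by
  apply Finset.prod_ne_zero_iff.2
  intro k _
  have h1 : ((k : ℕ) : R) ≠ 0 := by exact_mod_cast k.ne_zero
  have h2 : (Nat.factorial (mu.count k) : R) ≠ 0 := by exact_mod_cast Nat.factorial_ne_zero _
  exact mul_ne_zero (mul_ne_zero h2 (pow_ne_zero _ h1)) (pow_ne_zero _ (hw k))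

theorem zz_scale (w a : ℕ+ → R) (mu : Multiset ℕ+) :
    zz (fun k => a k * w k) mu = mon a mu * zz w mu := by
  unfold zz mon
  rw [Finset.prod_multiset_map_count, ← Finset.prod_mul_distrib]
  apply Finset.prod_congr rfl
  intro k _
  rw [mul_pow]; ring

/-- The degree `d` part of the form. -/
def frm (d : ℕ) (w : ℕ+ → R) (f g : SymFn R) : R := ∑ mu ∈ PS d, cf f mu * cf g mu * zz w mu

theorem innerQT_eq {f : SymFn R} {d : ℕ} (hf : Hom f d) (g : SymFn R) (q t : R) :
    innerQT q t f g = frm d (fun k => (1 - q ^ (k : ℕ)) / (1 - t ^ (k : ℕ))) f g := by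
  unfold innerQT frm
  rw [sum_support hf (fun m => coeff m f * coeff m g * zwtQT q t m) (by intro m h; simp [h])]
  apply Finset.sum_congr rfl
  intro mu _
  unfold cf zz zwtQT
  simp [Multiset.toFinsupp_support]

theorem cf_add (f g : SymFn R) (mu) : cf (f + g) mu = cf f mu + cf g mu := by simp [cf]
theorem cf_smul (c : R) (f : SymFn R) (mu) : cf (c • f) mu = c * cf f mu := by simp [cf]
theorem cf_sum {ι : Type} (s : Finset ι) (f : ι → SymFn R) (mu) :
    cf (∑ i ∈ s, f i) mu = ∑ i ∈ s, cf (f i) mu := by simp [cf, coeff_sum]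

theorem frm_comm (d : ℕ) (w : ℕ+ → R) (f g : SymFn R) : frm d w f g = frm d w g f :=
  Finset.sum_congr rfl fun _ _ => by ring

theorem ext_hom {f g : SymFn R} {d : ℕ} (hf : Hom f d) (hg : Hom g d)
    (h : ∀ mu ∈ PS d, cf f mu = cf g mu) : f = g := by
  ext m
  by_cases hm : wt (Finsupp.toMultiset m) = d
  · have := h _ (mem_PS.2 hm)
    simpa [cf] using this
  · have h1 : coeff m f = 0 := by
      by_contra hc; exact hm (hf.coeff_ne hc)
    have h2 : coeff m g = 0 := by
      by_contra hc; exact hm (hg.coeff_ne hc)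
    rw [h1, h2]

theorem Hom.add {f g : SymFn R} {d : ℕ} (hf : Hom f d) (hg : Hom g d) : Hom (f + g) d :=
  IsWeightedHomogeneous.add hf hg
theorem Hom.smul {f : SymFn R} {d : ℕ} (c : R) (hf : Hom f d) : Hom (c • f) d := by
  intro m hm
  apply hf
  intro h0
  apply hm
  simp [h0]
theorem Hom.sum {ι : Type} (s : Finset ι) (f : ι → SymFn R) {d : ℕ} (hf : ∀ i ∈ s, Hom (f i) d) :
    Hom (∑ i ∈ s, f i) d := IsWeightedHomogeneous.sum _ _ _ hf
theorem Hom.mul {f g : SymFn R} {d e : ℕ} (hf : Hom f d) (hg : Hom g e) : Hom (f * g) (d + e) :=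
  IsWeightedHomogeneous.mul hf hg
theorem hom_zero (d : ℕ) : Hom (0 : SymFn R) d := by intro m hm; simp at hm
theorem hom_one : Hom (1 : SymFn R) 0 := isWeightedHomogeneous_one R _

/-- The matrix of coefficients in degree `d`. -/
def cmat (d : ℕ) (P : Multiset ℕ+ → SymFn R) : Matrix (PS d) (PS d) R :=
  Matrix.of fun a b => cf (P a.1) b.1

/-- Dual families reproduce the kernel. -/
theorem dual_pair (d : ℕ) (w : ℕ+ → R) (hw : ∀ k, w k ≠ 0) (P G : Multiset ℕ+ → SymFn R)
    (hP : ∀ a ∈ PS d, Hom (P a) d) (hG : ∀ a ∈ PS d, Hom (G a) d)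
    (h : ∀ a ∈ PS d, ∀ b ∈ PS d, frm d w (P a) (G b) = if a = b then 1 else 0)
    (χ χ' : ℕ+ → R) :
    ∑ a ∈ PS d, eval χ (P a) * eval χ' (G a) = ∑ mu ∈ PS d, mon χ mu * mon χ' mu / zz w mu := by
  classical
  let D : Matrix (PS d) (PS d) R := Matrix.diagonal fun a => zz w a.1
  have h1 : cmat d P * (D * (cmat d G).transpose) = 1 := by
    ext a b
    rw [Matrix.mul_apply]
    have := h a.1 a.2 b.1 b.2
    simp only [Matrix.one_apply, Subtype.ext_iff, ← this]
    unfold frm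
    rw [← Finset.sum_coe_sort (PS d) (fun mu => cf (P a.1) mu * cf (G b.1) mu * zz w mu)]
    apply Finset.sum_congr rfl
    intro m _
    rw [Matrix.diagonal_mul]
    simp only [cmat, Matrix.of_apply, Matrix.transpose_apply]
    ring
  have h2 : (D * (cmat d G).transpose) * cmat d P = 1 := mul_eq_one_comm.1 h1
  have h3 : ∀ m m' : PS d, ∑ a : PS d, cf (G a.1) m.1 * cf (P a.1) m'.1 =
      if m = m' then 1 / zz w m.1 else 0 := by
    intro m m'
    have := congrFun (congrFun h2 m) m'
    rw [Matrix.mul_apply] at this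
    simp only [D, Matrix.diagonal_mul, Matrix.one_apply] at this
    simp only [mul_assoc, ← Finset.mul_sum] at this
    simp only [cmat, Matrix.of_apply, Matrix.transpose_apply] at this
    have hz := zz_ne_zero w hw m.1
    split_ifs at this ⊢ with hm
    · rw [eq_div_iff hz, mul_comm]; exact this
    · exact (mul_eq_zero.1 this).resolve_left hz
  have h4 : ∀ a ∈ PS d, eval χ (P a) * eval χ' (G a) =
      ∑ m ∈ PS d, ∑ m' ∈ PS d, mon χ' m * mon χ m' * (cf (G a) m * cf (P a) m') := by
    intro a ha
    rw [eval_eq_sum (hP a ha), eval_eq_sum (hG a ha), mul_comm, Finset.sum_mul_sum]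
    apply Finset.sum_congr rfl
    intro m _
    apply Finset.sum_congr rfl
    intro m' _
    ring
  rw [Finset.sum_congr rfl h4, Finset.sum_comm]
  apply Finset.sum_congr rfl
  intro m hm
  rw [Finset.sum_comm]
  simp only [← Finset.mul_sum]
  rw [Finset.sum_eq_single m]
  · have := h3 ⟨m, hm⟩ ⟨m, hm⟩
    rw [if_pos rfl, Finset.sum_coe_sort (PS d) (fun a => cf (G a) m * cf (P a) m)] at this
    rw [this]; ring
  · intro m' hm' hne
    have := h3 ⟨m, hm⟩ ⟨m', hm'⟩
    rw [if_neg (by simp; exact fun h => hne h.symm),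
      Finset.sum_coe_sort (PS d) (fun a => cf (G a) m * cf (P a) m')] at this
    rw [this]; ring
  · intro h; exact absurd hm h

/-- An independent family indexed by partitions is a basis. -/
theorem cmat_unit (d : ℕ) (P : Multiset ℕ+ → SymFn R) (hP : ∀ a ∈ PS d, Hom (P a) d)
    (hli : ∀ b : Multiset ℕ+ → R, ∑ a ∈ PS d, b a • P a = 0 → ∀ a ∈ PS d, b a = 0) :
    IsUnit (cmat d P) := by
  classical
  rw [← Matrix.linearIndependent_rows_iff_isUnit, Fintype.linearIndependent_iff]
  intro g hg i
  have := hli (fun a => if h : a ∈ PS d then g ⟨a, h⟩ else 0) ?_ i.1 i.2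
  · simpa using this
  · apply ext_hom (d := d) (Hom.sum _ _ fun a ha => (hP a ha).smul _) (hom_zero d)
    intro mu hmu
    have h1 := congrFun hg ⟨mu, hmu⟩
    rw [Finset.sum_apply] at h1
    rw [cf_sum, ← Finset.sum_coe_sort]
    simp only [cf_smul]
    simpa [cmat, cf] using h1

theorem span_hom (d : ℕ) (P : Multiset ℕ+ → SymFn R) (hP : ∀ a ∈ PS d, Hom (P a) d)
    (hu : IsUnit (cmat d P)) (f : SymFn R) (hf : Hom f d) :
    ∃ b : Multiset ℕ+ → R, f = ∑ a ∈ PS d, b a • P a := by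
  classical
  obtain ⟨B, hB⟩ := hu.exists_left_inv
  refine ⟨fun a => if h : a ∈ PS d then ∑ m : PS d, cf f m.1 * B m ⟨a, h⟩ else 0, ?_⟩
  apply ext_hom (d := d) hf (Hom.sum _ _ fun a ha => (hP a ha).smul _)
  intro mu hmu
  rw [cf_sum, ← Finset.sum_coe_sort]
  simp only [cf_smul, Finset.coe_mem, dite_true, Subtype.coe_eta, Finset.sum_mul]
  rw [Finset.sum_comm]
  have : ∀ m : PS d, ∑ a : PS d, cf f m.1 * B m a * cf (P a.1) mu =
      cf f m.1 * (if m = ⟨mu, hmu⟩ then 1 else 0) := by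
    intro m
    have := congrFun (congrFun hB m) ⟨mu, hmu⟩
    rw [Matrix.mul_apply, Matrix.one_apply] at this
    rw [← this, Finset.mul_sum]
    exact Finset.sum_congr rfl fun a _ => by simp [cmat]; ring
  simp only [this]
  simp

theorem exists_dual (d : ℕ) (w : ℕ+ → R) (hw : ∀ k, w k ≠ 0) (P : Multiset ℕ+ → SymFn R)
    (hu : IsUnit (cmat d P)) :
    ∃ G : Multiset ℕ+ → SymFn R, (∀ a, Hom (G a) d) ∧
      ∀ a ∈ PS d, ∀ b ∈ PS d, frm d w (P a) (G b) = if a = b then 1 else 0 := by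
  classical
  obtain ⟨B, hB⟩ := hu.exists_right_inv
  refine ⟨fun b => if h : b ∈ PS d then
    ∑ m : PS d, monomial (Multiset.toFinsupp m.1) (B m ⟨b, h⟩ / zz w m.1) else 0, ?_, ?_⟩
  · intro a
    beta_reduce
    split_ifs
    · apply Hom.sum
      intro m _
      intro m' hm'
      rw [coeff_monomial] at hm'
      split_ifs at hm' with h
      · rw [← h, weight_eq, Multiset.toFinsupp_toMultiset]
        exact mem_PS.1 m.2
      · exact absurd rfl hm'
    · exact hom_zero d
  · intro a ha b hb
    have h1 := congrFun (congrFun hB ⟨a, ha⟩) ⟨b, hb⟩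
    rw [Matrix.mul_apply, Matrix.one_apply] at h1
    simp only [Subtype.mk.injEq] at h1
    rw [← h1]
    unfold frm
    rw [← Finset.sum_coe_sort]
    apply Finset.sum_congr rfl
    intro m _
    beta_reduce
    rw [dif_pos hb]
    have : cf (∑ m : PS d, monomial (Multiset.toFinsupp m.1) (B m ⟨b, hb⟩ / zz w m.1)) m.1 =
        B m ⟨b, hb⟩ / zz w m.1 := by
      rw [cf_sum]
      unfold cf
      simp only [coeff_monomial]
      rw [Finset.sum_eq_single m]
      · simp
      · intro m' _ hne
        rw [if_neg]
        intro h
        exact hne (Subtype.ext (Multiset.toFinsupp.injective h))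
      · simp
    rw [this]
    have hz := zz_ne_zero w hw m.1
    simp only [cmat, Matrix.of_apply]
    field_simp

/-- Coefficients of the exponential series. -/
theorem HS_coeff (χ : ℕ+ → R) (d : ℕ) :
    PowerSeries.coeff d (HS χ) = ∑ mu ∈ PS d, mon χ mu / zz (fun _ => 1) mu := by
  classical
  set f : Multiset ℕ+ → R := fun mu => mon χ mu / zz (fun _ => 1) mu with hf
  have hF : (PowerSeries.mk fun d => ∑ mu ∈ PS d, f mu) = HS χ := by
    apply HS_unique
    · simp only [PowerSeries.coeff_mk]
      have : PS 0 = {0} := by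
        ext mu
        rw [mem_PS, Finset.mem_singleton]
        exact ⟨eq_zero_of_wt, fun h => by rw [h, wt_zero]⟩
      rw [this]
      simp [hf, mon, zz]
    · intro n
      simp only [PowerSeries.coeff_mk]
      have hcons : ∀ (k : ℕ+) (nu : Multiset ℕ+),
          ((k : ℕ) : R) * ((k ::ₘ nu).count k : R) * f (k ::ₘ nu) = χ k * f nu := by
        intro k nu
        simp only [hf]
        rw [zz_cons, Multiset.count_cons_self]
        have h1 : zz (fun _ => (1 : R)) nu ≠ 0 := zz_ne_zero _ (by simp) nu
        have h2 : ((k : ℕ) : R) ≠ 0 := by exact_mod_cast k.ne_zero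
        have h3 : ((nu.count k : R) + 1) ≠ 0 := by
          have := Nat.succ_ne_zero (nu.count k)
          exact_mod_cast this
        simp only [mon, Multiset.map_cons, Multiset.prod_cons]
        push_cast
        field_simp
      have hL : ∀ mu ∈ PS (n + 1), ((n : R) + 1) * f mu =
          ∑ k ∈ mu.toFinset, χ k * f (mu.erase k) := by
        intro mu hmu
        have hw : ((n : R) + 1) = ∑ k ∈ mu.toFinset, ((k : ℕ) : R) * (mu.count k : R) := by
          have := mem_PS.1 hmu
          unfold wt at this
          rw [Finset.sum_multiset_map_count] at this
          have h2 := congrArg (fun x : ℕ => (x : R)) this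
          push_cast at h2
          rw [← h2]
          apply Finset.sum_congr rfl
          intro k _
          simp [mul_comm]
        rw [hw, Finset.sum_mul]
        apply Finset.sum_congr rfl
        intro k hk
        have := hcons k (mu.erase k)
        rwa [Multiset.cons_erase (Multiset.mem_toFinset.1 hk)] at this
      rw [Finset.mul_sum, Finset.sum_congr rfl hL]
      simp only [Finset.mul_sum]
      rw [Finset.sum_sigma', Finset.sum_sigma']
      refine Finset.sum_bij' (fun x _ => ⟨(x.2 : ℕ) - 1, x.1.erase x.2⟩)
        (fun y _ => ⟨Nat.succPNat y.1 ::ₘ y.2, Nat.succPNat y.1⟩) ?_ ?_ ?_ ?_ ?_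
      · rintro ⟨mu, k⟩ h
        simp only [Finset.mem_sigma, Multiset.mem_toFinset, mem_PS] at h
        have h1 : wt mu = k + wt (mu.erase k) := by
          conv_lhs => rw [← Multiset.cons_erase h.2]
          simp [wt]
        have := k.pos
        simp only [Finset.mem_sigma, Finset.mem_range, mem_PS]
        omega
      · rintro ⟨i, nu⟩ h
        simp only [Finset.mem_sigma, Finset.mem_range, mem_PS] at h
        simp only [Finset.mem_sigma, Multiset.mem_toFinset, mem_PS]
        refine ⟨?_, by simp⟩
        have : wt (Nat.succPNat i ::ₘ nu) = (i + 1) + wt nu := by simp [wt]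
        omega
      · rintro ⟨mu, k⟩ h
        simp only [Finset.mem_sigma, Multiset.mem_toFinset, mem_PS] at h
        have hk : Nat.succPNat ((k : ℕ) - 1) = k := by
          apply PNat.eq
          have := k.pos
          simp only [Nat.succPNat_coe]
          omega
        simp only [hk, Multiset.cons_erase h.2]
      · rintro ⟨i, nu⟩ h
        simp
      · rintro ⟨mu, k⟩ h
        have hk : Nat.succPNat ((k : ℕ) - 1) = k := by
          apply PNat.eq
          have := k.pos
          simp only [Nat.succPNat_coe]
          omega
        simp only [hk]
  rw [← hF]
  simp

theorem HS_coeff_weight (χ χ' w : ℕ+ → R) (hw : ∀ k, w k ≠ 0) (d : ℕ) :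
    PowerSeries.coeff d (HS fun k => χ k * χ' k / w k) =
      ∑ mu ∈ PS d, mon χ mu * mon χ' mu / zz w mu := by
  rw [HS_coeff]
  apply Finset.sum_congr rfl
  intro mu _
  have h1 : zz w mu = mon w mu * zz (fun _ => (1 : R)) mu := by
    rw [← zz_scale]; simp
  have h2 : mon (fun k => χ k * χ' k / w k) mu * mon w mu = mon χ mu * mon χ' mu := by
    unfold mon
    rw [← Multiset.prod_map_mul, ← Multiset.prod_map_mul]
    congr 1
    apply Multiset.map_congr rfl
    intro k _
    have := hw k
    field_simp
  have h3 : zz (fun _ => (1 : R)) mu ≠ 0 := zz_ne_zero _ (by simp) mu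
  have h4 : zz w mu ≠ 0 := zz_ne_zero _ hw mu
  rw [div_eq_div_iff h3 h4, h1, ← h2]
  ring

/-- The kernel expansion of a pair of dual families. -/
theorem dual_kernel (d : ℕ) (w : ℕ+ → R) (hw : ∀ k, w k ≠ 0) (P G : Multiset ℕ+ → SymFn R)
    (hP : ∀ a ∈ PS d, Hom (P a) d) (hG : ∀ a ∈ PS d, Hom (G a) d)
    (h : ∀ a ∈ PS d, ∀ b ∈ PS d, frm d w (P a) (G b) = if a = b then 1 else 0)
    (χ χ' : ℕ+ → R) :
    ∑ a ∈ PS d, eval χ (P a) * eval χ' (G a) =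
      PowerSeries.coeff d (HS fun k => χ k * χ' k / w k) := by
  rw [dual_pair d w hw P G hP hG h, HS_coeff_weight χ χ' w hw]

/-! ### Homogeneity of Schur functions -/

theorem hom_hsym (n : ℕ) : Hom (hsym (R := R) n) n := by
  induction n using Nat.strong_induction_on with
  | _ n ih =>
    rcases n with _ | n
    · rw [hsym]; exact hom_one
    · rw [hsym]
      apply Hom.smul
      apply Hom.sum
      intro i hi
      have hi' := Finset.mem_range.1 hi
      have h1 : Hom (X (⟨i+1, Nat.succ_pos i⟩ : ℕ+) : SymFn R) (i + 1) :=
        isWeightedHomogeneous_X R _ _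
      have h2 := h1.mul (ih (n - i) (by omega))
      have : i + 1 + (n - i) = n + 1 := by omega
      rwa [this] at h2

theorem hom_hInt (z : ℤ) : hInt (R := R) z = 0 ∨ ∃ n : ℕ, (n : ℤ) = z ∧ Hom (hInt (R := R) z) n := by
  unfold hInt
  split_ifs with h
  · right
    exact ⟨z.toNat, by omega, hom_hsym _⟩
  · left; rfl

theorem hom_prod {ι : Type} (s : Finset ι) (f : ι → SymFn R) (e : ι → ℤ)
    (h : ∀ i ∈ s, f i = 0 ∨ ∃ n : ℕ, (n : ℤ) = e i ∧ Hom (f i) n) :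
    (∏ i ∈ s, f i) = 0 ∨ ∃ n : ℕ, (n : ℤ) = ∑ i ∈ s, e i ∧ Hom (∏ i ∈ s, f i) n := by
  classical
  induction s using Finset.induction_on with
  | empty => right; exact ⟨0, by simp, by simpa using hom_one⟩
  | insert a s ha ih =>
    rw [Finset.prod_insert ha, Finset.sum_insert ha]
    rcases h a (Finset.mem_insert_self _ _) with h1 | ⟨n1, e1, h1⟩
    · left; rw [h1, zero_mul]
    · rcases ih (fun i hi => h i (Finset.mem_insert_of_mem hi)) with h2 | ⟨n2, e2, h2⟩
      · left; rw [h2, mul_zero]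
      · right
        exact ⟨n1 + n2, by push_cast; rw [e1, e2], h1.mul h2⟩

theorem hom_schur (lam : Multiset ℕ+) : Hom (schur (R := R) lam) (wt lam) := by
  unfold schur
  rw [Matrix.det_apply]
  apply Hom.sum
  intro σ _
  have h := hom_prod Finset.univ (fun i => hInt (R := R)
    ((((descParts lam).getD (σ i) 0 : ℕ) : ℤ) + (i : ℤ) - ((σ i : Fin _) : ℤ)))
    (fun i => ((((descParts lam).getD (σ i) 0 : ℕ) : ℤ) + (i : ℤ) - ((σ i : Fin _) : ℤ)))
    (fun i _ => hom_hInt _)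
  have hsum : ∑ i, ((((descParts lam).getD (σ i) 0 : ℕ) : ℤ) + (i : ℤ) - ((σ i : Fin _) : ℤ)) =
      wt lam := by
    rw [Finset.sum_sub_distrib, Finset.sum_add_distrib]
    rw [Equiv.sum_comp σ (fun j => (((descParts lam).getD j 0 : ℕ) : ℤ)),
      Equiv.sum_comp σ (fun j : Fin (Multiset.card lam) => ((j : ℕ) : ℤ))]
    rw [add_sub_cancel_right, ← sum_part lam _ le_rfl, Finset.sum_range]
    push_cast
    rfl
  rw [Units.smul_def]
  have hz : ∀ (z : ℤ) (f : SymFn R), Hom f (wt lam) → Hom (z • f) (wt lam) := by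
    intro z f hf
    rw [← Int.cast_smul_eq_zsmul R]
    exact hf.smul _
  apply hz
  simp only [Matrix.of_apply]
  rcases h with h | ⟨n, e, h⟩
  · rw [h]; exact hom_zero _
  · rw [hsum] at e
    have : n = wt lam := by exact_mod_cast e
    rw [← this]; exact h

end LA
end HF
end

open MvPolynomial

noncomputable section
set_option linter.unusedSectionVars false
namespace HF

/-! ### Triangular families -/

/-- Partitions of `d` with at most `n` parts. -/
def PSn (n d : ℕ) : Finset (Multiset ℕ+) := (PS d).filter fun k => Multiset.card k ≤ n

theorem mem_PSn {n d : ℕ} {k : Multiset ℕ+} : k ∈ PSn n d ↔ wt k = d ∧ Multiset.card k ≤ n := by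
  unfold PSn; rw [Finset.mem_filter, mem_PS]

theorem PSn_self (d : ℕ) : PSn d d = PS d := by
  ext k
  rw [mem_PSn, mem_PS]
  exact ⟨fun h => h.1, fun h => ⟨h, h ▸ card_le_wt k⟩⟩

section T
variable {R : Type} [Field R] [CharZero R] {n : ℕ}

/-- The alternant attached to a partition. -/
def ak (R : Type) [Field R] (n : ℕ) (k : Multiset ℕ+) : (Fin n → R) → R := fun v => alt v (dlp n k)

theorem Low_eq (d N : ℕ) : Low R n d N =
    Submodule.span R (ak R n '' (((PSn n d).filter fun k => Phi n k < N) : Finset (Multiset ℕ+))) := by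
  unfold Low
  congr 1
  ext f
  constructor
  · rintro ⟨k, h1, h2, h3, rfl⟩
    exact ⟨k, by simp [mem_PSn, h1, h2, h3], rfl⟩
  · rintro ⟨k, h, rfl⟩
    simp [mem_PSn] at h
    exact ⟨k, h.1.2, h.1.1, h.2, rfl⟩

theorem lead_zero {d : ℕ} (b c : Multiset ℕ+ → R) (f : Multiset ℕ+ → (Fin n → R) → R)
    (hf : ∀ k ∈ PSn n d, f k - c k • ak R n k ∈ Low R n d (Phi n k))
    {k0 : Multiset ℕ+} (hk0 : k0 ∈ PSn n d) (hmax : ∀ k ∈ PSn n d, b k ≠ 0 → Phi n k ≤ Phi n k0)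
    (h : ∑ k ∈ PSn n d, b k • f k ∈ Low R n d (Phi n k0)) : b k0 * c k0 = 0 := by
  classical
  set M := Phi n k0
  have h1 : ∑ k ∈ PSn n d, b k • (f k - c k • ak R n k) ∈ Low R n d M := by
    apply Submodule.sum_mem
    intro k hk
    by_cases hb : b k = 0
    · rw [hb, zero_smul]; exact Submodule.zero_mem _
    · exact Submodule.smul_mem _ _ (Low_mono (hmax k hk hb) (hf k hk))
  have h2 : ∑ k ∈ PSn n d, (b k * c k) • ak R n k ∈ Low R n d M := by
    have := Submodule.sub_mem _ h h1
    rw [← Finset.sum_sub_distrib] at this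
    convert this using 2
    rw [smul_sub, sub_sub_cancel, smul_smul]
  rw [Low_eq, Submodule.mem_span_image_finset_iff_exists_fun'] at h2
  obtain ⟨a, ha⟩ := h2
  have h3 := alt_indep (R := R) (PSn n d) (fun k hk => (mem_PSn.1 hk).2)
    (fun k => b k * c k - if Phi n k < M then a k else 0) ?_ k0 hk0
  · simpa [M] using h3
  · intro v
    have := congrFun ha v
    rw [Finset.sum_filter, Finset.sum_apply, Finset.sum_apply] at this
    simp only [sub_mul, Finset.sum_sub_distrib]
    rw [sub_eq_zero]
    refine Eq.trans ?_ (this.symm.trans ?_)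
    · exact Finset.sum_congr rfl fun k _ => by simp [ak]
    · refine Finset.sum_congr rfl fun k _ => ?_
      split_ifs <;> simp [ak]

theorem exists_top {d : ℕ} (b : Multiset ℕ+ → R) (h : ∃ k ∈ PSn n d, b k ≠ 0) :
    ∃ k0 ∈ PSn n d, b k0 ≠ 0 ∧ ∀ k ∈ PSn n d, b k ≠ 0 → Phi n k ≤ Phi n k0 := by
  classical
  obtain ⟨k, hk, hb⟩ := h
  obtain ⟨k0, h0, hm⟩ := Finset.exists_max_image ((PSn n d).filter fun k => b k ≠ 0) (Phi n)
    ⟨k, by simp [hk, hb]⟩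
  rw [Finset.mem_filter] at h0
  exact ⟨k0, h0.1, h0.2, fun k hk hb => hm k (by simp [hk, hb])⟩

theorem lead_span {d : ℕ} (f : Multiset ℕ+ → (Fin n → R) → R)
    (hf : ∀ k ∈ PSn n d, f k - ak R n k ∈ Low R n d (Phi n k)) (N : ℕ) :
    Low R n d N ≤ Submodule.span R
      (f '' (((PSn n d).filter fun k => Phi n k < N) : Finset (Multiset ℕ+))) := by
  classical
  induction N using Nat.strong_induction_on with
  | _ N ih =>
    rw [Low_eq, Submodule.span_le]
    rintro _ ⟨k, hk, rfl⟩
    have hk' := Finset.mem_filter.1 hk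
    have h1 := ih _ hk'.2 (hf k hk'.1)
    have h2 : f k ∈ Submodule.span R
      (f '' (((PSn n d).filter fun k => Phi n k < N) : Finset (Multiset ℕ+))) :=
      Submodule.subset_span ⟨k, hk, rfl⟩
    have h3 : ak R n k = f k - (f k - ak R n k) := by simp
    rw [h3]
    refine Submodule.sub_mem _ h2 (Submodule.span_mono ?_ h1)
    apply Set.image_mono
    intro j hj
    have hj' := Finset.mem_filter.1 hj
    exact Finset.mem_filter.2 ⟨hj'.1, lt_trans hj'.2 hk'.2⟩

def fnL (R : Type) [Field R] [CharZero R] (n : ℕ) : SymFn R →ₗ[R] ((Fin n → R) → R) where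
  toFun := fn n
  map_add' f g := by funext v; simp [fn]
  map_smul' c f := by funext v; simp [fn, smul_eval]

/-- Evaluation in `n` variables times the Vandermonde alternant. -/
def AL (R : Type) [Field R] [CharZero R] (n : ℕ) : SymFn R →ₗ[R] ((Fin n → R) → R) where
  toFun f := fun v => av v * fn n f v
  map_add' f g := by funext v; simp [fn, mul_add]
  map_smul' c f := by funext v; simp [fn, smul_eval]; ring

theorem AL_apply (f : SymFn R) (v : Fin n → R) : AL R n f v = av v * eval (pw v) f := rfl
theorem fnL_apply (f : SymFn R) (v : Fin n → R) : fnL R n f v = eval (pw v) f := rfl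
theorem fnL_eq (f : SymFn R) : fnL R n f = fn n f := rfl

theorem AL_schur {k : Multiset ℕ+} (hk : Multiset.card k ≤ n) : AL R n (schur k) = ak R n k := by
  funext v
  rw [AL_apply, ak, schur_alt v k hk, mul_comm]

theorem AL_schur_vanish {k : Multiset ℕ+} (hk : n < Multiset.card k) : AL R n (schur k) = 0 := by
  funext v
  rw [AL_apply, schur_vanish hk, mul_zero]; rfl

theorem fnL_schur_vanish {k : Multiset ℕ+} (hk : n < Multiset.card k) : fnL R n (schur k) = 0 := by
  funext v
  rw [fnL_apply, schur_vanish hk]; rfl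

theorem AL_inj {f g : SymFn R} (h : AL R n f = AL R n g) (v : Fin n → R) :
    eval (pw v) f = eval (pw v) g := by
  refine av_cancel_eq (isPoly_eval f) (isPoly_eval g) ?_ v
  intro v
  have := congrFun h v
  rw [AL_apply, AL_apply] at this
  rw [mul_comm, this, mul_comm]

/-- Unitriangularity with respect to Schur functions. -/
def Tri (P : Multiset ℕ+ → SymFn R) : Prop := ∀ lam, P lam - schur lam ∈
  Submodule.span R ((schur (R := R)) '' {mu | StrictDom mu lam})

theorem tri_schur : Tri (schur (R := R)) := by
  intro lam; rw [sub_self]; exact Submodule.zero_mem _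

variable {P : Multiset ℕ+ → SymFn R}

theorem Tri.hom (h : Tri P) (lam : Multiset ℕ+) : Hom (P lam) (wt lam) := by
  have h1 : Hom (P lam - schur lam) (wt lam) := by
    have := h lam
    revert this
    generalize P lam - schur lam = y
    intro this
    induction this using Submodule.span_induction with
    | mem x hx =>
      obtain ⟨mu, hmu, rfl⟩ := hx
      rw [← hmu.2.1]; exact hom_schur mu
    | zero => exact hom_zero _
    | add x y _ _ hx hy => exact hx.add hy
    | smul a x _ hx => exact hx.smul a
  have := h1.add (hom_schur lam)
  simpa using this

theorem Tri.map_zero (h : Tri P) {V : Type} [AddCommGroup V] [Module R V] (L : SymFn R →ₗ[R] V)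
    (hL : ∀ k : Multiset ℕ+, n < Multiset.card k → L (schur k) = 0)
    {lam : Multiset ℕ+} (hl : n < Multiset.card lam) : L (P lam) = 0 := by
  have h1 : L (P lam - schur lam) = 0 := by
    have := h lam
    revert this
    generalize P lam - schur lam = y
    intro this
    induction this using Submodule.span_induction with
    | mem x hx =>
      obtain ⟨mu, hmu, rfl⟩ := hx
      exact hL mu (lt_of_lt_of_le hl (strictDom_card_le hmu))
    | zero => simp
    | add x y _ _ hx hy => rw [_root_.map_add, hx, hy, add_zero]
    | smul a x _ hx => rw [_root_.map_smul, hx, smul_zero]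
  rw [_root_.map_sub, hL lam hl, sub_zero] at h1
  exact h1

theorem Tri.map_low (h : Tri P) (L : SymFn R →ₗ[R] ((Fin n → R) → R))
    (hL0 : ∀ k : Multiset ℕ+, n < Multiset.card k → L (schur k) = 0)
    (c : Multiset ℕ+ → R)
    (hL : ∀ k : Multiset ℕ+, Multiset.card k ≤ n →
      L (schur k) - c k • ak R n k ∈ Low R n (wt k) (Phi n k))
    {lam : Multiset ℕ+} (hl : Multiset.card lam ≤ n) :
    L (P lam) - c lam • ak R n lam ∈ Low R n (wt lam) (Phi n lam) := by
  have h1 : L (P lam - schur lam) ∈ Low R n (wt lam) (Phi n lam) := by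
    have := h lam
    revert this
    generalize P lam - schur lam = y
    intro this
    induction this using Submodule.span_induction with
    | mem x hx =>
      obtain ⟨mu, hmu, rfl⟩ := hx
      by_cases hc : Multiset.card mu ≤ n
      · have h2 := Low_mono (le_of_lt (strictDom_Phi_lt hmu hc)) (hL mu hc)
        rw [hmu.2.1] at h2
        have h3 : ak R n mu ∈ Low R n (wt lam) (Phi n lam) :=
          Submodule.subset_span ⟨mu, hc, hmu.2.1, strictDom_Phi_lt hmu hc, rfl⟩
        have := Submodule.add_mem _ h2 (Submodule.smul_mem _ (c mu) h3)
        simpa using this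
      · rw [hL0 mu (by omega)]; exact Submodule.zero_mem _
    | zero => simp
    | add x y _ _ hx hy => rw [_root_.map_add]; exact Submodule.add_mem _ hx hy
    | smul a x _ hx => rw [_root_.map_smul]; exact Submodule.smul_mem _ _ hx
  have := Submodule.add_mem _ h1 (hL lam hl)
  rw [_root_.map_sub] at this
  convert this using 1
  abel

theorem Tri.AL_vanish (h : Tri P) {lam : Multiset ℕ+} (hl : n < Multiset.card lam) :
    AL R n (P lam) = 0 := h.map_zero (AL R n) (fun _ hk => AL_schur_vanish hk) hl

theorem Tri.vanish (h : Tri P) {lam : Multiset ℕ+} (hl : n < Multiset.card lam) :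
    fnL R n (P lam) = 0 := h.map_zero (fnL R n) (fun _ hk => fnL_schur_vanish hk) hl

theorem Tri.AL_low (h : Tri P) {lam : Multiset ℕ+} (hl : Multiset.card lam ≤ n) :
    AL R n (P lam) - ak R n lam ∈ Low R n (wt lam) (Phi n lam) := by
  have := h.map_low (AL R n) (fun _ hk => AL_schur_vanish hk) (fun _ => 1)
    (by intro k hk; rw [AL_schur hk]; simp) hl
  simpa using this

/-- The operator on symmetric functions. -/
def DL (R : Type) [Field R] [CharZero R] (n : ℕ) (q t x : R) : SymFn R →ₗ[R] ((Fin n → R) → R) :=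
  (aDL q t x).comp (fnL R n)

theorem DL_apply (q t x : R) (f : SymFn R) (v : Fin n → R) :
    DL R n q t x f v = aDf q t x (fn n f) v := rfl

theorem Tri.DL_vanish (h : Tri P) (q t x : R) {lam : Multiset ℕ+} (hl : n < Multiset.card lam) :
    DL R n q t x (P lam) = 0 := by
  unfold DL; rw [LinearMap.comp_apply, h.vanish hl, _root_.map_zero]

theorem Tri.DL_low (h : Tri P) (q t x : R) {lam : Multiset ℕ+} (hl : Multiset.card lam ≤ n) :
    DL R n q t x (P lam) - Ev n q t lam x • ak R n lam ∈ Low R n (wt lam) (Phi n lam) :=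
  h.map_low (DL R n q t x) (fun _ hk => tri_schur.DL_vanish q t x hk) (fun k => Ev n q t k x)
    (fun _ hk => schur_tri q t x _ hk) hl

/-- Independence in `n` variables. -/
theorem Tri.indep (h : Tri P) {d : ℕ} (b : Multiset ℕ+ → R)
    (h0 : ∑ k ∈ PSn n d, b k • AL R n (P k) = 0) : ∀ k ∈ PSn n d, b k = 0 := by
  by_contra hc
  push Not at hc
  obtain ⟨k0, hk0, hb, hm⟩ := exists_top b hc
  have := lead_zero b (fun _ => 1) (fun k => AL R n (P k)) (d := d) ?_ hk0 hm
    (by rw [h0]; exact Submodule.zero_mem _)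
  · exact hb (by simpa using this)
  · intro k hk
    have := h.AL_low (n := n) (mem_PSn.1 hk).2
    rw [(mem_PSn.1 hk).1] at this
    simpa using this

theorem Tri.sum_PSn (h : Tri P) {d : ℕ} (L : SymFn R →ₗ[R] ((Fin n → R) → R))
    (hL0 : ∀ k : Multiset ℕ+, n < Multiset.card k → L (schur k) = 0) (b : Multiset ℕ+ → R) :
    ∑ k ∈ PS d, b k • L (P k) = ∑ k ∈ PSn n d, b k • L (P k) := by
  unfold PSn
  rw [Finset.sum_filter]
  refine Finset.sum_congr rfl fun k _ => ?_
  split_ifs with hc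
  · rfl
  · rw [h.map_zero L hL0 (by omega), smul_zero]

theorem Tri.unit (h : Tri P) (d : ℕ) : IsUnit (cmat d P) := by
  apply cmat_unit d P
  · intro a ha; rw [← mem_PS.1 ha]; exact h.hom a
  · intro b hb
    have h1 := congrArg (AL R d) hb
    rw [_root_.map_sum, _root_.map_zero] at h1
    simp only [_root_.map_smul] at h1
    rw [← PSn_self] at h1 ⊢
    exact h.indep b h1

theorem Tri.expand (h : Tri P) {d : ℕ} {f : SymFn R} (hf : Hom f d) :
    ∃ b : Multiset ℕ+ → R, f = ∑ a ∈ PS d, b a • P a :=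
  span_hom d P (fun a ha => by rw [← mem_PS.1 ha]; exact h.hom a) (h.unit d) f hf

/-- A function vanishing in many variables is zero. -/
theorem eq_zero_of_vars {f : SymFn R} {d : ℕ} (hf : Hom f d) (h : AL R d f = 0) : f = 0 := by
  obtain ⟨b, hb⟩ := tri_schur.expand hf
  rw [hb, _root_.map_sum] at h
  simp only [_root_.map_smul] at h
  rw [← PSn_self] at h
  have := tri_schur.indep b h
  rw [hb, ← PSn_self]
  exact Finset.sum_eq_zero fun k hk => by rw [this k hk, zero_smul]

/-- Genericity of the parameters. -/
def Gen (q t : R) : Prop := ∀ a b j k : ℕ, q ^ a * t ^ j = q ^ b * t ^ k → a = b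

theorem Ev_inj {q t : R} (hg : Gen q t) {lam mu : Multiset ℕ+} (hl : Multiset.card lam ≤ n)
    (hm : Multiset.card mu ≤ n) (h : ∀ x, Ev n q t lam x = Ev n q t mu x) : lam = mu := by
  classical
  let e : Multiset ℕ+ → ℕ → R := fun k i => q ^ part k i * t ^ (n - 1 - i)
  let p : Multiset ℕ+ → Polynomial R := fun k =>
    (((Multiset.range n).map (fun i => - e k i)).map fun a => Polynomial.X - Polynomial.C a).prod
  have hp : ∀ k y, (p k).eval y = ∏ i ∈ Finset.range n, (y + e k i) := by
    intro k y
    simp only [p]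
    rw [Polynomial.eval_multiset_prod, Multiset.map_map, Multiset.map_map]
    rw [Finset.prod_eq_multiset_prod]
    congr 1
    apply Multiset.map_congr rfl
    intro i _
    simp
  have hp2 : ∀ k y, y ≠ 0 → (p k).eval y = y ^ n * Ev n q t k y⁻¹ := by
    intro k y hy
    rw [hp, Ev]
    conv_rhs => rw [← Finset.card_range n, ← Finset.prod_const, Finset.card_range]
    rw [← Finset.prod_mul_distrib]
    refine Finset.prod_congr rfl fun i _ => ?_
    simp only [e]
    field_simp
  have hpe : p lam = p mu := by
    apply Polynomial.eq_of_infinite_eval_eq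
    apply Set.Infinite.mono (s := {0}ᶜ)
    · intro y hy
      have hy' : y ≠ 0 := hy
      simp only [Set.mem_ofPred_eq]
      rw [hp2 _ _ hy', hp2 _ _ hy', h]
    · exact (Set.finite_singleton (0 : R)).infinite_compl
  have h2 := congrArg Polynomial.roots hpe
  simp only [p, Polynomial.roots_multiset_prod_X_sub_C] at h2
  let ex : R → ℕ := fun r => if h : ∃ a j, - r = q ^ a * t ^ j then h.choose else 0
  have hex : ∀ a j, ex (-(q ^ a * t ^ j)) = a := by
    intro a j
    have hh : ∃ a' j', - (-(q ^ a * t ^ j)) = q ^ a' * t ^ j' := ⟨a, j, by simp⟩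
    simp only [ex]
    rw [dif_pos hh]
    obtain ⟨j', hj'⟩ := hh.choose_spec
    exact (hg _ _ _ _ ((neg_neg _).symm.trans hj')).symm
  have h3 := congrArg (Multiset.map ex) h2
  rw [Multiset.map_map, Multiset.map_map] at h3
  have h4 : ∀ k, (ex ∘ fun i => - e k i) = part k := by
    intro k; funext i; exact hex _ _
  rw [h4, h4] at h3
  exact eq_of_multiset_part hl hm h3

/-- Uniqueness of eigenfunctions. -/
theorem eig_unique {q t : R} (hg : Gen q t) {lam : Multiset ℕ+} (hl : Multiset.card lam ≤ n) {d : ℕ}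
    (hP : Tri P) (b : Multiset ℕ+ → R) (hb : b lam = 0)
    (h : ∀ x, DL R n q t x (∑ k ∈ PS d, b k • P k) =
      Ev n q t lam x • AL R n (∑ k ∈ PS d, b k • P k)) :
    ∀ k ∈ PSn n d, b k = 0 := by
  by_contra hc
  push Not at hc
  obtain ⟨k0, hk0, hbk, hm⟩ := exists_top b hc
  have key : ∀ x, Ev n q t k0 x = Ev n q t lam x := by
    intro x
    have h1 := h x
    rw [_root_.map_sum, _root_.map_sum] at h1
    simp only [_root_.map_smul] at h1
    rw [hP.sum_PSn (DL R n q t x) (fun _ hk => tri_schur.DL_vanish q t x hk),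
      hP.sum_PSn (AL R n) (fun _ hk => tri_schur.AL_vanish hk)] at h1
    have := lead_zero b (fun k => Ev n q t k x - Ev n q t lam x)
      (fun k => DL R n q t x (P k) - Ev n q t lam x • AL R n (P k)) (d := d) ?_ hk0 hm ?_
    · exact sub_eq_zero.1 ((mul_eq_zero.1 this).resolve_left hbk)
    · intro k hk
      have h2 := hP.DL_low (n := n) q t x (mem_PSn.1 hk).2
      have h3 := Submodule.smul_mem _ (Ev n q t lam x) (hP.AL_low (n := n) (mem_PSn.1 hk).2)
      have h4 := Submodule.sub_mem _ h2 h3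
      rw [(mem_PSn.1 hk).1] at h4
      convert h4 using 1
      rw [smul_sub, sub_smul]
      abel
    · simp only [smul_sub, Finset.sum_sub_distrib]
      rw [h1, Finset.smul_sum]
      have : ∀ k, Ev n q t lam x • b k • AL R n (P k) = b k • Ev n q t lam x • AL R n (P k) :=
        fun k => smul_comm _ _ _
      simp only [this, sub_self]
      exact Submodule.zero_mem _
  have := Ev_inj hg (mem_PSn.1 hk0).2 hl key
  rw [this] at hbk
  exact hbk hb

end T
end HF
end

open MvPolynomial

noncomputable section
set_option linter.unusedSectionVars false
namespace HF

/-! ### The reproducing kernel -/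

section K
variable {R : Type} [Field R] [CharZero R] {n : ℕ}

/-- The power series variable. -/
local notation "ε" => (PowerSeries.X : PowerSeries R)

theorem HS_neg_mul (χ : ℕ+ → R) : HS χ * HS (fun k => - χ k) = 1 := by
  rw [← HS_add]
  have : (fun k => χ k + -χ k) = fun _ => (0 : R) := by funext k; ring
  rw [this, HS_zero]

theorem HS_shift (q : R) (hq : ∀ k : ℕ+, 1 - q ^ (k : ℕ) ≠ 0) (χ : ℕ+ → R) (x : Fin n → R)
    (s : Fin n → Bool) :
    HS (fun k => pw (sc s q x) k * χ k / (1 - q ^ (k : ℕ))) =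
      HS (fun k => pw x k * χ k / (1 - q ^ (k : ℕ))) *
        ∏ i, (if s i then HS (fun k => - (x i ^ (k : ℕ) * χ k)) else 1) := by
  have h1 : ∀ i, (if s i then HS (fun k => - (x i ^ (k : ℕ) * χ k)) else 1) =
      HS (fun k => if s i then - (x i ^ (k : ℕ) * χ k) else 0) := by
    intro i
    split_ifs
    · rfl
    · rw [HS_zero]
  simp only [h1]
  rw [← HS_sum, ← HS_add]
  congr 1
  funext k
  have hk := hq k
  rw [div_add' _ _ _ hk]
  congr 1
  unfold pw
  rw [Finset.sum_mul, Finset.sum_mul, Finset.sum_mul, ← Finset.sum_add_distrib]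
  refine Finset.sum_congr rfl fun i _ => ?_
  unfold sc
  split_ifs <;> ring

/-- The determinant describing the action of the operator. -/
def aDS (t X : R) (χ : ℕ+ → R) (x : Fin n → R) : PowerSeries R :=
  Matrix.det (Matrix.of fun i j : Fin n => PowerSeries.C (x i) ^ dl n j *
    (1 + PowerSeries.C t ^ dl n j * (PowerSeries.C X * HS (fun k => - (x i ^ (k : ℕ) * χ k)))))

theorem alt_map {S T : Type} [CommRing S] [CommRing T] (φ : S →+* T) (v : Fin n → S)
    (b : Fin n → ℕ) : φ (alt v b) = alt (fun i => φ (v i)) b := by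
  unfold alt
  rw [RingHom.map_det]
  congr 1
  ext i j
  simp

theorem aDf_HS (q t X : R) (hq : ∀ k : ℕ+, 1 - q ^ (k : ℕ) ≠ 0) (χ : ℕ+ → R) (x : Fin n → R) (d : ℕ) :
    aDf q t X (fun x' => PowerSeries.coeff d (HS (fun k => pw x' k * χ k / (1 - q ^ (k : ℕ))))) x =
      PowerSeries.coeff d (HS (fun k => pw x k * χ k / (1 - q ^ (k : ℕ))) * aDS t X χ x) := by
  unfold aDS
  rw [← sum_alt_sc, Finset.mul_sum, _root_.map_sum]
  unfold aDf
  refine Finset.sum_congr rfl fun s _ => ?_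
  beta_reduce
  rw [HS_shift q hq χ x s]
  have h1 : (alt (sc s (PowerSeries.C t) fun i => PowerSeries.C (x i)) (dl n) : PowerSeries R) =
      PowerSeries.C (av (sc s t x)) := by
    rw [av, alt_map]
    congr 1
    funext i
    unfold sc
    split_ifs <;> simp
  have h2 : (∏ i, if s i then (PowerSeries.C X * HS (fun k => - (x i ^ (k : ℕ) * χ k))) else 1 :
      PowerSeries R) = PowerSeries.C (∏ i, if s i then X else 1) *
        ∏ i, (if s i then HS (fun k => - (x i ^ (k : ℕ) * χ k)) else 1) := by
    rw [_root_.map_prod, ← Finset.prod_mul_distrib]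
    refine Finset.prod_congr rfl fun i _ => ?_
    split_ifs <;> simp
  rw [h1, h2, ← PowerSeries.coeff_C_mul]
  congr 1
  rw [_root_.map_mul]
  ring

theorem HS_neg_geom (a : R) : HS (fun k => - (a ^ (k : ℕ))) = 1 - PowerSeries.C a * ε := by
  have h1 := HS_neg_mul (fun k => a ^ (k : ℕ))
  have h2 := HS_geom_mul a
  calc HS (fun k => - (a ^ (k : ℕ))) = ((1 - PowerSeries.C a * ε) * HS (fun k => a ^ (k : ℕ))) *
        HS (fun k => - (a ^ (k : ℕ))) := by rw [h2, one_mul]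
    _ = _ := by rw [mul_assoc, h1, mul_one]

/-! #### Third kernel identity -/

theorem aDS_one (t : R) (x : Fin n → R) :
    aDS t (-1) (fun _ => 1) x =
      PowerSeries.C (t ^ (∑ j, dl n j) * ((∏ i, x i) * av x)) * ε ^ n := by
  classical
  let U : Matrix (Fin n) (Fin n) (PowerSeries R) := Matrix.of fun m j =>
    if m = j then PowerSeries.C (t ^ dl n j) * ε
    else if dl n m + 1 = dl n j then PowerSeries.C (1 - t ^ dl n j) else 0
  let M : Matrix (Fin n) (Fin n) (PowerSeries R) := Matrix.of fun i j =>
    PowerSeries.C (x i) ^ (dl n j + 1)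
  have h1 : aDS t (-1) (fun _ => 1) x = (M * U).det := by
    unfold aDS
    congr 1
    ext1 i j
    rw [Matrix.mul_apply]
    simp only [Matrix.of_apply, mul_one, HS_neg_geom, M, U]
    rw [← Finset.add_sum_erase _ _ (Finset.mem_univ j)]
    rw [if_pos rfl]
    have h2 : ∑ m ∈ Finset.univ.erase j, (PowerSeries.C (x i) ^ (dl n m + 1) *
        (if m = j then PowerSeries.C (t ^ dl n j) * ε
          else if dl n m + 1 = dl n j then PowerSeries.C (1 - t ^ dl n j) else 0)) =
        PowerSeries.C (x i) ^ (dl n j) * PowerSeries.C (1 - t ^ dl n j) := by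
      by_cases h0 : dl n j = 0
      · rw [h0, pow_zero, sub_self, _root_.map_zero, mul_zero]
        refine Finset.sum_eq_zero fun m hm => ?_
        rw [if_neg (Finset.ne_of_mem_erase hm), if_neg (by omega), mul_zero]
      · have hj : (j : ℕ) + 1 < n := by unfold dl at h0; omega
        have e : dl n ⟨j + 1, hj⟩ + 1 = dl n j := by unfold dl; simp only; omega
        rw [Finset.sum_eq_single (⟨j + 1, hj⟩ : Fin n)]
        · rw [if_neg (by intro h; have := congrArg Fin.val h; simp at this), if_pos e, e]
        · intro m hm hne
          rw [if_neg (Finset.ne_of_mem_erase hm), if_neg, mul_zero]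
          intro h
          apply hne
          apply dl_strictAnti.injective
          omega
        · intro h
          exfalso; apply h
          rw [Finset.mem_erase]
          refine ⟨?_, Finset.mem_univ _⟩
          intro h; have := congrArg Fin.val h; simp at this
    rw [h2]
    simp only [_root_.map_sub, _root_.map_pow, _root_.map_one, _root_.map_neg]
    ring
  have h3 : U.det = PowerSeries.C (t ^ (∑ j, dl n j)) * ε ^ n := by
    rw [Matrix.det_of_isLowerTriangular U]
    · simp only [U, Matrix.of_apply, if_true]
      rw [Finset.prod_mul_distrib, ← _root_.map_prod, Finset.prod_pow_eq_pow_sum]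
      simp
    · intro i j hij
      have hij' : i < j := hij
      simp only [U, Matrix.of_apply]
      rw [if_neg (ne_of_lt hij'), if_neg]
      have := dl_strictAnti hij'
      omega
  have h4 : M.det = PowerSeries.C ((∏ i, x i) * av x) := by
    have : M.det = alt (fun i => PowerSeries.C (x i)) (fun j => dl n j + 1) := rfl
    rw [this, ← alt_map (PowerSeries.C (R := R)), alt_add_one]
    rfl
  rw [h1, Matrix.det_mul, h3, h4, _root_.map_mul PowerSeries.C (t ^ _)]
  ring

theorem K3 (q t : R) (hq : ∀ k : ℕ+, 1 - q ^ (k : ℕ) ≠ 0) (x : Fin n → R) (d : ℕ) :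
    aDf q t (-1) (fun x' => PowerSeries.coeff (d + n)
        (HS (fun k => pw x' k * 1 / (1 - q ^ (k : ℕ))))) x =
      t ^ (∑ j, dl n j) * ((∏ i, x i) * av x) *
        PowerSeries.coeff d (HS (fun k => pw x k * 1 / (1 - q ^ (k : ℕ)))) := by
  rw [aDf_HS q t (-1) hq (fun _ => 1) x (d + n), aDS_one, mul_left_comm, PowerSeries.coeff_C_mul,
    PowerSeries.coeff_mul_X_pow]

/-! #### Symmetric kernel identities -/

theorem geom_inv (a : R) : (1 - PowerSeries.C a * ε) * (PowerSeries.mk fun m => a ^ m) = 1 :=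
  geom_mul a

/-- The symmetric matrix. -/
def Wm (t X : R) (x y : Fin n → R) : Matrix (Fin n) (Fin n) (PowerSeries R) :=
  Matrix.of fun i k => (PowerSeries.mk fun m => (x i * y k) ^ m) +
    PowerSeries.C X * (PowerSeries.mk fun m => (t * (x i * y k)) ^ m)

theorem Wm_symm (t X : R) (x y : Fin n → R) : (Wm t X x y).transpose = Wm t X y x := by
  ext1 i k
  simp only [Wm, Matrix.transpose_apply, Matrix.of_apply]
  rw [mul_comm (x k) (y i)]

/-- The Cauchy denominators. -/
def Bp (x y : Fin n → R) : PowerSeries R := ∏ i, ∏ r, (1 - PowerSeries.C (x i * y r) * ε)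

theorem Bp_symm (x y : Fin n → R) : Bp x y = Bp y x := by
  unfold Bp
  rw [Finset.prod_comm]
  simp only [mul_comm]

theorem shift_factor (t a : R) (y : Fin n → R) :
    HS (fun k => - (a ^ (k : ℕ) * (pw y k * (1 - t ^ (k : ℕ))))) *
      ∏ r, (1 - PowerSeries.C (t * (a * y r)) * ε) = ∏ r, (1 - PowerSeries.C (a * y r) * ε) := by
  have h1 : ∀ c : R, ∏ r, (1 - PowerSeries.C (c * y r) * ε) =
      HS (fun k => ∑ r, - ((c * y r) ^ (k : ℕ))) := by
    intro c
    rw [HS_sum]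
    exact Finset.prod_congr rfl fun r _ => (HS_neg_geom _).symm
  simp only [← mul_assoc]
  rw [h1, h1, ← HS_add]
  congr 1
  funext k
  unfold pw
  rw [Finset.mul_sum, Finset.sum_mul, ← Finset.sum_neg_distrib, ← Finset.sum_add_distrib]
  refine Finset.sum_congr rfl fun r _ => ?_
  ring

theorem aDS_mul (t X : R) (x y : Fin n → R) :
    aDS t X (fun k => pw y k * (1 - t ^ (k : ℕ))) x * (PowerSeries.C (av y) * ε ^ (∑ j, dl n j)) =
      Bp x y * (Wm t X x y).det := by
  classical
  have h0 : PowerSeries.C (av y) * ε ^ (∑ j, dl n j) =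
      (Mq (fun r => ε * PowerSeries.C (y r))).det := by
    unfold av at *
    rw [det_Mq, av, alt_smul, alt_map, mul_comm]
  rw [h0, aDS, ← Matrix.det_mul]
  have h1 : Bp x y * (Wm t X x y).det = Matrix.det (Matrix.of fun i k =>
      (∏ r, (1 - PowerSeries.C (x i * y r) * ε)) * Wm t X x y i k) := by
    rw [Matrix.det_mul_column]; rfl
  rw [h1]
  congr 1
  ext1 i k
  rw [Matrix.mul_apply]
  simp only [Matrix.of_apply]
  set g := HS (fun k => - (x i ^ (k : ℕ) * (pw y k * (1 - t ^ (k : ℕ)))))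
  have h2 : ∑ j, PowerSeries.C (x i) ^ dl n j * (1 + PowerSeries.C t ^ dl n j *
      (PowerSeries.C X * g)) * Mq (fun r => ε * PowerSeries.C (y r)) j k =
      (∏ r ∈ Finset.univ.erase k, (1 - PowerSeries.C (x i * y r) * ε)) + PowerSeries.C X * g *
        ∏ r ∈ Finset.univ.erase k, (1 - PowerSeries.C (t * (x i * y r)) * ε) := by
    have e1 := Qp_eval (fun r => ε * PowerSeries.C (y r)) k (PowerSeries.C (x i))
    have e2 := Qp_eval (fun r => ε * PowerSeries.C (y r)) k (PowerSeries.C t * PowerSeries.C (x i))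
    have e3 : ∏ r ∈ Finset.univ.erase k, (1 - PowerSeries.C (x i * y r) * ε) =
        ∏ r ∈ Finset.univ.erase k, (1 - ε * PowerSeries.C (y r) * PowerSeries.C (x i)) := by
      refine Finset.prod_congr rfl fun r _ => ?_
      rw [_root_.map_mul]; ring
    have e4 : ∏ r ∈ Finset.univ.erase k, (1 - PowerSeries.C (t * (x i * y r)) * ε) =
        ∏ r ∈ Finset.univ.erase k,
          (1 - ε * PowerSeries.C (y r) * (PowerSeries.C t * PowerSeries.C (x i))) := by
      refine Finset.prod_congr rfl fun r _ => ?_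
      rw [_root_.map_mul, _root_.map_mul]; ring
    rw [e3, e4, ← e1, ← e2, Finset.mul_sum, ← Finset.sum_add_distrib]
    refine Finset.sum_congr rfl fun j _ => ?_
    rw [mul_pow]; ring
  rw [h2]
  have hs := shift_factor t (x i) y
  rw [← Finset.mul_prod_erase _ _ (Finset.mem_univ k)] at hs
  have ha := geom_inv (x i * y k)
  have hb := geom_inv (t * (x i * y k))
  simp only [Wm, Matrix.of_apply]
  set B := ∏ r, (1 - PowerSeries.C (x i * y r) * ε) with hB
  have hB2 := Finset.mul_prod_erase Finset.univ
    (fun r => 1 - PowerSeries.C (x i * y r) * ε) (Finset.mem_univ k)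
  simp only [← hB] at hB2
  set B' := ∏ r ∈ Finset.univ.erase k, (1 - PowerSeries.C (x i * y r) * ε)
  set D' := ∏ r ∈ Finset.univ.erase k, (1 - PowerSeries.C (t * (x i * y r)) * ε)
  set ga := (PowerSeries.mk fun m => (x i * y k) ^ m)
  set gb := (PowerSeries.mk fun m => (t * (x i * y k)) ^ m)
  have f1 : B * ga = B' := by
    rw [← hB2]
    calc _ = B' * ((1 - PowerSeries.C (x i * y k) * ε) * ga) := by ring
      _ = _ := by rw [ha, mul_one]
  have f2 : B * gb = g * D' := by
    rw [← hs]
    calc _ = g * D' * ((1 - PowerSeries.C (t * (x i * y k)) * ε) * gb) := by ring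
      _ = _ := by rw [hb, mul_one]
  rw [mul_add, f1, mul_left_comm, f2]
  ring

/-- The kernel. -/
def Kern (q t : R) (d : ℕ) (x y : Fin n → R) : R :=
  PowerSeries.coeff d (HS fun k => pw x k * pw y k / ((1 - q ^ (k : ℕ)) / (1 - t ^ (k : ℕ))))

theorem Kern_symm (q t : R) (d : ℕ) (x y : Fin n → R) : Kern q t d x y = Kern q t d y x := by
  unfold Kern
  simp only [mul_comm]

theorem Kern_eq (q t : R) (d : ℕ) (x y : Fin n → R) : Kern q t d x y =
    PowerSeries.coeff d (HS fun k => pw x k * (pw y k * (1 - t ^ (k : ℕ))) / (1 - q ^ (k : ℕ))) := by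
  unfold Kern
  congr 2
  funext k
  rw [div_div_eq_mul_div, mul_assoc]

theorem aDf_Kern (q t X : R) (hq : ∀ k : ℕ+, 1 - q ^ (k : ℕ) ≠ 0) (d : ℕ) (x y : Fin n → R) :
    av y * aDf q t X (fun x' => Kern q t d x' y) x =
      PowerSeries.coeff (d + ∑ j, dl n j)
        (HS (fun k => pw x k * (pw y k * (1 - t ^ (k : ℕ))) / (1 - q ^ (k : ℕ))) *
          (Bp x y * (Wm t X x y).det)) := by
  simp only [Kern_eq]
  rw [aDf_HS q t X hq, ← aDS_mul, ← mul_assoc, ← mul_assoc, PowerSeries.coeff_mul_X_pow, mul_comm _ (PowerSeries.C (av y)),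
    PowerSeries.coeff_C_mul]

theorem K1 (q t X : R) (hq : ∀ k : ℕ+, 1 - q ^ (k : ℕ) ≠ 0) (d : ℕ) (x y : Fin n → R) :
    av y * aDf q t X (fun x' => Kern q t d x' y) x =
      av x * aDf q t X (fun y' => Kern q t d x y') y := by
  simp only [Kern_symm q t d x]
  rw [aDf_Kern q t X hq, aDf_Kern q t X hq, Bp_symm x y, ← Wm_symm t X x y, Matrix.det_transpose]
  congr 3
  funext k
  ring

theorem K2 (q t : R) (hq : ∀ k : ℕ+, 1 - q ^ (k : ℕ) ≠ 0) (d : ℕ) (x y : Fin n → R) :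
    av y * aDf q t (-1) (fun x' => Kern q t (d + n) x' y) x =
      ((∏ i, x i) * ∏ i, y i) * (av y * aDf q t (-t) (fun x' => Kern q t d x' y) x) := by
  rw [aDf_Kern q t _ hq, aDf_Kern q t _ hq]
  have h1 : (Wm t (-1) x y).det =
      PowerSeries.C ((∏ i, x i) * ∏ i, y i) * ε ^ n * (Wm t (-t) x y).det := by
    have e : Wm t (-1) x y = Matrix.of fun i k => PowerSeries.C (x i) *
        (Matrix.of fun i k => (ε * PowerSeries.C (y k)) * Wm t (-t) x y i k) i k := by
      ext1 i k
      simp only [Wm, Matrix.of_apply]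
      have ha := geom_inv (x i * y k)
      have hb := geom_inv (t * (x i * y k))
      set ga := (PowerSeries.mk fun m => (x i * y k) ^ m)
      set gb := (PowerSeries.mk fun m => (t * (x i * y k)) ^ m)
      have e1 : ga = 1 + PowerSeries.C (x i * y k) * ε * ga := by
        linear_combination ha
      have e2 : gb = 1 + PowerSeries.C (t * (x i * y k)) * ε * gb := by
        linear_combination hb
      have e3 : ga - gb = (PowerSeries.C (x i * y k) * ε * ga) - PowerSeries.C (t * (x i * y k)) * ε * gb := by
        linear_combination e1 - e2
      simp only [_root_.map_mul, _root_.map_neg, _root_.map_one] at e3 ⊢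
      linear_combination e3
    rw [e, Matrix.det_mul_column, Matrix.det_mul_row, Finset.prod_mul_distrib,
      Finset.prod_const, Finset.card_univ, Fintype.card_fin, _root_.map_mul, _root_.map_prod,
      _root_.map_prod]
    ring
  rw [h1]
  have h2 : ∀ (A B D : PowerSeries R) (c : R), A * (B * (PowerSeries.C c * ε ^ n * D)) =
      PowerSeries.C c * ((A * (B * D)) * ε ^ n) := by intros; ring
  rw [h2, PowerSeries.coeff_C_mul, add_right_comm, PowerSeries.coeff_mul_X_pow]

end K
end HF
end

open MvPolynomial

noncomputable section
set_option linter.unusedSectionVars false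
namespace HF

/-! ### Macdonald polynomials are eigenfunctions -/

section E
variable {R : Type} [Field R] [CharZero R] {n : ℕ}

theorem frm_smul_right (d : ℕ) (w : ℕ+ → R) (f g : SymFn R) (c : R) :
    frm d w f (c • g) = c * frm d w f g := by
  unfold frm
  rw [Finset.mul_sum]
  exact Finset.sum_congr rfl fun k _ => by rw [cf_smul]; ring

theorem frm_sum_right {ι : Type} (d : ℕ) (w : ℕ+ → R) (f : SymFn R) (s : Finset ι)
    (g : ι → SymFn R) : frm d w f (∑ i ∈ s, g i) = ∑ i ∈ s, frm d w f (g i) := by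
  unfold frm
  rw [Finset.sum_comm]
  refine Finset.sum_congr rfl fun k _ => ?_
  rw [cf_sum, Finset.mul_sum, Finset.sum_mul]

variable {P : Multiset ℕ+ → SymFn R}

theorem Tri.hom' (h : Tri P) {d : ℕ} {a : Multiset ℕ+} (ha : a ∈ PS d) : Hom (P a) d := by
  rw [← mem_PS.1 ha]; exact h.hom a

theorem norm_ne_zero {d : ℕ} {w : ℕ+ → R} (hw : ∀ k, w k ≠ 0) (h : Tri P)
    (ho : ∀ a ∈ PS d, ∀ b ∈ PS d, a ≠ b → frm d w (P a) (P b) = 0)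
    {a : Multiset ℕ+} (ha : a ∈ PS d) : frm d w (P a) (P a) ≠ 0 := by
  classical
  obtain ⟨G, hG, hd⟩ := exists_dual d w hw P (h.unit d)
  obtain ⟨c, hc⟩ := h.expand (hG a)
  have h1 := hd a ha a ha
  rw [if_pos rfl, hc, frm_sum_right, Finset.sum_eq_single a] at h1
  · rw [frm_smul_right] at h1
    intro h0
    rw [h0, mul_zero] at h1
    exact zero_ne_one h1
  · intro b hb hne
    rw [frm_smul_right, ho a ha b hb hne.symm, mul_zero]
  · intro h; exact absurd ha h

theorem bil_indep (h : Tri P) {d : ℕ} (e : Multiset ℕ+ → Multiset ℕ+ → R)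
    (h0 : ∀ x y : Fin n → R, ∑ a ∈ PSn n d, ∑ b ∈ PSn n d,
      e a b * (AL R n (P a) x * AL R n (P b) y) = 0) :
    ∀ a ∈ PSn n d, ∀ b ∈ PSn n d, e a b = 0 := by
  intro a ha b hb
  have h1 : ∀ y : Fin n → R, ∑ b ∈ PSn n d, e a b * AL R n (P b) y = 0 := by
    intro y
    have := h.indep (n := n) (d := d) (fun a => ∑ b ∈ PSn n d, e a b * AL R n (P b) y) ?_ a ha
    · exact this
    · funext x
      rw [Finset.sum_apply]
      simp only [Pi.smul_apply, smul_eq_mul, Pi.zero_apply]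
      rw [← h0 x y]
      refine Finset.sum_congr rfl fun a _ => ?_
      rw [Finset.sum_mul]
      exact Finset.sum_congr rfl fun b _ => by ring
  apply h.indep (n := n) (d := d) (fun b => e a b) _ b hb
  funext y
  rw [Finset.sum_apply]
  exact h1 y

/-- Triangular eigenfamilies. -/
def Eig (q t : R) (P : Multiset ℕ+ → SymFn R) : Prop :=
  Tri P ∧ ∀ (n : ℕ) (lam : Multiset ℕ+), Multiset.card lam ≤ n → ∀ X,
    DL R n q t X (P lam) = Ev n q t lam X • AL R n (P lam)

theorem aDf_lin {ι : Type} (q t X : R) (s : Finset ι) (c : ι → R) (f : ι → SymFn R)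
    (F : (Fin n → R) → R) (hF : ∀ v, F v = ∑ i ∈ s, c i * eval (pw v) (f i)) (v : Fin n → R) :
    aDf q t X F v = ∑ i ∈ s, c i * DL R n q t X (f i) v := by
  have : F = ∑ i ∈ s, c i • fnL R n (f i) := by
    funext v
    rw [hF, Finset.sum_apply]; rfl
  rw [this, ← aDL_apply, _root_.map_sum, Finset.sum_apply]
  refine Finset.sum_congr rfl fun i _ => ?_
  rw [_root_.map_smul]; rfl

theorem Tri.scalar_sum_PSn (h : Tri P) {d : ℕ} (L : SymFn R →ₗ[R] ((Fin n → R) → R))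
    (hL0 : ∀ k : Multiset ℕ+, n < Multiset.card k → L (schur k) = 0) (b : Multiset ℕ+ → R)
    (v : Fin n → R) :
    ∑ k ∈ PS d, b k * L (P k) v = ∑ k ∈ PSn n d, b k * L (P k) v := by
  have := congrFun (h.sum_PSn (d := d) L hL0 b) v
  rw [Finset.sum_apply, Finset.sum_apply] at this
  exact this

theorem DL_expand (h : Tri P) (q t X : R) {d : ℕ} : ∃ D : Multiset ℕ+ → Multiset ℕ+ → R,
    (∀ a ∈ PSn n d, DL R n q t X (P a) = ∑ b ∈ PSn n d, D a b • AL R n (P b)) ∧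
    (∀ a ∈ PSn n d, D a a = Ev n q t a X) ∧
    (∀ a ∈ PSn n d, ∀ b, D a b ≠ 0 → b = a ∨ Phi n b < Phi n a) := by
  classical
  have h1 : ∀ a, ∃ c : Multiset ℕ+ → R, a ∈ PSn n d → DL R n q t X (P a) - Ev n q t a X • AL R n (P a) =
      ∑ k ∈ (PSn n d).filter (fun k => Phi n k < Phi n a), c k • AL R n (P k) := by
    intro a
    by_cases ha : a ∈ PSn n d
    · have hc := (mem_PSn.1 ha).2
      have h2 := h.DL_low (n := n) q t X hc
      have h3 := Submodule.smul_mem _ (Ev n q t a X) (h.AL_low (n := n) hc)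
      have h4 := Submodule.sub_mem _ h2 h3
      rw [(mem_PSn.1 ha).1] at h4
      have h5 := lead_span (d := d) (fun k => AL R n (P k)) (by
        intro k hk
        have := h.AL_low (n := n) (mem_PSn.1 hk).2
        rwa [(mem_PSn.1 hk).1] at this) (Phi n a) h4
      rw [Submodule.mem_span_image_finset_iff_exists_fun'] at h5
      obtain ⟨c, hc⟩ := h5
      refine ⟨c, fun _ => ?_⟩
      rw [hc, smul_sub]
      abel
    · exact ⟨0, fun h => absurd h ha⟩
  choose c hc using h1
  refine ⟨fun a b => (if b = a then Ev n q t a X else 0) + (if Phi n b < Phi n a then c a b else 0),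
    ?_, ?_, ?_⟩
  · intro a ha
    have := hc a ha
    rw [sub_eq_iff_eq_add] at this
    rw [this, Finset.sum_filter]
    simp only [add_smul, Finset.sum_add_distrib, ite_smul, zero_smul]
    rw [Finset.sum_ite_eq' , if_pos ha, add_comm]
  · intro a _
    simp
  · intro a _ b hb
    by_contra hcon
    push Not at hcon
    apply hb
    beta_reduce
    rw [if_neg hcon.1, if_neg (by omega), add_zero]

theorem mac_kernel (q t : R) (hq : ∀ k : ℕ+, 1 - q ^ (k : ℕ) ≠ 0) (ht : ∀ k : ℕ+, 1 - t ^ (k : ℕ) ≠ 0)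
    (hP : IsMacdonaldBasis q t P) (d : ℕ) :
    ∃ N : Multiset ℕ+ → R, (∀ a ∈ PS d, N a ≠ 0) ∧ ∀ χ χ' : ℕ+ → R,
      ∑ a ∈ PS d, N a * (eval χ (P a) * eval χ' (P a)) = PowerSeries.coeff d
        (HS fun k => χ k * χ' k / ((1 - q ^ (k : ℕ)) / (1 - t ^ (k : ℕ)))) := by
  classical
  have h : Tri P := hP.1
  set w : ℕ+ → R := fun k => (1 - q ^ (k : ℕ)) / (1 - t ^ (k : ℕ)) with hw
  have hw0 : ∀ k, w k ≠ 0 := fun k => div_ne_zero (hq k) (ht k)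
  have ho : ∀ a ∈ PS d, ∀ b ∈ PS d, a ≠ b → frm d w (P a) (P b) = 0 := by
    intro a ha b hb hne
    rw [hw, ← innerQT_eq (h.hom' ha)]
    exact hP.2 a b hne
  refine ⟨fun a => (frm d w (P a) (P a))⁻¹, fun a ha => inv_ne_zero (norm_ne_zero hw0 h ho ha), ?_⟩
  intro χ χ'
  rw [← dual_kernel d w hw0 P (fun a => (frm d w (P a) (P a))⁻¹ • P a) (fun a ha => h.hom' ha)
    (fun a ha => (h.hom' ha).smul _)]
  · refine Finset.sum_congr rfl fun a _ => ?_
    rw [smul_eval]; ring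
  · intro a ha b hb
    rw [frm_smul_right]
    split_ifs with hab
    · subst hab
      exact inv_mul_cancel₀ (norm_ne_zero hw0 h ho ha)
    · rw [ho a ha b hb hab, mul_zero]

theorem mac_eig (q t : R) (hq : ∀ k : ℕ+, 1 - q ^ (k : ℕ) ≠ 0) (ht : ∀ k : ℕ+, 1 - t ^ (k : ℕ) ≠ 0)
    (hP : IsMacdonaldBasis q t P) : Eig q t P := by
  refine ⟨hP.1, ?_⟩
  have h : Tri P := hP.1
  intro n lam hl X
  set d := wt lam with hd
  have hlam : lam ∈ PSn n d := mem_PSn.2 ⟨rfl, hl⟩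
  obtain ⟨N, hN, hker⟩ := mac_kernel q t hq ht hP d
  obtain ⟨D, hD, hDd, hDt⟩ := DL_expand (n := n) (d := d) h q t X
  have key : ∀ x y : Fin n → R, av y * aDf q t X (fun x' => Kern q t d x' y) x =
      ∑ a ∈ PSn n d, ∑ b ∈ PSn n d, (N a * D a b) * (AL R n (P b) x * AL R n (P a) y) := by
    intro x y
    rw [aDf_lin q t X (PS d) (fun a => N a * eval (pw y) (P a)) P (fun x' => Kern q t d x' y) (by
      intro v
      unfold Kern
      rw [← hker]
      exact Finset.sum_congr rfl fun a _ => by ring)]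
    rw [h.scalar_sum_PSn (DL R n q t X) (fun _ hk => tri_schur.DL_vanish q t X hk), Finset.mul_sum]
    refine Finset.sum_congr rfl fun a ha => ?_
    rw [hD a ha, Finset.sum_apply, Finset.mul_sum, Finset.mul_sum]
    refine Finset.sum_congr rfl fun b _ => ?_
    rw [AL_apply (P a)]
    simp only [Pi.smul_apply, smul_eq_mul]
    ring
  have hsym : ∀ a ∈ PSn n d, ∀ b ∈ PSn n d, N a * D a b - N b * D b a = 0 := by
    intro a ha b hb
    refine bil_indep h (n := n) (d := d) (fun b a => N a * D a b - N b * D b a) ?_ b hb a ha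
    intro x y
    have h1 := K1 q t X hq d x y
    have e : aDf q t X (fun y' => Kern q t d x y') y = aDf q t X (fun y' => Kern q t d y' x) y := by
      congr 1
      funext y'
      exact Kern_symm q t d x y'
    rw [e, key, key, ← sub_eq_zero, Finset.sum_comm, ← Finset.sum_sub_distrib] at h1
    rw [← h1]
    refine Finset.sum_congr rfl fun a _ => ?_
    rw [← Finset.sum_sub_distrib]
    refine Finset.sum_congr rfl fun b _ => ?_
    ring
  rw [hD lam hlam, Finset.sum_eq_single lam]
  · rw [hDd lam hlam]
  · intro b hb hne
    by_cases h0 : D lam b = 0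
    · rw [h0, zero_smul]
    · exfalso
      have h1 := (hDt lam hlam b h0).resolve_left hne
      have h2 := hsym lam hlam b hb
      have hNl := hN lam (mem_PS.2 rfl)
      have h3 : D b lam ≠ 0 := by
        intro h3
        rw [h3, mul_zero, sub_zero] at h2
        exact (mul_ne_zero hNl h0) h2
      have := (hDt b hb lam h3).resolve_left (fun h => hne h.symm)
      omega
  · intro h; exact absurd hlam h

/-- Linear combinations of eigenfunctions: coefficients are detected by the eigenvalue. -/
theorem Eig.coef {q t : R} (hE : Eig q t P) {d : ℕ} (c : Multiset ℕ+ → R) (X : R) (r s : R)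
    (h : r • DL R n q t X (∑ k ∈ PS d, c k • P k) = s • AL R n (∑ k ∈ PS d, c k • P k)) :
    ∀ k ∈ PSn n d, c k * (r * Ev n q t k X - s) = 0 := by
  rw [_root_.map_sum, _root_.map_sum] at h
  simp only [_root_.map_smul] at h
  rw [hE.1.sum_PSn (DL R n q t X) (fun _ hk => tri_schur.DL_vanish q t X hk),
    hE.1.sum_PSn (AL R n) (fun _ hk => tri_schur.AL_vanish hk)] at h
  apply hE.1.indep
  rw [← sub_eq_zero, Finset.smul_sum, Finset.smul_sum, ← Finset.sum_sub_distrib] at h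
  rw [← h]
  refine Finset.sum_congr rfl fun k hk => ?_
  rw [hE.2 n k (mem_PSn.1 hk).2]
  simp only [smul_smul, ← sub_smul]
  congr 1
  ring

theorem aDf_column (q t X : R) (F : (Fin n → R) → R) (v : Fin n → R) :
    aDf q t X (fun v => (∏ i, v i) * F v) v = (∏ i, v i) * aDf q t (X * q) F v := by
  unfold aDf
  rw [Finset.mul_sum]
  refine Finset.sum_congr rfl fun s _ => ?_
  have : (∏ i, if s i then X else 1) * ∏ i, sc s q v i = (∏ i, v i) * ∏ i, if s i then X * q else 1 := by
    rw [← Finset.prod_mul_distrib, ← Finset.prod_mul_distrib]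
    refine Finset.prod_congr rfl fun i _ => ?_
    unfold sc
    split_ifs <;> ring
  linear_combination (av (sc s t v) * F (sc s q v)) * this

theorem Ev_column (q t X : R) {lam kap : Multiset ℕ+}
    (h : ∀ i, i < n → part lam i = part kap i + 1) : Ev n q t kap (X * q) = Ev n q t lam X := by
  unfold Ev
  refine Finset.prod_congr rfl fun i hi => ?_
  rw [h i (Finset.mem_range.1 hi)]; ring

theorem sum_add_one_sq (f : Fin n → ℕ) :
    ∑ j, (f j + 1) ^ 2 = ∑ j, f j ^ 2 + 2 * ∑ j, f j + n := by
  have : ∀ j, (f j + 1) ^ 2 = f j ^ 2 + 2 * f j + 1 := fun j => by ring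
  simp [this, Finset.sum_add_distrib, Finset.mul_sum]

theorem low_column {d N : ℕ} {f : (Fin n → R) → R} (hf : f ∈ Low R n d N) :
    (fun v => (∏ i, v i) * f v) ∈ Low R n (d + n) (N + 2 * (d + ∑ j, dl n j) + n) := by
  unfold Low at hf
  induction hf using Submodule.span_induction with
  | mem x hx =>
    obtain ⟨k, h1, h2, h3, rfl⟩ := hx
    have : (fun v : Fin n → R => (∏ i, v i) * alt v (dlp n k)) =
        fun v => alt v (fun j => dlp n k j + 1) := by
      funext v; rw [alt_add_one]
    simp only [this]
    have hs := sum_dlp k h1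
    apply alt_mem_Low
    · rw [Finset.sum_add_distrib, hs, h2]; simp; ring
    · have : ∑ j, (dlp n k j + 1) ^ 2 = Phi n k + 2 * (d + ∑ j, dl n j) + n := by
        rw [Phi_eq, ← h2, ← hs, sum_add_one_sq]
      omega
  | zero => simp only [Pi.zero_apply, mul_zero]; exact Submodule.zero_mem _
  | add x y _ _ hx hy =>
    have := Submodule.add_mem _ hx hy
    convert this using 1
    funext v; simp [mul_add]
  | smul a x _ hx =>
    have := Submodule.smul_mem _ a hx
    convert this using 1
    funext v; simp; ring

theorem Phi_column {lam kap : Multiset ℕ+} (hk : Multiset.card kap ≤ n)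
    (h : ∀ i, i < n → part lam i = part kap i + 1) :
    Phi n lam = Phi n kap + 2 * (wt kap + ∑ j, dl n j) + n := by
  rw [Phi_eq, Phi_eq, ← sum_dlp kap hk, ← sum_add_one_sq]
  refine Finset.sum_congr rfl fun j _ => ?_
  unfold dlp
  rw [h j j.2]; ring

theorem wt_column {lam kap : Multiset ℕ+} (hl : Multiset.card lam ≤ n) (hk : Multiset.card kap ≤ n)
    (h : ∀ i, i < n → part lam i = part kap i + 1) : wt lam = wt kap + n := by
  rw [← sum_part lam n hl, ← sum_part kap n hk, Finset.sum_congr rfl fun i hi => h i (Finset.mem_range.1 hi),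
    Finset.sum_add_distrib]
  simp

/-- Removing a full column. -/
theorem Eig.column {q t : R} (hE : Eig q t P) (hg : Gen q t) {lam kap : Multiset ℕ+}
    (hl : Multiset.card lam ≤ n) (hk : Multiset.card kap ≤ n)
    (h : ∀ i, i < n → part lam i = part kap i + 1) (v : Fin n → R) :
    eval (pw v) (P lam) = (∏ i, v i) * eval (pw v) (P kap) := by
  classical
  set d := wt lam with hd
  have hw := wt_column hl hk h
  have e1 : ak R n lam = fun v => (∏ i, v i) * ak R n kap v := by
    funext v
    unfold ak
    rw [← alt_add_one]
    congr 1
    funext j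
    unfold dlp
    rw [h j j.2]; ring
  have h1 := low_column (hE.1.AL_low hk)
  rw [← hw, ← Phi_column hk h] at h1
  have h2 := Submodule.sub_mem _ h1 (hE.1.AL_low hl)
  have h3 := lead_span (d := d) (fun k => AL R n (P k)) (by
        intro k hk
        have := hE.1.AL_low (n := n) (mem_PSn.1 hk).2
        rwa [(mem_PSn.1 hk).1] at this) _ h2
  rw [Submodule.mem_span_image_finset_iff_exists_fun'] at h3
  obtain ⟨c, hc⟩ := h3
  set b : Multiset ℕ+ → R := fun k => if k ∈ PSn n d ∧ Phi n k < Phi n lam then c k else 0 with hb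
  set f := ∑ k ∈ PS d, b k • P k with hf
  have hfe : AL R n f = ∑ k ∈ (PSn n d).filter (fun k => Phi n k < Phi n lam), c k • AL R n (P k) := by
    rw [hf, _root_.map_sum]
    simp only [_root_.map_smul]
    rw [hE.1.sum_PSn (AL R n) (fun _ hk => tri_schur.AL_vanish hk), Finset.sum_filter]
    refine Finset.sum_congr rfl fun k hk => ?_
    simp only [hb, hk, true_and]
    split_ifs <;> simp
  have hfv : ∀ v : Fin n → R, eval (pw v) f = (∏ i, v i) * eval (pw v) (P kap) - eval (pw v) (P lam) := by
    refine av_cancel_eq (isPoly_eval f) ((isPoly_prod.mul (isPoly_eval _)).sub (isPoly_eval _)) ?_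
    intro v
    have := congrFun (hfe.trans hc) v
    rw [e1] at this
    simp only [Pi.sub_apply, AL_apply] at this
    rw [mul_comm, this]
    ring
  have hz : ∀ k ∈ PSn n d, b k = 0 := by
    intro k hkm
    by_contra hbk
    have hlt : Phi n k < Phi n lam := by
      by_contra hcon
      apply hbk
      simp only [hb]
      rw [if_neg (fun hh => hcon hh.2)]
    have hall : ∀ X, Ev n q t k X = Ev n q t lam X := by
      intro X
      have := hE.coef (n := n) b X 1 (Ev n q t lam X) ?_ k hkm
      · have := (mul_eq_zero.1 this).resolve_left hbk
        rw [one_mul] at this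
        exact sub_eq_zero.1 this
      · rw [one_smul]
        funext v
        rw [← hf]
        have e2 : fnL R n f = fnL R n (- P lam) + (fun v => (∏ i, v i) * fn n (P kap) v) := by
          funext v
          rw [fnL_apply, hfv v, Pi.add_apply, fnL_apply, _root_.map_neg]
          unfold fn
          ring
        have e3 : DL R n q t X f = DL R n q t X (- P lam) +
            aDL q t X (fun v => (∏ i, v i) * fn n (P kap) v) := by
          unfold DL
          rw [LinearMap.comp_apply, e2, _root_.map_add]; rfl
        rw [e3, _root_.map_neg, hE.2 n lam hl]
        simp only [Pi.add_apply, Pi.neg_apply, Pi.smul_apply, smul_eq_mul, aDL_apply, AL_apply]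
        rw [aDf_column, ← DL_apply, hE.2 n kap hk, Ev_column q t X h, hfv v]
        simp only [Pi.smul_apply, smul_eq_mul, AL_apply]
        ring
    have := Ev_inj hg (mem_PSn.1 hkm).2 hl hall
    rw [this] at hlt
    omega
  have hf0 : AL R n f = AL R n 0 := by
    rw [hf, _root_.map_sum, _root_.map_zero]
    simp only [_root_.map_smul]
    rw [hE.1.sum_PSn (AL R n) (fun _ hk => tri_schur.AL_vanish hk)]
    exact Finset.sum_eq_zero fun k hk => by rw [hz k hk, zero_smul]
  have := AL_inj hf0 v
  rw [hfv, _root_.map_zero] at this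
  exact (sub_eq_zero.1 this).symm

end E
end HF
end

open MvPolynomial

noncomputable section
set_option linter.unusedSectionVars false
namespace HF

/-! ### Columns and principal specialization -/

section Col

/-- Remove the first column. -/
def dn (a : Multiset ℕ+) : Multiset ℕ+ := (exists_column a).choose

theorem dn_card (a : Multiset ℕ+) : Multiset.card (dn a) ≤ Multiset.card a :=
  (exists_column a).choose_spec.1

theorem dn_part (a : Multiset ℕ+) (i : ℕ) : part (dn a) i = part a i - 1 :=
  (exists_column a).choose_spec.2 i

theorem exists_up (n : ℕ) (k : Multiset ℕ+) : ∃ a : Multiset ℕ+, Multiset.card k ≤ n →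
    Multiset.card a ≤ n ∧ ∀ i, part a i = if i < n then part k i + 1 else 0 := by
  by_cases hk : Multiset.card k ≤ n
  · obtain ⟨a, h1, h2⟩ := exists_part (fun i => if i < n then part k i + 1 else 0) (by
      intro i j hij
      have := part_antitone k hij
      beta_reduce
      split_ifs <;> omega) n (by intro i hi; rw [if_neg (by omega)])
    exact ⟨a, fun _ => ⟨h1, h2⟩⟩
  · exact ⟨0, fun h => absurd h hk⟩

/-- Add a full column of height `n`. -/
def up (n : ℕ) (k : Multiset ℕ+) : Multiset ℕ+ := (exists_up n k).choose

variable {n : ℕ}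

theorem up_part {k : Multiset ℕ+} (hk : Multiset.card k ≤ n) (i : ℕ) :
    part (up n k) i = if i < n then part k i + 1 else 0 := ((exists_up n k).choose_spec hk).2 i

theorem up_card {k : Multiset ℕ+} (hk : Multiset.card k ≤ n) : Multiset.card (up n k) = n := by
  refine le_antisymm ((exists_up n k).choose_spec hk).1 ?_
  by_contra h
  push Not at h
  have h1 := part_ge (up n k) (le_refl _)
  rw [up_part hk, if_pos h] at h1
  omega

theorem up_part' {k : Multiset ℕ+} (hk : Multiset.card k ≤ n) (i : ℕ) (hi : i < n) :
    part (up n k) i = part k i + 1 := by rw [up_part hk, if_pos hi]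

theorem dn_up {k : Multiset ℕ+} (hk : Multiset.card k ≤ n) : dn (up n k) = k := by
  apply part_inj
  intro i
  rw [dn_part, up_part hk]
  split_ifs with h
  · omega
  · rw [part_ge k (by omega)]

theorem up_dn {a : Multiset ℕ+} (ha : Multiset.card a = n) : up n (dn a) = a := by
  have hd : Multiset.card (dn a) ≤ n := ha ▸ dn_card a
  apply part_inj
  intro i
  rw [up_part hd, dn_part]
  split_ifs with h
  · have := part_pos a (i := i) (by omega)
    omega
  · rw [part_ge a (by omega)]

theorem dn_part' {a : Multiset ℕ+} (ha : Multiset.card a = n) (i : ℕ) (hi : i < n) :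
    part a i = part (dn a) i + 1 := by
  have := part_pos a (i := i) (by omega)
  rw [dn_part]; omega

theorem dn_wt (a : Multiset ℕ+) : wt a = wt (dn a) + Multiset.card a :=
  wt_column le_rfl (dn_card a) (dn_part' rfl)

theorem up_wt {k : Multiset ℕ+} (hk : Multiset.card k ≤ n) : wt (up n k) = wt k + n :=
  wt_column (up_card hk).le hk (up_part' hk)

theorem col_sum {M : Type} [AddCommMonoid M] {d : ℕ} (h : Multiset ℕ+ → M)
    (h0 : ∀ a, Multiset.card a ≠ n → h a = 0) :
    ∑ a ∈ PSn n (d + n), h a = ∑ k ∈ PSn n d, h (up n k) := by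
  symm
  refine Finset.sum_of_injOn (up n) ?_ ?_ ?_ (fun _ _ => rfl)
  · intro a ha b hb hab
    rw [← dn_up (mem_PSn.1 ha).2, hab, dn_up (mem_PSn.1 hb).2]
  · intro a ha
    have ha := mem_PSn.1 (Finset.mem_coe.1 ha)
    exact mem_PSn.2 ⟨by rw [up_wt ha.2, ha.1], (up_card ha.2).le⟩
  · intro a ha hn
    apply h0
    intro hc
    apply hn
    have ha := mem_PSn.1 ha
    refine ⟨dn a, Finset.mem_coe.2 (mem_PSn.2 ⟨?_, hc ▸ dn_card a⟩), up_dn hc⟩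
    have := dn_wt a
    omega

end Col

section PSpec
variable {R : Type} [Field R] [CharZero R] {n : ℕ} {P : Multiset ℕ+ → SymFn R}

theorem Ev_neg_one (q t : R) {a : Multiset ℕ+} (ha : Multiset.card a < n) : Ev n q t a (-1) = 0 := by
  unfold Ev
  refine Finset.prod_eq_zero (i := n - 1) (Finset.mem_range.2 (by omega)) ?_
  rw [part_ge a (by omega)]
  simp

theorem K3gen {q t : R} (hq : ∀ k : ℕ+, 1 - q ^ (k : ℕ) ≠ 0) (hE : Eig q t P) (hg : Gen q t)
    (g : Multiset ℕ+ → R)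
    (hk : ∀ (d : ℕ) (χ : ℕ+ → R), ∑ a ∈ PS d, g a * eval χ (P a) =
      PowerSeries.coeff d (HS fun k => χ k * 1 / (1 - q ^ (k : ℕ))))
    (a : Multiset ℕ+) (ha : Multiset.card a = n) :
    Ev n q t a (-1) * g a = t ^ (∑ j, dl n j) * g (dn a) := by
  classical
  set d := wt (dn a) with hd
  have hda : wt a = d + n := by rw [dn_wt a, ha]
  have hz := hE.1.indep (n := n) (d := d + n)
    (fun b => g b * Ev n q t b (-1) - if Multiset.card b = n then t ^ (∑ j, dl n j) * g (dn b) else 0) (by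
    funext x
    rw [Finset.sum_apply]
    simp only [sub_mul, Finset.sum_sub_distrib, Pi.zero_apply, Pi.smul_apply, smul_eq_mul]
    rw [sub_eq_zero]
    have h1 := K3 q t hq x d
    rw [aDf_lin q t (-1) (PS (d + n)) g P _ (fun v => (hk (d+n) (pw v)).symm),
      hE.1.scalar_sum_PSn (DL R n q t (-1)) (fun _ hk => tri_schur.DL_vanish q t (-1) hk)] at h1
    have h2 : ∑ b ∈ PSn n (d + n), g b * DL R n q t (-1) (P b) x =
        ∑ b ∈ PSn n (d + n), g b * Ev n q t b (-1) * AL R n (P b) x := by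
      refine Finset.sum_congr rfl fun b hb => ?_
      rw [hE.2 n b (mem_PSn.1 hb).2, Pi.smul_apply, smul_eq_mul, mul_assoc]
    rw [← h2, h1, col_sum _ (by intro a ha; rw [if_neg ha, zero_mul]), ← hk]
    have h3 := hE.1.scalar_sum_PSn (n := n) (d := d) (AL R n) (fun _ hk => tri_schur.AL_vanish hk) g x
    simp only [AL_apply] at h3
    have h4 : av x * ∑ a ∈ PS d, g a * eval (pw x) (P a) = ∑ k ∈ PS d, g k * (av x * eval (pw x) (P k)) := by
      rw [Finset.mul_sum]
      exact Finset.sum_congr rfl fun k _ => by ring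
    rw [mul_assoc, mul_assoc, h4, h3, Finset.mul_sum, Finset.mul_sum]
    refine Finset.sum_congr rfl fun k hkm => ?_
    have hc := (mem_PSn.1 hkm).2
    rw [if_pos (up_card hc), dn_up hc, AL_apply, hE.column hg (up_card hc).le hc (up_part' hc)]
    ring)
  have := hz a (mem_PSn.2 ⟨hda, ha.le⟩)
  beta_reduce at this
  rw [if_pos ha, sub_eq_zero] at this
  rw [← this, mul_comm]

theorem K2gen {q t : R} (hq : ∀ k : ℕ+, 1 - q ^ (k : ℕ) ≠ 0) (hE : Eig q t P) (hg : Gen q t)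
    (N : Multiset ℕ+ → R)
    (hk : ∀ (d : ℕ) (χ χ' : ℕ+ → R), ∑ a ∈ PS d, N a * (eval χ (P a) * eval χ' (P a)) =
      PowerSeries.coeff d (HS fun k => χ k * χ' k / ((1 - q ^ (k : ℕ)) / (1 - t ^ (k : ℕ)))))
    (a : Multiset ℕ+) (ha : Multiset.card a = n) :
    Ev n q t a (-1) * N a = Ev n q t (dn a) (-t) * N (dn a) := by
  classical
  set d := wt (dn a) with hd
  have hda : wt a = d + n := by rw [dn_wt a, ha]
  have hx : ∀ (e : ℕ) (X : R) (x y : Fin n → R),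
      av y * aDf q t X (fun x' => Kern q t e x' y) x =
      ∑ b ∈ PSn n e, N b * Ev n q t b X * (AL R n (P b) x * AL R n (P b) y) := by
    intro e X x y
    rw [aDf_lin q t X (PS e) (fun b => N b * eval (pw y) (P b)) P _ (by
      intro v; unfold Kern; rw [← hk]; exact Finset.sum_congr rfl fun b _ => by ring),
      hE.1.scalar_sum_PSn (DL R n q t X) (fun _ hk => tri_schur.DL_vanish q t X hk), Finset.mul_sum]
    refine Finset.sum_congr rfl fun b hb => ?_
    rw [hE.2 n b (mem_PSn.1 hb).2, Pi.smul_apply, smul_eq_mul, AL_apply, AL_apply]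
    ring
  have hz := bil_indep (n := n) hE.1 (d := d + n)
    (fun b c => if b = c then N b * Ev n q t b (-1) -
      (if Multiset.card b = n then Ev n q t (dn b) (-t) * N (dn b) else 0) else 0) (by
    intro x y
    have h0 : ∀ b ∈ PSn n (d+n), (∑ c ∈ PSn n (d + n), (if b = c then N b * Ev n q t b (-1) -
      (if Multiset.card b = n then Ev n q t (dn b) (-t) * N (dn b) else 0) else 0) *
        (AL R n (P b) x * AL R n (P c) y)) = N b * Ev n q t b (-1) * (AL R n (P b) x * AL R n (P b) y) -
        (if Multiset.card b = n then Ev n q t (dn b) (-t) * N (dn b) else 0) *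
          (AL R n (P b) x * AL R n (P b) y) := by
      intro b hb
      simp only [ite_mul, zero_mul]
      rw [Finset.sum_ite_eq, if_pos hb, sub_mul, ite_mul, zero_mul]
    rw [Finset.sum_congr rfl h0, Finset.sum_sub_distrib, ← hx, K2 q t hq, hx,
      col_sum _ (by intro a ha; rw [if_neg ha, zero_mul]), sub_eq_zero, Finset.mul_sum]
    refine Finset.sum_congr rfl fun k hkm => ?_
    have hc := (mem_PSn.1 hkm).2
    rw [if_pos (up_card hc), dn_up hc]
    simp only [AL_apply]
    rw [hE.column hg (up_card hc).le hc (up_part' hc), hE.column hg (up_card hc).le hc (up_part' hc)]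
    ring)
  have h1 := mem_PSn.2 ⟨hda, ha.le⟩
  have := hz a h1 a h1
  beta_reduce at this
  rw [if_pos rfl, if_pos ha, sub_eq_zero] at this
  rw [← this, mul_comm]

theorem Tri.zero (h : Tri P) : P 0 = 1 := by
  have h1 := h 0
  have : {mu | StrictDom mu (0 : Multiset ℕ+)} = ∅ := by
    ext mu
    simp only [Set.mem_ofPred_eq, Set.mem_empty_iff_false, iff_false]
    rintro ⟨h1, h2, -⟩
    rw [wt_zero] at h2
    exact h1 (eq_zero_of_wt h2)
  rw [this, Set.image_empty, Submodule.span_empty, Submodule.mem_bot, sub_eq_zero] at h1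
  rw [h1]
  unfold schur
  have : IsEmpty (Fin (Multiset.card (0 : Multiset ℕ+))) := by rw [Multiset.card_zero]; infer_instance
  exact Matrix.det_isEmpty

/-- Induction on columns. -/
theorem col_induction {p : Multiset ℕ+ → Prop} (h0 : p 0) (h1 : ∀ a, a ≠ 0 → p (dn a) → p a) (a) : p a := by
  induction hw : wt a using Nat.strong_induction_on generalizing a with
  | _ w ih =>
    by_cases ha : a = 0
    · rw [ha]; exact h0
    · refine h1 a ha (ih _ ?_ (dn a) rfl)
      have := dn_wt a
      have := Multiset.card_pos.2 ha
      omega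

end PSpec
end HF
end

open MvPolynomial

noncomputable section
set_option linter.unusedSectionVars false
namespace HF

/-! ### Principal specialization of the modified Macdonald polynomials -/

section PS2

theorem leg_eq (a : Multiset ℕ+) (i j n : ℕ) (hn : Multiset.card a ≤ n) :
    legM a i j = ((Finset.range n).filter fun i' => i < i' ∧ j < part a i').card := by
  have h1 : legM a i j = ((Finset.range (Multiset.card a)).filter
      fun i' => i < i' ∧ j < part a i').card := by
    unfold legM
    rw [descParts_length]
    have : ((Finset.range (Multiset.card a)).filter fun i' => i < i' ∧ j < part a i').card =
      ((Multiset.range (Multiset.card a)).filter fun i' => i < i' ∧ j < part a i').card := rfl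
    rw [this, Multiset.range, Multiset.filter_coe, Multiset.coe_card]
    congr 2
    funext i'
    simp [part]
  rw [h1]
  congr 1
  ext i'
  simp only [Finset.mem_filter, Finset.mem_range]
  constructor
  · rintro ⟨h, h2⟩; exact ⟨by omega, h2⟩
  · rintro ⟨h, h2⟩
    refine ⟨?_, h2⟩
    by_contra hc
    rw [part_ge a (by omega)] at h2
    omega

theorem leg_dn (a : Multiset ℕ+) (i j : ℕ) : legM (dn a) i j = legM a i (j + 1) := by
  rw [leg_eq a i (j+1) _ le_rfl, leg_eq (dn a) i j _ (dn_card a)]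
  congr 1
  ext i'
  simp only [Finset.mem_filter, Finset.mem_range, dn_part]
  omega

theorem leg_zero (a : Multiset ℕ+) (i : ℕ) : legM a i 0 = Multiset.card a - 1 - i := by
  rw [leg_eq a i 0 _ le_rfl]
  have : (Finset.range (Multiset.card a)).filter (fun i' => i < i' ∧ 0 < part a i') =
      Finset.Ico (i + 1) (Multiset.card a) := by
    ext i'
    simp only [Finset.mem_filter, Finset.mem_range, Finset.mem_Ico]
    constructor
    · rintro ⟨h1, h2, _⟩; omega
    · rintro ⟨h1, h2⟩; exact ⟨h2, by omega, part_pos a h2⟩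
  rw [this, Nat.card_Ico]; omega

theorem cell_eq {S : Type} [CommMonoid S] (a : Multiset ℕ+) (f : ℕ → ℕ → S) (n : ℕ)
    (hn : Multiset.card a ≤ n) :
    cellProd a f = ∏ i ∈ Finset.range n, ∏ j ∈ Finset.range (part a i), f i j := by
  unfold cellProd
  rw [descParts_length]
  refine Finset.prod_subset (Finset.range_subset_range.2 hn) ?_
  intro i _ hi
  rw [Finset.mem_range, not_lt] at hi
  rw [show (descParts a).getD i 0 = part a i from rfl, part_ge a hi]
  simp

variable {R : Type} [Field R] [CharZero R] {n : ℕ} {P : Multiset ℕ+ → SymFn R}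

theorem cLow_dn (q t : R) (a : Multiset ℕ+) :
    cLow q t a = Ev (Multiset.card a) q t (dn a) (-t) * cLow q t (dn a) := by
  unfold cLow Ev
  rw [cell_eq a _ _ le_rfl, cell_eq (dn a) _ _ (dn_card a), ← Finset.prod_mul_distrib]
  refine Finset.prod_congr rfl fun i hi => ?_
  have hi := Finset.mem_range.1 hi
  have h1 := dn_part' (a := a) rfl i hi
  rw [h1, Finset.prod_range_succ', mul_comm]
  congr 1
  · rw [leg_zero]
    unfold armM
    rw [show (descParts a).getD i 0 = part a i from rfl, h1, zero_add, Nat.add_sub_cancel, pow_succ]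
    ring
  · refine Finset.prod_congr rfl fun j _ => ?_
    rw [leg_dn]
    unfold armM
    rw [show (descParts a).getD i 0 = part a i from rfl,
      show (descParts (dn a)).getD i 0 = part (dn a) i from rfl, h1, Nat.add_sub_add_right]

theorem nInv_eq (a : Multiset ℕ+) (n : ℕ) (hn : Multiset.card a ≤ n) :
    nInv a = ∑ i ∈ Finset.range n, i * part a i := by
  unfold nInv
  rw [descParts_length]
  refine Finset.sum_subset (Finset.range_subset_range.2 hn) ?_
  intro i _ hi
  rw [Finset.mem_range, not_lt] at hi
  rw [show (descParts a).getD i 0 = part a i from rfl, part_ge a hi, mul_zero]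

theorem nInv_dn (a : Multiset ℕ+) :
    nInv a = (∑ j, dl (Multiset.card a) j) + nInv (dn a) := by
  rw [nInv_eq a _ le_rfl, nInv_eq (dn a) _ (dn_card a)]
  have : ∑ j, dl (Multiset.card a) j = ∑ i ∈ Finset.range (Multiset.card a), i := by
    rw [← Finset.sum_range_reflect, ← Fin.sum_univ_eq_sum_range (fun i => Multiset.card a - 1 - i)]
    rfl
  rw [this, ← Finset.sum_add_distrib]
  refine Finset.sum_congr rfl fun i hi => ?_
  rw [dn_part' (a := a) rfl i (Finset.mem_range.1 hi)]; ring

theorem pspec {q t : R} (hq : ∀ k : ℕ+, 1 - q ^ (k : ℕ) ≠ 0) (ht : ∀ k : ℕ+, 1 - t ^ (k : ℕ) ≠ 0)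
    (hg : Gen q t) (hP : IsMacdonaldBasis q t P) (a : Multiset ℕ+) :
    eval (fun k : ℕ+ => (1 - t ^ (k : ℕ))⁻¹) (P a) * cLow q t a = t ^ nInv a := by
  have hE := mac_eig q t hq ht hP
  choose N' hN0 hN using mac_kernel q t hq ht hP
  set N : Multiset ℕ+ → R := fun a => N' (wt a) a with hNd
  have hk : ∀ (d : ℕ) (χ χ' : ℕ+ → R), ∑ a ∈ PS d, N a * (eval χ (P a) * eval χ' (P a)) =
      PowerSeries.coeff d (HS fun k => χ k * χ' k / ((1 - q ^ (k : ℕ)) / (1 - t ^ (k : ℕ)))) := by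
    intro d χ χ'
    rw [← hN]
    refine Finset.sum_congr rfl fun a ha => ?_
    rw [hNd]; beta_reduce; rw [mem_PS.1 ha]
  induction a using col_induction with
  | h0 =>
    rw [hE.1.zero, _root_.map_one, one_mul]
    unfold cLow nInv cellProd
    rw [descParts_length]
    simp
  | h1 a ha ih =>
    have e2 := K2gen hq hE hg N hk a rfl
    have e3 := K3gen hq hE hg (fun a => N a * eval (fun k : ℕ+ => (1 - t ^ (k : ℕ))⁻¹) (P a)) (by
      intro d χ
      have := hk d χ (fun k : ℕ+ => (1 - t ^ (k : ℕ))⁻¹)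
      have e : (fun k : ℕ+ => χ k * (1 - t ^ (k : ℕ))⁻¹ / ((1 - q ^ (k : ℕ)) / (1 - t ^ (k : ℕ)))) =
          fun k : ℕ+ => χ k * 1 / (1 - q ^ (k : ℕ)) := by
        funext k
        have := hq k; have := ht k
        field_simp
      rw [e] at this
      rw [← this]
      exact Finset.sum_congr rfl fun b _ => by ring) a rfl
    have hn : N (dn a) ≠ 0 := hN0 _ _ (mem_PS.2 rfl)
    beta_reduce at e3
    rw [← mul_assoc, e2] at e3
    have e4 : Ev (Multiset.card a) q t (dn a) (-t) * eval (fun k : ℕ+ => (1 - t ^ (k : ℕ))⁻¹) (P a) =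
        t ^ (∑ j, dl (Multiset.card a) j) * eval (fun k : ℕ+ => (1 - t ^ (k : ℕ))⁻¹) (P (dn a)) := by
      apply mul_left_cancel₀ hn
      linear_combination e3
    rw [cLow_dn, nInv_dn, pow_add, ← ih]
    linear_combination cLow q t (dn a) * e4

theorem eval_scale (g χ : ℕ+ → R) (f : SymFn R) :
    eval χ (scaleHom g f) = eval (fun k => g k * χ k) f := by
  unfold scaleHom
  rw [aeval_def, eval_eval₂]
  show eval₂ _ _ f = eval₂ _ _ f
  congr 1
  · ext x; simp
  · funext k; simp

theorem Htilde_one {q t : R} (h0 : t ≠ 0) (hq : ∀ k : ℕ+, 1 - q ^ (k : ℕ) ≠ 0)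
    (ht : ∀ k : ℕ+, 1 - t⁻¹ ^ (k : ℕ) ≠ 0)
    (hg : Gen q t⁻¹) (hP : IsMacdonaldBasis q t⁻¹ P) (a : Multiset ℕ+) :
    eval (fun _ => 1) (Htilde q t P a) = 1 := by
  have := pspec hq ht hg hP a
  unfold Htilde
  rw [eval_mul, eval_C, eval_scale, eval_mul, eval_C]
  simp only [mul_one]
  rw [mul_comm (cLow _ _ _), this, inv_pow, mul_inv_cancel₀ (pow_ne_zero _ h0)]

end PS2
end HF
end

open MvPolynomial

noncomputable section
set_option linter.unusedSectionVars false
namespace HF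

/-! ### Specialization of rational functions -/

section Spec
variable {K : Type} [Field K] {c : K}

/-- `y` is the value of the rational function `x`, regular at `c`. -/
def Sp (c : K) (x : RatFunc K) (y : K) : Prop := ∃ a b : Polynomial K, b.eval c ≠ 0 ∧
  x * algebraMap (Polynomial K) (RatFunc K) b = algebraMap (Polynomial K) (RatFunc K) a ∧
  y * b.eval c = a.eval c

theorem Sp.eval {x : RatFunc K} {y : K} (h : Sp c x y) : RatFunc.eval (RingHom.id K) c x = y := by
  obtain ⟨a, b, h1, h2, h3⟩ := h
  have hb : b ≠ 0 := by rintro rfl; simp at h1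
  have hb' : algebraMap (Polynomial K) (RatFunc K) b ≠ 0 := by
    simpa using hb
  have hd : RatFunc.denom x ∣ b := (RatFunc.denom_dvd hb).2 ⟨a, by rw [eq_div_iff hb', h2]⟩
  have hd1 : (RatFunc.denom x).eval c ≠ 0 := by
    obtain ⟨e, he⟩ := hd
    rw [he, Polynomial.eval_mul] at h1
    exact left_ne_zero_of_mul h1
  have hd2 : algebraMap (Polynomial K) (RatFunc K) (RatFunc.denom x) ≠ 0 := by
    simpa using RatFunc.denom_ne_zero x
  have h4 : RatFunc.num x * b = a * RatFunc.denom x := by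
    apply RatFunc.algebraMap_injective K
    rw [_root_.map_mul, _root_.map_mul, ← h2]
    have := RatFunc.num_div_denom x
    rw [div_eq_iff hd2] at this
    rw [this]; ring
  have h5 := congrArg (Polynomial.eval c) h4
  rw [Polynomial.eval_mul, Polynomial.eval_mul] at h5
  unfold RatFunc.eval
  rw [Polynomial.eval₂_id, Polynomial.eval₂_id, div_eq_iff hd1]
  apply mul_right_cancel₀ h1
  linear_combination h5 - (RatFunc.denom x).eval c * h3

theorem Sp.unique {x : RatFunc K} {y y' : K} (h : Sp c x y) (h' : Sp c x y') : y = y' := by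
  rw [← h.eval, ← h'.eval]

theorem Sp.const (y : K) : Sp c (RatFunc.C y) y :=
  ⟨Polynomial.C y, 1, by simp, by simp, by simp⟩

theorem Sp.zero : Sp c 0 0 := ⟨0, 1, by simp, by simp, by simp⟩
theorem Sp.one : Sp c 1 1 := ⟨1, 1, by simp, by simp, by simp⟩
theorem Sp.var : Sp c RatFunc.X c := ⟨Polynomial.X, 1, by simp, by simp, by simp⟩

theorem Sp.add {x x' : RatFunc K} {y y' : K} (h : Sp c x y) (h' : Sp c x' y') :
    Sp c (x + x') (y + y') := by
  obtain ⟨a, b, h1, h2, h3⟩ := h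
  obtain ⟨a', b', h1', h2', h3'⟩ := h'
  refine ⟨a * b' + a' * b, b * b', by rw [Polynomial.eval_mul]; exact mul_ne_zero h1 h1', ?_, ?_⟩
  · simp only [_root_.map_mul, _root_.map_add, ← h2, ← h2']; ring
  · simp only [Polynomial.eval_mul, Polynomial.eval_add, ← h3, ← h3']; ring

theorem Sp.mul {x x' : RatFunc K} {y y' : K} (h : Sp c x y) (h' : Sp c x' y') :
    Sp c (x * x') (y * y') := by
  obtain ⟨a, b, h1, h2, h3⟩ := h
  obtain ⟨a', b', h1', h2', h3'⟩ := h'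
  refine ⟨a * a', b * b', by rw [Polynomial.eval_mul]; exact mul_ne_zero h1 h1', ?_, ?_⟩
  · simp only [_root_.map_mul, ← h2, ← h2']; ring
  · simp only [Polynomial.eval_mul, ← h3, ← h3']; ring

theorem Sp.neg {x : RatFunc K} {y : K} (h : Sp c x y) : Sp c (-x) (-y) := by
  have := (Sp.const (c := c) (-1)).mul h
  simpa using this

theorem Sp.sub {x x' : RatFunc K} {y y' : K} (h : Sp c x y) (h' : Sp c x' y') :
    Sp c (x - x') (y - y') := by
  rw [sub_eq_add_neg, sub_eq_add_neg]; exact h.add h'.neg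

theorem Sp.pow {x : RatFunc K} {y : K} (h : Sp c x y) (n : ℕ) : Sp c (x ^ n) (y ^ n) := by
  induction n with
  | zero => simpa using Sp.one
  | succ n ih => rw [pow_succ, pow_succ]; exact ih.mul h

theorem Sp.inv {x : RatFunc K} {y : K} (h : Sp c x y) (hy : y ≠ 0) : Sp c x⁻¹ y⁻¹ := by
  obtain ⟨a, b, h1, h2, h3⟩ := h
  have ha : a.eval c ≠ 0 := by rw [← h3]; exact mul_ne_zero hy h1
  refine ⟨b, a, ha, ?_, ?_⟩
  · rw [← h2]
    have : x ≠ 0 := by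
      rintro rfl
      rw [zero_mul] at h2
      have : a = 0 := by simpa using h2.symm
      rw [this] at ha; simp at ha
    field_simp
  · rw [← h3]; field_simp

theorem Sp.natCast (m : ℕ) : Sp c (m : RatFunc K) (m : K) := by
  have := Sp.const (c := c) (m : K)
  simpa using this

theorem Sp.intCast (m : ℤ) : Sp c (m : RatFunc K) (m : K) := by
  have := Sp.const (c := c) (m : K)
  simpa using this

theorem Sp.sum {ι : Type} (s : Finset ι) {x : ι → RatFunc K} {y : ι → K}
    (h : ∀ i ∈ s, Sp c (x i) (y i)) : Sp c (∑ i ∈ s, x i) (∑ i ∈ s, y i) := by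
  classical
  induction s using Finset.induction_on with
  | empty => simpa using Sp.zero
  | insert a s ha ih =>
    rw [Finset.sum_insert ha, Finset.sum_insert ha]
    exact (h a (Finset.mem_insert_self _ _)).add (ih fun i hi => h i (Finset.mem_insert_of_mem hi))

theorem Sp.prod {ι : Type} (s : Finset ι) {x : ι → RatFunc K} {y : ι → K}
    (h : ∀ i ∈ s, Sp c (x i) (y i)) : Sp c (∏ i ∈ s, x i) (∏ i ∈ s, y i) := by
  classical
  induction s using Finset.induction_on with
  | empty => simpa using Sp.one
  | insert a s ha ih =>
    rw [Finset.prod_insert ha, Finset.prod_insert ha]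
    exact (h a (Finset.mem_insert_self _ _)).mul (ih fun i hi => h i (Finset.mem_insert_of_mem hi))

theorem Sp.ite {p : Prop} [Decidable p] {x x' : RatFunc K} {y y' : K} (h : Sp c x y) (h' : Sp c x' y') :
    Sp c (if p then x else x') (if p then y else y') := by
  split_ifs <;> assumption

/-- Primitive scaling. -/
theorem exists_scale {ι : Type} (c : K) (s : Finset ι) (x : ι → RatFunc K) (hx : ∃ i ∈ s, x i ≠ 0) :
    ∃ g : RatFunc K, g ≠ 0 ∧ ∃ y : ι → K, (∀ i ∈ s, Sp c (g * x i) (y i)) ∧ ∃ i ∈ s, y i ≠ 0 := by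
  classical
  obtain ⟨_inst⟩ : Nonempty (NormalizedGCDMonoid (Polynomial K)) := inferInstance
  obtain ⟨D, hD⟩ := IsLocalization.exist_integer_multiples (nonZeroDivisors (Polynomial K)) s x
  have hD0 : algebraMap (Polynomial K) (RatFunc K) D.1 ≠ 0 := by
    simp
  have : ∀ i, ∃ a : Polynomial K, i ∈ s → algebraMap (Polynomial K) (RatFunc K) a =
      algebraMap (Polynomial K) (RatFunc K) D.1 * x i := by
    intro i
    by_cases hi : i ∈ s
    · obtain ⟨a, ha⟩ := hD i hi
      refine ⟨a, fun _ => ?_⟩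
      rw [ha]
      exact Algebra.smul_def _ _
    · exact ⟨0, fun h => absurd h hi⟩
  choose a ha using this
  obtain ⟨i0, hi0, hxi⟩ := hx
  obtain ⟨b, hb, hg⟩ := Finset.extract_gcd a ⟨i0, hi0⟩
  have hG : s.gcd a ≠ 0 := by
    intro h0
    have h1 := hb i0 hi0
    rw [h0, zero_mul] at h1
    have := ha i0 hi0
    rw [h1, _root_.map_zero] at this
    exact mul_ne_zero hD0 hxi this.symm
  have hG0 : algebraMap (Polynomial K) (RatFunc K) (s.gcd a) ≠ 0 := by simpa using hG
  refine ⟨algebraMap (Polynomial K) (RatFunc K) D.1 / algebraMap (Polynomial K) (RatFunc K) (s.gcd a),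
    div_ne_zero hD0 hG0, fun i => (b i).eval c, ?_, ?_⟩
  · intro i hi
    refine ⟨b i, 1, by simp, ?_, by simp⟩
    have h1 := ha i hi
    rw [hb i hi, _root_.map_mul] at h1
    rw [_root_.map_one, mul_one, div_mul_eq_mul_div, ← h1, mul_div_cancel_left₀ _ hG0]
  · by_contra hcon
    push Not at hcon
    have : (Polynomial.X - Polynomial.C c) ∣ s.gcd b :=
      Finset.dvd_gcd fun i hi => Polynomial.dvd_iff_isRoot.2 (hcon i hi)
    rw [hg] at this
    exact Polynomial.not_isUnit_X_sub_C c (isUnit_of_dvd_one this)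

variable [CharZero K] {n : ℕ}

theorem Sp.alt {v : Fin n → RatFunc K} {v' : Fin n → K} (h : ∀ i, Sp c (v i) (v' i)) (b : Fin n → ℕ) :
    Sp c (alt v b) (alt v' b) := by
  rw [alt_eq, alt_eq]
  exact Sp.sum _ fun σ _ => (Sp.intCast _).mul (Sp.prod _ fun i _ => (h i).pow _)

theorem Sp.sc {v : Fin n → RatFunc K} {v' : Fin n → K} (h : ∀ i, Sp c (v i) (v' i))
    {x : RatFunc K} {y : K} (hx : Sp c x y) (s : Fin n → Bool) (i : Fin n) :
    Sp c (sc s x v i) (sc s y v' i) := Sp.ite (hx.mul (h i)) (h i)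

theorem Sp.pw {v : Fin n → RatFunc K} {v' : Fin n → K} (h : ∀ i, Sp c (v i) (v' i)) (k : ℕ+) :
    Sp c (pw v k) (pw v' k) := Sp.sum _ fun i _ => (h i).pow _

/-- Coefficientwise specialization. -/
def SpF (c : K) (f : SymFn (RatFunc K)) (g : SymFn K) : Prop := ∀ mu, Sp c (cf f mu) (cf g mu)

theorem Sp.mon {χ : ℕ+ → RatFunc K} {χ' : ℕ+ → K} (h : ∀ k, Sp c (χ k) (χ' k)) (mu : Multiset ℕ+) :
    Sp c (mon χ mu) (mon χ' mu) := by
  unfold HF.mon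
  rw [Finset.prod_multiset_map_count, Finset.prod_multiset_map_count]
  exact Sp.prod _ fun i _ => (h i).pow _

theorem SpF.hom {f : SymFn (RatFunc K)} {g : SymFn K} (h : SpF c f g) {d : ℕ} (hf : Hom f d) :
    Hom g d := by
  refine hom_of fun mu hmu => ?_
  by_contra hw
  apply hmu
  have h0 : cf f mu = 0 := by
    by_contra h1
    apply hw
    have := hf.coeff_ne h1
    simpa using this
  have := h mu
  rw [h0] at this
  exact this.unique Sp.zero

theorem SpF.eval {f : SymFn (RatFunc K)} {g : SymFn K} (h : SpF c f g) {d : ℕ} (hf : Hom f d)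
    {χ : ℕ+ → RatFunc K} {χ' : ℕ+ → K} (hχ : ∀ k, Sp c (χ k) (χ' k)) :
    Sp c (eval χ f) (eval χ' g) := by
  rw [eval_eq_sum hf, eval_eq_sum (h.hom hf)]
  exact Sp.sum _ fun mu _ => (h mu).mul (Sp.mon hχ mu)

theorem SpF.frm {f f' : SymFn (RatFunc K)} {g g' : SymFn K} (h : SpF c f g) (h' : SpF c f' g')
    {w : ℕ+ → RatFunc K} {w' : ℕ+ → K} (hw : ∀ k, Sp c (w k) (w' k)) (d : ℕ) :
    Sp c (frm d w f f') (frm d w' g g') := by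
  refine Sp.sum _ fun mu _ => ((h mu).mul (h' mu)).mul ?_
  exact Sp.prod _ fun k _ => ((Sp.natCast _).mul ((Sp.natCast _).pow _)).mul ((hw k).pow _)

theorem SpF.DL {f : SymFn (RatFunc K)} {g : SymFn K} (h : SpF c f g) {d : ℕ} (hf : Hom f d)
    {q t X : RatFunc K} {q' t' X' : K} (hq : Sp c q q') (ht : Sp c t t') (hX : Sp c X X')
    {v : Fin n → RatFunc K} {v' : Fin n → K} (hv : ∀ i, Sp c (v i) (v' i)) :
    Sp c (DL (RatFunc K) n q t X f v) (DL K n q' t' X' g v') := by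
  rw [DL_apply, DL_apply]
  unfold aDf
  refine Sp.sum _ fun s _ => ((Sp.prod _ fun _ _ => Sp.ite hX Sp.one).mul ?_).mul ?_
  · exact Sp.alt (Sp.sc hv ht s) _
  · exact h.eval hf (Sp.pw (Sp.sc hv hq s))

theorem SpF.AL {f : SymFn (RatFunc K)} {g : SymFn K} (h : SpF c f g) {d : ℕ} (hf : Hom f d)
    {v : Fin n → RatFunc K} {v' : Fin n → K} (hv : ∀ i, Sp c (v i) (v' i)) :
    Sp c (AL (RatFunc K) n f v) (AL K n g v') := by
  rw [AL_apply, AL_apply]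
  exact (Sp.alt hv _).mul (h.eval hf (Sp.pw hv))

theorem Sp.Ev {q t X : RatFunc K} {q' t' X' : K} (hq : Sp c q q') (ht : Sp c t t') (hX : Sp c X X')
    (lam : Multiset ℕ+) : Sp c (Ev n q t lam X) (Ev n q' t' lam X') :=
  Sp.prod _ fun i _ => Sp.one.add ((hX.mul (ht.pow _)).mul (hq.pow _))

theorem SpF.sum {ι : Type} (s : Finset ι) {x : ι → SymFn (RatFunc K)} {y : ι → SymFn K}
    (h : ∀ i ∈ s, SpF c (x i) (y i)) : SpF c (∑ i ∈ s, x i) (∑ i ∈ s, y i) := by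
  intro mu
  rw [cf_sum, cf_sum]
  exact Sp.sum _ fun i hi => h i hi mu

theorem SpF.smul {f : SymFn (RatFunc K)} {g : SymFn K} (h : SpF c f g) {x : RatFunc K} {y : K}
    (hx : Sp c x y) : SpF c (x • f) (y • g) := by
  intro mu
  rw [cf_smul, cf_smul]
  exact hx.mul (h mu)

/-- Schur functions are defined over the rationals. -/
theorem map_hsym (n : ℕ) : MvPolynomial.map (RatFunc.C (K := K)) (hsym n) = hsym n := by
  induction n using Nat.strong_induction_on with
  | _ n ih =>
    rcases n with _ | n
    · rw [hsym, hsym, _root_.map_one]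
    · rw [hsym, hsym, MvPolynomial.smul_eq_C_mul, MvPolynomial.smul_eq_C_mul, _root_.map_mul, map_C, _root_.map_sum]
      congr 2
      · simp
      · funext i
        rw [_root_.map_mul]
        exact congrArg₂ (· * ·) (map_X _ _) (ih _ (by omega))

theorem map_schur (lam : Multiset ℕ+) : MvPolynomial.map (RatFunc.C (K := K)) (schur lam) = schur lam := by
  unfold schur
  rw [RingHom.map_det]
  congr 1
  ext1 i j
  simp only [RingHom.mapMatrix_apply, Matrix.map_apply, Matrix.of_apply]
  unfold hInt
  split_ifs
  · exact map_hsym _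
  · exact _root_.map_zero _

theorem SpF.schur (lam : Multiset ℕ+) : SpF c (schur lam) (schur lam) := by
  intro mu
  rw [← map_schur]
  unfold cf
  rw [coeff_map]
  exact Sp.const _

theorem SpF.specT {c : KK} {f : SymFn FF} {g : SymFn KK} (h : SpF c f g) : specT c f = g := by
  ext m
  have hz : ∀ m : ℕ+ →₀ ℕ, evalT c (coeff m f) = coeff m g := by
    intro m
    have := (h (Finsupp.toMultiset m)).eval
    unfold evalT
    simpa [cf] using this
  unfold _root_.specT
  rw [coeff_sum]
  simp only [coeff_monomial]
  rw [Finset.sum_ite_eq']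
  split_ifs with hm
  · exact hz m
  · rw [← hz m, notMem_support_iff.1 hm]
    exact Sp.zero.eval.symm

end Spec
end HF
end

open MvPolynomial

noncomputable section
set_option linter.unusedSectionVars false
namespace HF

/-! ### Specialization of Macdonald polynomials -/

section Gen1
variable {R : Type} [Field R] [CharZero R] {n : ℕ} {P : Multiset ℕ+ → SymFn R}

theorem Tri.coeffs (h : Tri P) (lam : Multiset ℕ+) : ∃ b : Multiset ℕ+ → R,
    P lam = ∑ mu ∈ PS (wt lam), b mu • schur mu ∧ b lam = 1 ∧
      ∀ mu, b mu ≠ 0 → mu = lam ∨ StrictDom mu lam := by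
  classical
  have h1 := h lam
  have hs : {mu | StrictDom mu lam} = (((PS (wt lam)).filter fun mu => StrictDom mu lam : Finset _) : Set _) := by
    ext mu
    simp only [Set.mem_ofPred_eq, Finset.coe_filter, mem_PS]
    exact ⟨fun h => ⟨h.2.1, h⟩, fun h => h.2⟩
  rw [hs, Submodule.mem_span_image_finset_iff_exists_fun'] at h1
  obtain ⟨c, hc⟩ := h1
  refine ⟨fun mu => (if mu = lam then 1 else 0) + (if StrictDom mu lam then c mu else 0), ?_, ?_, ?_⟩
  · simp only [add_smul, Finset.sum_add_distrib, ite_smul, zero_smul, one_smul]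
    rw [← Finset.sum_filter, ← Finset.sum_filter, hc, Finset.filter_eq' , if_pos (mem_PS.2 rfl),
      Finset.sum_singleton]
    abel
  · beta_reduce
    rw [if_pos rfl, if_neg (fun h => h.1 rfl), add_zero]
  · intro mu hmu
    by_contra hcon
    push Not at hcon
    apply hmu
    beta_reduce
    rw [if_neg hcon.1, if_neg hcon.2, add_zero]

theorem frm_nondeg (h : Tri P) {w : ℕ+ → R} (hw : ∀ k, w k ≠ 0) {d : ℕ} {u : SymFn R} (hu : Hom u d)
    (h0 : ∀ a ∈ PS d, frm d w (P a) u = 0) : u = 0 := by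
  classical
  refine ext_hom hu (hom_zero d) fun mu hmu => ?_
  have hz : cf (0 : SymFn R) mu = 0 := by simp [cf]
  rw [hz]
  set f : SymFn R := monomial (Multiset.toFinsupp mu) 1 with hf
  have hcf : ∀ nu, cf f nu = if mu = nu then 1 else 0 := by
    intro nu
    unfold cf
    rw [hf, coeff_monomial]
    simp only [EmbeddingLike.apply_eq_iff_eq]
  have hfh : Hom f d := by
    refine hom_of fun nu hnu => ?_
    rw [hcf] at hnu
    have : mu = nu := by by_contra hh; rw [if_neg hh] at hnu; exact hnu rfl
    rw [← this]; exact mem_PS.1 hmu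
  obtain ⟨b, hb⟩ := h.expand hfh
  have h1 : frm d w f u = 0 := by
    rw [hb, frm_comm, frm_sum_right]
    refine Finset.sum_eq_zero fun a ha => ?_
    rw [frm_smul_right, frm_comm, h0 a ha, mul_zero]
  have h2 : frm d w f u = cf u mu * zz w mu := by
    unfold frm
    simp only [hcf, ite_mul, one_mul, zero_mul]
    rw [Finset.sum_ite_eq, if_pos hmu]
  rw [h2] at h1
  exact (mul_eq_zero.1 h1).resolve_right (zz_ne_zero w hw mu)

theorem cf_scale (g : ℕ+ → R) (f : SymFn R) (mu : Multiset ℕ+) :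
    cf (scaleHom g f) mu = mon g mu * cf f mu := by
  classical
  induction f using MvPolynomial.induction_on' with
  | monomial u a =>
    have : scaleHom g (monomial u a) = monomial u (a * mon g (Finsupp.toMultiset u)) := by
      unfold scaleHom mon
      rw [aeval_monomial, monomial_eq, Finset.prod_multiset_map_count]
      simp only [mul_pow, Finsupp.prod, Finset.prod_mul_distrib, _root_.map_mul, _root_.map_prod, _root_.map_pow,
        Finsupp.toFinset_toMultiset, Finsupp.count_toMultiset]
      rw [mul_assoc]
      rfl
    rw [this]
    unfold cf
    rw [coeff_monomial, coeff_monomial]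
    split_ifs with h
    · rw [h]; simp [mul_comm]
    · simp
  | add p q hp hq => rw [_root_.map_add, cf_add, cf_add, hp, hq, mul_add]

theorem frm_scale (d : ℕ) (w g : ℕ+ → R) (f f' : SymFn R) :
    frm d w f (scaleHom g f') = frm d (fun k => g k * w k) f f' := by
  refine Finset.sum_congr rfl fun mu _ => ?_
  rw [cf_scale, zz_scale]; ring

theorem hom_scale (g : ℕ+ → R) {f : SymFn R} {d : ℕ} (hf : Hom f d) : Hom (scaleHom g f) d := by
  refine hom_of fun mu hmu => ?_
  rw [cf_scale] at hmu
  have := hf.coeff_ne (right_ne_zero_of_mul hmu)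
  simpa using this

theorem Htilde_eq (q t : R) (P : Multiset ℕ+ → SymFn R) (a : Multiset ℕ+) :
    Htilde q t P a = (t ^ nInv a * cLow q t⁻¹ a) • scaleHom (fun k => (1 - (t⁻¹) ^ (k : ℕ))⁻¹) (P a) := by
  unfold Htilde
  rw [_root_.map_mul, smul_eq_C_mul, C_mul, mul_assoc]
  congr 2
  unfold scaleHom
  rw [aeval_C]; rfl

theorem Htilde_hom {q t : R} (h : Tri P) (a : Multiset ℕ+) : Hom (Htilde q t P a) (wt a) := by
  rw [Htilde_eq]
  exact Hom.smul _ (hom_scale _ (h.hom a))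

theorem Htilde_orth {q t : R} (hP : IsMacdonaldBasis q t⁻¹ P) (a b : Multiset ℕ+) (hab : b ≠ a) :
    frm (wt b) (fun k => 1 - q ^ (k : ℕ)) (P b) (Htilde q t P a) = 0 := by
  have h : Tri P := hP.1
  rw [Htilde_eq, frm_smul_right, frm_scale]
  have h1 := hP.2 b a hab
  rw [innerQT_eq (h.hom b)] at h1
  have e : (fun k : ℕ+ => (1 - t⁻¹ ^ (k : ℕ))⁻¹ * (1 - q ^ (k : ℕ))) =
      fun k : ℕ+ => (1 - q ^ (k : ℕ)) / (1 - t⁻¹ ^ (k : ℕ)) := by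
    funext k; rw [div_eq_mul_inv, mul_comm]
  rw [e, h1, mul_zero]

/-- A nonzero function orthogonal to all but one has a nonzero value. -/
theorem eval_one_ne {q t : R} (hq : ∀ k : ℕ+, 1 - q ^ (k : ℕ) ≠ 0) (ht0 : t ≠ 0) (hE : Eig q t P)
    (hg : Gen q t) (a : Multiset ℕ+) {u : SymFn R} (hu : Hom u (wt a)) (hu0 : u ≠ 0)
    (ho : ∀ b ∈ PS (wt a), b ≠ a → frm (wt a) (fun k => 1 - q ^ (k : ℕ)) (P b) u = 0) :
    eval (fun _ => 1) u ≠ 0 := by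
  choose G hG hd using fun d => exists_dual d (fun k : ℕ+ => 1 - q ^ (k : ℕ)) hq P (hE.1.unit d)
  set g : Multiset ℕ+ → R := fun a => eval (fun _ => 1) (G (wt a) a) with hgd
  have hk : ∀ (d : ℕ) (χ : ℕ+ → R), ∑ a ∈ PS d, g a * eval χ (P a) =
      PowerSeries.coeff d (HS fun k => χ k * 1 / (1 - q ^ (k : ℕ))) := by
    intro d χ
    have := dual_kernel d (fun k : ℕ+ => 1 - q ^ (k : ℕ)) hq P (G d) (fun a ha => hE.1.hom' ha)
      (fun a _ => hG d a) (hd d) χ (fun _ => 1)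
    rw [← this]
    refine Finset.sum_congr rfl fun a ha => ?_
    rw [hgd]; beta_reduce
    rw [mem_PS.1 ha, mul_comm]
  have hne : ∀ a, g a ≠ 0 := by
    intro a
    induction a using col_induction with
    | h0 =>
      have h1 := hk 0 (fun _ => 1)
      have h2 : PS 0 = {0} := by
        ext mu
        rw [mem_PS, Finset.mem_singleton]
        exact ⟨eq_zero_of_wt, fun h => by rw [h, wt_zero]⟩
      rw [HS_coeff_zero, h2, Finset.sum_singleton, hE.1.zero, _root_.map_one, mul_one] at h1
      rw [h1]; exact one_ne_zero
    | h1 a _ ih =>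
      have := K3gen hq hE hg g hk a rfl
      intro h0
      rw [h0, mul_zero] at this
      exact mul_ne_zero (pow_ne_zero _ ht0) ih this.symm
  set β := frm (wt a) (fun k => 1 - q ^ (k : ℕ)) (P a) u with hβ
  have hu2 : u + (-β) • G (wt a) a = 0 := by
    refine frm_nondeg hE.1 hq (hu.add (Hom.smul _ (hG _ a))) fun b hb => ?_
    have hadd : frm (wt a) (fun k => 1 - q ^ (k : ℕ)) (P b) (u + (-β) • G (wt a) a) =
        frm (wt a) (fun k => 1 - q ^ (k : ℕ)) (P b) u +
          frm (wt a) (fun k => 1 - q ^ (k : ℕ)) (P b) ((-β) • G (wt a) a) := by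
      unfold frm
      rw [← Finset.sum_add_distrib]
      exact Finset.sum_congr rfl fun m _ => by rw [cf_add]; ring
    rw [hadd, frm_smul_right, hd _ b hb a (mem_PS.2 rfl)]
    split_ifs with hba
    · rw [hba, ← hβ]; ring
    · rw [ho b hb hba]; ring
  have hu3 : u = β • G (wt a) a := by
    rw [neg_smul, ← sub_eq_add_neg, sub_eq_zero] at hu2; exact hu2
  rw [hu3, smul_eval]
  refine mul_ne_zero ?_ (hne a)
  intro h0
  apply hu0
  rw [hu3, h0, zero_smul]

end Gen1

section SpecM
variable {K : Type} [Field K] [CharZero K] {c : K}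

theorem spec_eig {q z : K} {T : RatFunc K} (hT : Sp c T z) (hg : Gen q z)
    {P : Multiset ℕ+ → SymFn (RatFunc K)} (hE : Eig (RatFunc.C q) T P) :
    ∃ P' : Multiset ℕ+ → SymFn K, Eig q z P' ∧ ∀ lam, SpF c (P lam) (P' lam) := by
  have key : ∀ lam, ∃ f' : SymFn K, SpF c (P lam) f' ∧ f' - schur lam ∈
      Submodule.span K ((schur (R := K)) '' {mu | StrictDom mu lam}) ∧
      ∀ n, Multiset.card lam ≤ n → ∀ X, DL K n q z X f' = Ev n q z lam X • AL K n f' := by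
    intro lam
    obtain ⟨b, hb, hb1, hb2⟩ := hE.1.coeffs lam
    obtain ⟨g, hg0, y, hy, i, hi, hyi⟩ := exists_scale c (PS (wt lam)) b
      ⟨lam, mem_PS.2 rfl, by rw [hb1]; exact one_ne_zero⟩
    set f' := ∑ mu ∈ PS (wt lam), y mu • schur (R := K) mu with hf'
    have hsp : SpF c (g • P lam) f' := by
      rw [hb, Finset.smul_sum]
      refine SpF.sum _ fun mu hmu => ?_
      rw [smul_smul]
      exact (SpF.schur mu).smul (hy mu hmu)
    have hhom : Hom (g • P lam) (wt lam) := Hom.smul _ (hE.1.hom lam)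
    have heig : ∀ n, Multiset.card lam ≤ n → ∀ X, DL K n q z X f' = Ev n q z lam X • AL K n f' := by
      intro n hn X
      funext v
      have h1 := hsp.DL hhom (Sp.const q) hT (Sp.const X) (fun i : Fin n => Sp.const (v i))
      have h2 := (Sp.Ev (n := n) (Sp.const (c := c) q) hT (Sp.const X) lam).mul
        (hsp.AL hhom (fun i : Fin n => Sp.const (v i)))
      rw [_root_.map_smul, hE.2 n lam hn, smul_comm, ← _root_.map_smul] at h1
      exact h1.unique h2
    have hyl : y lam ≠ 0 := by
      intro h0
      apply hyi
      exact eig_unique hg (card_le_wt lam) tri_schur y h0 (heig _ (card_le_wt lam)) i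
        (by rw [PSn_self]; exact hi)
    have hgi : Sp c g⁻¹ (y lam)⁻¹ := by
      have := hy lam (mem_PS.2 rfl)
      rw [hb1, mul_one] at this
      exact this.inv hyl
    refine ⟨(y lam)⁻¹ • f', ?_, ?_, ?_⟩
    · have := hsp.smul hgi
      rwa [smul_smul, inv_mul_cancel₀ hg0, one_smul] at this
    · have : (y lam)⁻¹ • f' - schur lam = ∑ mu ∈ (PS (wt lam)).erase lam, ((y lam)⁻¹ * y mu) • schur (R := K) mu := by
        rw [hf', ← Finset.add_sum_erase _ _ (mem_PS.2 rfl : lam ∈ PS (wt lam)), smul_add, smul_smul,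
          inv_mul_cancel₀ hyl, one_smul, add_sub_cancel_left, Finset.smul_sum]
        exact Finset.sum_congr rfl fun mu _ => smul_smul _ _ _
      rw [this]
      refine Submodule.sum_mem _ fun mu hmu => ?_
      rw [Finset.mem_erase] at hmu
      by_cases h0 : b mu = 0
      · have := hy mu hmu.2
        rw [h0, mul_zero] at this
        rw [← Sp.zero.unique this, mul_zero, zero_smul]
        exact Submodule.zero_mem _
      · exact Submodule.smul_mem _ _ (Submodule.subset_span ⟨mu, (hb2 mu h0).resolve_left hmu.1, rfl⟩)
    · intro n hn X
      rw [_root_.map_smul, _root_.map_smul, heig n hn, smul_comm]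
  choose P' h1 h2 h3 using key
  exact ⟨P', ⟨h2, fun n lam hl X => h3 lam n hl X⟩, h1⟩

theorem spec_dual {q z : K} (hq : ∀ k : ℕ+, 1 - q ^ (k : ℕ) ≠ 0) (hz : z ≠ 0) (hg : Gen q z)
    {P H : Multiset ℕ+ → SymFn (RatFunc K)} {P' : Multiset ℕ+ → SymFn K} (hE : Eig q z P')
    (hP : ∀ lam, SpF c (P lam) (P' lam)) (hH : ∀ a, Hom (H a) (wt a))
    (ho : ∀ a b, b ≠ a → frm (wt b) (fun k => 1 - RatFunc.C q ^ (k : ℕ)) (P b) (H a) = 0)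
    (h1 : ∀ a, eval (fun _ => 1) (H a) = 1) (a : Multiset ℕ+) :
    ∃ H' : SymFn K, SpF c (H a) H' ∧ Hom H' (wt a) ∧
      (∀ b ∈ PS (wt a), b ≠ a → frm (wt a) (fun k => 1 - q ^ (k : ℕ)) (P' b) H' = 0) ∧
      eval (fun _ => 1) H' = 1 := by
  obtain ⟨g, hg0, y, hy, i, hi, hyi⟩ := exists_scale c (PS (wt a)) (cf (H a)) (by
    by_contra hcon
    push Not at hcon
    have : H a = 0 := ext_hom (hH a) (hom_zero _) fun mu hmu => by rw [hcon mu hmu]; simp [cf]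
    have h2 := h1 a
    rw [this, _root_.map_zero] at h2
    exact zero_ne_one h2)
  set f' : SymFn K := ∑ mu ∈ PS (wt a), monomial (Multiset.toFinsupp mu) (y mu) with hf'
  have hcf : ∀ nu, cf f' nu = if nu ∈ PS (wt a) then y nu else 0 := by
    classical
    intro nu
    rw [hf', cf_sum]
    unfold cf
    simp only [coeff_monomial, EmbeddingLike.apply_eq_iff_eq]
    rw [Finset.sum_ite_eq']
  have hsp : SpF c (g • H a) f' := by
    intro mu
    rw [cf_smul, hcf]
    split_ifs with hmu
    · exact hy mu hmu
    · have : cf (H a) mu = 0 := by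
        by_contra hh
        apply hmu
        have := (hH a).coeff_ne hh
        rw [mem_PS]
        simpa using this
      rw [this, mul_zero]
      exact Sp.zero
  have hhom : Hom (g • H a) (wt a) := Hom.smul _ (hH a)
  have hort : ∀ b ∈ PS (wt a), b ≠ a → frm (wt a) (fun k => 1 - q ^ (k : ℕ)) (P' b) f' = 0 := by
    intro b hb hba
    have e1 := (hP b).frm hsp (fun k : ℕ+ => (Sp.one (c := c)).sub ((Sp.const (c := c) q).pow k)) (wt a)
    have e2 := ho a b hba
    rw [mem_PS.1 hb] at e2
    rw [frm_smul_right, e2, mul_zero] at e1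
    exact (Sp.zero.unique e1).symm
  have hne : f' ≠ 0 := by
    intro h0
    apply hyi
    have := hcf i
    rw [if_pos hi, h0] at this
    rw [← this]; simp [cf]
  have hev := eval_one_ne hq hz hE hg a (hsp.hom hhom) hne hort
  have hgs : Sp c g (eval (fun _ => 1) f') := by
    have := hsp.eval hhom (fun _ => Sp.one (c := c))
    rwa [smul_eval, h1, mul_one] at this
  have hgi := hgs.inv hev
  refine ⟨(eval (fun _ => 1) f')⁻¹ • f', ?_, Hom.smul _ (hsp.hom hhom), ?_, ?_⟩
  · have := hsp.smul hgi
    rwa [smul_smul, inv_mul_cancel₀ hg0, one_smul] at this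
  · intro b hb hba
    rw [frm_smul_right, hort b hb hba, mul_zero]
  · rw [smul_eval, inv_mul_cancel₀ hev]

end SpecM
end HF
end

open MvPolynomial

noncomputable section
set_option linter.unusedSectionVars false
namespace HF

/-! ### Roots of unity -/

section Roots
variable {R : Type} [Field R] {z : R} {l : ℕ}

theorem prod_roots (hz : IsPrimitiveRoot z l) (hl : 0 < l) (x y : R) :
    ∏ j ∈ Finset.range l, (x - z ^ j * y) = x ^ l - y ^ l := by
  classical
  rw [hz.pow_sub_pow_eq_prod_sub_mul _ _ hl]
  have hinj : Set.InjOn (fun j => z ^ j) (Finset.range l : Finset ℕ) := by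
    intro i hi j hj h
    exact hz.pow_inj (by simpa using hi) (by simpa using hj) h
  have : Polynomial.nthRootsFinset l (1 : R) = (Finset.range l).image (fun j => z ^ j) := by
    symm
    apply Finset.eq_of_subset_of_card_le
    · intro a ha
      obtain ⟨j, _, rfl⟩ := Finset.mem_image.1 ha
      rw [Polynomial.mem_nthRootsFinset hl]
      rw [← pow_mul, mul_comm, pow_mul, hz.pow_eq_one, one_pow]
    · rw [Finset.card_image_of_injOn hinj, hz.card_nthRootsFinset, Finset.card_range]
  rw [this, Finset.prod_image hinj]

/-- The product of all roots. -/
def cc (z : R) (l : ℕ) : R := ∏ j ∈ Finset.range l, z ^ j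

theorem prod_one_add_roots (hz : IsPrimitiveRoot z l) (hl : 0 < l) (y : R) :
    ∏ j ∈ Finset.range l, (1 + y * z ^ j) = 1 + cc z l * y ^ l := by
  have h1 := prod_roots hz hl 1 (-y)
  have h2 := prod_roots hz hl 0 (-1)
  have e1 : ∏ j ∈ Finset.range l, (1 - z ^ j * -y) = ∏ j ∈ Finset.range l, (1 + y * z ^ j) :=
    Finset.prod_congr rfl fun j _ => by ring
  have e2 : ∏ j ∈ Finset.range l, (0 - z ^ j * -1) = cc z l :=
    Finset.prod_congr rfl fun j _ => by ring
  rw [e1] at h1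
  rw [e2, zero_pow hl.ne'] at h2
  rw [h1, h2, neg_pow y, one_pow]; ring

theorem prod_shift_roots (hz : IsPrimitiveRoot z l) (hl : 0 < l) (y : R) (m : ℕ) :
    ∏ j ∈ Finset.range l, (1 + y * z ^ (j + m)) = 1 + cc z l * y ^ l := by
  have := prod_one_add_roots hz hl (y * z ^ m)
  rw [mul_pow, ← pow_mul, mul_comm m l, pow_mul z, hz.pow_eq_one, one_pow, mul_one] at this
  rw [← this]
  exact Finset.prod_congr rfl fun j _ => by rw [pow_add]; ring

end Roots

/-! ### Adding a block of equal parts -/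

theorem part_block (lam : Multiset ℕ+) (l : ℕ) (i : ℕ+) :
    ∃ m, m ≤ Multiset.card lam ∧
      (∀ j, j < m → part (lam + Multiset.replicate l i) j = part lam j) ∧
      (∀ j, j < l → part (lam + Multiset.replicate l i) (m + j) = i) ∧
      (∀ j, m ≤ j → part (lam + Multiset.replicate l i) (j + l) = part lam j) := by
  classical
  have hex : ∃ m, part lam m < (i : ℕ) := ⟨Multiset.card lam, by rw [part_ge lam le_rfl]; exact i.2⟩
  set m := Nat.find hex with hm
  have h1 : part lam m < (i : ℕ) := Nat.find_spec hex
  have h2 : ∀ j, j < m → (i : ℕ) ≤ part lam j := fun j hj => not_lt.1 (Nat.find_min hex hj)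
  have hmc : m ≤ Multiset.card lam := Nat.find_min' hex (by rw [part_ge lam le_rfl]; exact i.2)
  set f : ℕ → ℕ := fun j => if j < m then part lam j else if j < m + l then (i : ℕ) else part lam (j - l) with hf
  have hanti : Antitone f := by
    intro a b hab
    simp only [hf]
    have p1 := part_antitone lam hab
    by_cases hb : b < m
    · rw [if_pos hb, if_pos (lt_of_le_of_lt hab hb)]; exact p1
    · rw [if_neg hb]
      by_cases hb' : b < m + l
      · rw [if_pos hb']
        by_cases ha : a < m
        · rw [if_pos ha]; exact h2 a ha
        · rw [if_neg ha, if_pos (lt_of_le_of_lt hab hb')]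
      · rw [if_neg hb']
        have p2 : part lam (b - l) ≤ part lam m := part_antitone lam (by omega)
        by_cases ha : a < m
        · rw [if_pos ha]; have := h2 a ha; omega
        · rw [if_neg ha]
          by_cases ha' : a < m + l
          · rw [if_pos ha']; omega
          · rw [if_neg ha']; exact part_antitone lam (by omega)
  obtain ⟨kap, hk, hkp⟩ := exists_part f hanti (Multiset.card lam + l) (by
    intro j hj
    simp only [hf]
    rw [if_neg (by omega), if_neg (by omega)]
    exact part_ge lam (by omega))
  have hkap : kap = lam + Multiset.replicate l i := by
    apply map_coe_inj
    have e1 := multiset_part kap _ hk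
    have e2 := multiset_part lam _ le_rfl
    have e3 : (Multiset.range (Multiset.card lam + l)).map (part kap) =
        (Multiset.range (Multiset.card lam)).map (part lam) + Multiset.replicate l (i : ℕ) := by
      obtain ⟨r, hr⟩ := Nat.exists_eq_add_of_le hmc
      have hra : ∀ a b : ℕ, Multiset.range (a + b) = Multiset.range a +
          (Multiset.range b).map (fun x => a + x) := by
        intro a b
        simp only [Multiset.range, Multiset.map_coe, Multiset.coe_add, List.range_add]
      rw [hr, show m + r + l = m + l + r by omega, hra (m + l), hra m l, hra m r]
      simp only [Multiset.map_add, Multiset.map_map, Function.comp_def]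
      have f1 : (Multiset.range m).map (part kap) = (Multiset.range m).map (part lam) :=
        Multiset.map_congr rfl fun j hj => by
          rw [hkp]; simp only [hf]; rw [if_pos (Multiset.mem_range.1 hj)]
      have f2 : (Multiset.range l).map (fun x => part kap (m + x)) = Multiset.replicate l (i : ℕ) := by
        rw [Multiset.map_congr rfl (g := fun _ => (i : ℕ))]
        · simp
        · intro j hj
          have := Multiset.mem_range.1 hj
          rw [hkp]; simp only [hf]; rw [if_neg (by omega), if_pos (by omega)]
      have f3 : (Multiset.range r).map (fun x => part kap (m + l + x)) =
          (Multiset.range r).map (fun x => part lam (m + x)) :=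
        Multiset.map_congr rfl fun j hj => by
          rw [hkp]; simp only [hf]; rw [if_neg (by omega), if_neg (by omega)]
          congr 1; omega
      rw [f1, f2, f3]; abel
    have e4 := filter_part kap _ hk
    rw [← e4, e3, Multiset.filter_add, filter_part lam _ le_rfl, Multiset.map_add, Multiset.map_replicate]
    congr 1
    apply Multiset.filter_eq_self.2
    intro a ha
    rw [Multiset.eq_of_mem_replicate ha]; exact i.2
  refine ⟨m, hmc, ?_, ?_, ?_⟩
  · intro j hj
    rw [← hkap, hkp]; simp only [hf]; rw [if_pos hj]
  · intro j hj
    rw [← hkap, hkp]; simp only [hf]; rw [if_neg (by omega), if_pos (by omega)]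
  · intro j hj
    rw [← hkap, hkp]; simp only [hf]; rw [if_neg (by omega), if_neg (by omega)]
    congr 1; omega

section Roots2
variable {R : Type} [Field R] [CharZero R] {z : R} {l : ℕ}

theorem Ev_block (q : R) (hz : IsPrimitiveRoot z l) (hl : 0 < l) {n : ℕ} (lam : Multiset ℕ+)
    (hn : Multiset.card lam ≤ n) (i : ℕ+) (X : R) :
    Ev (n + l) q z (lam + Multiset.replicate l i) X =
      (1 + X ^ l * cc z l * q ^ (l * (i : ℕ))) * Ev n q z lam X := by
  obtain ⟨m, hm, h1, h2, h3⟩ := part_block lam l i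
  obtain ⟨r, rfl⟩ := Nat.exists_eq_add_of_le (hm.trans hn)
  have hp : ∀ a : ℕ, z ^ (a + l) = z ^ a := fun a => by rw [pow_add, hz.pow_eq_one, mul_one]
  unfold Ev
  rw [show m + r + l = m + l + r by omega, Finset.prod_range_add, Finset.prod_range_add,
    Finset.prod_range_add _ m r]
  have f1 : ∏ x ∈ Finset.range m, (1 + X * z ^ (m + l + r - 1 - x) * q ^ part (lam + Multiset.replicate l i) x)
      = ∏ x ∈ Finset.range m, (1 + X * z ^ (m + r - 1 - x) * q ^ part lam x) :=
    Finset.prod_congr rfl fun x hx => by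
      have := Finset.mem_range.1 hx
      rw [h1 x this, show m + l + r - 1 - x = (m + r - 1 - x) + l by omega, hp]
  have f2 : ∏ x ∈ Finset.range l, (1 + X * z ^ (m + l + r - 1 - (m + x)) * q ^ part (lam + Multiset.replicate l i) (m + x))
      = 1 + X ^ l * cc z l * q ^ (l * (i : ℕ)) := by
    have := prod_shift_roots hz hl (X * q ^ (i : ℕ)) r
    rw [← Finset.prod_range_reflect] at this
    rw [mul_pow, ← pow_mul, mul_comm (i : ℕ) l] at this
    rw [show 1 + X ^ l * cc z l * q ^ (l * (i : ℕ)) = 1 + cc z l * (X ^ l * q ^ (l * (i : ℕ))) by ring, ← this]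
    refine Finset.prod_congr rfl fun x hx => ?_
    have := Finset.mem_range.1 hx
    rw [h2 x this, show m + l + r - 1 - (m + x) = l - 1 - x + r by omega]; ring
  have f3 : ∏ x ∈ Finset.range r, (1 + X * z ^ (m + l + r - 1 - (m + l + x)) * q ^ part (lam + Multiset.replicate l i) (m + l + x))
      = ∏ x ∈ Finset.range r, (1 + X * z ^ (m + r - 1 - (m + x)) * q ^ part lam (m + x)) :=
    Finset.prod_congr rfl fun x hx => by
      rw [show m + l + x = (m + x) + l by omega, h3 _ (by omega), show m + l + r - 1 - (m + x + l) = m + r - 1 - (m + x) by omega]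
  rw [f1, f2, f3]; ring

end Roots2
end HF
end

open MvPolynomial

noncomputable section
set_option linter.unusedSectionVars false
namespace HF

/-! ### The Macdonald operator with a block of root of unity variables -/

section Blk
variable {R : Type} [Field R] [CharZero R] {z : R} {l n : ℕ}

theorem av_prod (v : Fin n → R) : av v = ∏ i, ∏ j, if i < j then v i - v j else 1 := by
  have h := Matrix.det_projVandermonde (fun _ => (1 : R)) v
  have e : Matrix.projVandermonde (fun _ => (1 : R)) v = Matrix.of fun i j => v i ^ dl n j := by
    ext i j
    unfold dl
    simp only [Matrix.projVandermonde, Matrix.rectVandermonde, Matrix.of_apply, one_pow, one_mul, Fin.val_rev]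
    congr 1; omega
  rw [e] at h
  unfold av alt
  rw [h]
  refine Finset.prod_congr rfl fun i _ => ?_
  rw [← Finset.prod_filter]
  refine Finset.prod_congr ?_ fun j _ => by ring
  ext j; simp

theorem av_append (a : Fin n → R) (w : Fin l → R) :
    av (Fin.append a w) = av a * av w * ∏ i, ∏ j, (a i - w j) := by
  rw [av_prod, av_prod, av_prod, Fin.prod_univ_add]
  simp only [Fin.prod_univ_add, Fin.append_left, Fin.append_right]
  have h1 : ∀ (i : Fin n) (j : Fin l), Fin.castAdd l i < Fin.natAdd n j := fun i j => by
    rw [Fin.lt_def]; simp; omega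
  have h2 : ∀ (i : Fin n) (j : Fin l), ¬ (Fin.natAdd n j < Fin.castAdd l i) := fun i j => by
    rw [Fin.lt_def]; simp; omega
  have h3 : ∀ (i j : Fin n), (Fin.castAdd l i < Fin.castAdd l j) ↔ i < j := fun i j => by
    rw [Fin.lt_def, Fin.lt_def]; simp
  have h4 : ∀ (i j : Fin l), (Fin.natAdd n i < Fin.natAdd n j) ↔ i < j := fun i j => by
    rw [Fin.lt_def, Fin.lt_def]; simp
  simp only [h1, h2, h3, h4, if_true, if_false, Finset.prod_const_one, one_mul, Finset.prod_mul_distrib]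
  ring

/-- A block of variables. -/
def wz (z u : R) (l : ℕ) : Fin l → R := fun j => u * z ^ (j : ℕ)

theorem prod_wz (hz : IsPrimitiveRoot z l) (hl : 0 < l) (x u : R) :
    ∏ j, (x - wz z u l j) = x ^ l - u ^ l := by
  rw [← prod_roots hz hl, ← Fin.prod_univ_eq_prod_range (fun j => x - z ^ j * u)]
  exact Finset.prod_congr rfl fun j _ => by unfold wz; ring

theorem av_wz_ne (hz : IsPrimitiveRoot z l) {u : R} (hu : u ≠ 0) : av (wz z u l) ≠ 0 := by
  rw [av_prod, Finset.prod_ne_zero_iff]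
  intro i _
  rw [Finset.prod_ne_zero_iff]
  intro j _
  split_ifs with h
  · unfold wz
    intro h0
    have h1 := mul_left_cancel₀ hu (sub_eq_zero.1 h0)
    have := hz.pow_inj i.2 j.2 h1
    exact absurd this (by omega)
  · exact one_ne_zero

theorem av_smul_wz (u : R) : av (fun i => z * wz z u l i) = cc z l * av (wz z u l) := by
  unfold av
  rw [alt_smul]
  congr 1
  unfold cc
  rw [Finset.prod_pow_eq_pow_sum]
  congr 1
  exact sum_dl (fun j => j)

theorem sc_append (s : Fin n → Bool) (s' : Fin l → Bool) (c : R) (v : Fin n → R) (w : Fin l → R) :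
    sc (Fin.append s s') c (Fin.append v w) = Fin.append (sc s c v) (sc s' c w) := by
  funext i
  refine Fin.addCases (fun i => ?_) (fun i => ?_) i
  · simp [sc]
  · simp [sc]

theorem pw_append (v : Fin n → R) (w : Fin l → R) :
    pw (Fin.append v w) = fun k => pw v k + pw w k := by
  funext k; unfold pw; rw [Fin.sum_univ_add]; simp

theorem av_mid (hz : IsPrimitiveRoot z l) (hl : 0 < l) (a : Fin n → R) (u : R) (s : Fin l → Bool)
    (h1 : s ≠ fun _ => true) (h2 : s ≠ fun _ => false) :
    av (Fin.append a (sc s z (wz z u l))) = 0 := by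
  set σ : ℕ → Fin l := fun m => ⟨m % l, Nat.mod_lt _ hl⟩ with hσ
  have hσi : ∀ j : Fin l, σ j = j := fun j => by
    apply Fin.ext; simp [hσ, Nat.mod_eq_of_lt j.2]
  obtain ⟨m, hm1, hm2⟩ : ∃ m, s (σ m) = true ∧ s (σ (m + 1)) = false := by
    by_contra hcon
    push Not at hcon
    obtain ⟨j0, hj0⟩ : ∃ j, s j = true := by
      by_contra hc; push Not at hc; exact h2 (funext fun j => by simpa using hc j)
    apply h1
    have hall : ∀ r : ℕ, s (σ (j0 + r)) = true := by
      intro r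
      induction r with
      | zero => rw [add_zero, hσi]; exact hj0
      | succ r ih => simpa [add_assoc] using hcon _ ih
    funext j
    have h3 := hall ((l - j0) + j)
    have : σ (j0 + ((l - j0) + j)) = j := by
      apply Fin.ext
      have e : (j0 : ℕ) + ((l - j0) + j) = j + l := by have := j0.2; omega
      simp only [hσ, e, Nat.add_mod_right]
      exact Nat.mod_eq_of_lt j.2
    rw [this] at h3; exact h3
  have hne : Fin.natAdd n (σ m) ≠ Fin.natAdd n (σ (m + 1)) := by
    intro h
    have := Fin.natAdd_injective _ _ h
    rw [this, hm2] at hm1; exact Bool.noConfusion hm1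
  refine alt_eq_rows _ _ hne ?_
  rw [Fin.append_right, Fin.append_right]
  unfold sc wz
  rw [hm1, hm2]
  have hp : ∀ m, z ^ (σ m : ℕ) = z ^ m := fun m => by
    simp only [hσ]; exact (pow_eq_pow_mod m hz.pow_eq_one).symm
  rw [hp, hp]
  simp only [if_true, Bool.false_eq_true, if_false]
  ring

theorem aDf_append (hz : IsPrimitiveRoot z l) (hl : 0 < l) (q X u : R) (F : (Fin (n + l) → R) → R)
    (y : Fin n → R) :
    aDf q z X F (Fin.append y (wz z u l)) =
      (av (wz z u l) * ∏ i, (y i ^ l - u ^ l)) *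
      ∑ s : Fin n → Bool, (∏ i, if s i then X else 1) * av (sc s z y) *
        (F (Fin.append (sc s q y) (wz z u l)) +
          X ^ l * cc z l * F (Fin.append (sc s q y) (wz z (q * u) l))) := by
  unfold aDf
  rw [← Equiv.sum_comp (Fin.appendEquiv n l), Fintype.sum_prod_type, Finset.mul_sum]
  refine Finset.sum_congr rfl fun s _ => ?_
  have hsc : ∀ i, (sc s z y i) ^ l = y i ^ l := fun i => by
    unfold sc; split_ifs
    · rw [mul_pow, hz.pow_eq_one, one_mul]
    · rfl
  have hpr : ∀ s' : Fin l → Bool, (∏ i, if (Fin.append s s') i then X else 1) =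
      (∏ i, if s i then X else 1) * ∏ i, if s' i then X else 1 := fun s' => by
    rw [Fin.prod_univ_add]; simp
  have hae : ∀ s' : Fin l → Bool, Fin.appendEquiv n l (s, s') = Fin.append s s' := fun _ => rfl
  simp_rw [hae, sc_append, hpr]
  have hT : ∀ c : R, sc (fun _ : Fin l => true) c (wz z u l) = fun i => c * wz z u l i := fun c => by
    funext i; simp [sc]
  have hF : ∀ c : R, sc (fun _ : Fin l => false) c (wz z u l) = wz z u l := fun c => by
    funext i; simp [sc]
  have hne : (fun _ : Fin l => true) ≠ fun _ => false := fun h => by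
    simpa using congrFun h ⟨0, hl⟩
  rw [← Finset.sum_subset (Finset.subset_univ ({(fun _ => true), (fun _ => false)} : Finset (Fin l → Bool)))]
  · rw [Finset.sum_pair hne, hT, hT, hF, hF]
    have hq : (fun i => q * wz z u l i) = wz z (q * u) l := by
      funext i; unfold wz; ring
    have hz' : (fun i => z * wz z u l i) = wz z (z * u) l := by
      funext i; unfold wz; ring
    have hA := av_smul_wz (z := z) (l := l) u
    rw [hq]
    rw [hz'] at hA ⊢
    rw [av_append, av_append, hA]
    simp only [prod_wz hz hl, hsc, mul_pow, hz.pow_eq_one, one_mul]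
    simp only [if_true, Bool.false_eq_true, if_false, Finset.prod_const, Finset.card_univ, Fintype.card_fin, one_pow]
    ring
  · intro s' _ hs'
    simp only [Finset.mem_insert, Finset.mem_singleton, not_or] at hs'
    rw [av_mid hz hl _ _ _ hs'.1 hs'.2]; ring

/-- The power sums of the roots of unity. -/
def pz (z : R) (l : ℕ) (k : ℕ+) : R := ∑ j ∈ Finset.range l, z ^ (j * (k : ℕ))

theorem pw_wz (u : R) (k : ℕ+) : pw (wz z u l) k = u ^ (k : ℕ) * pz z l k := by
  unfold pw wz pz
  rw [Finset.mul_sum, ← Fin.sum_univ_eq_sum_range (fun j => u ^ (k : ℕ) * z ^ (j * (k : ℕ)))]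
  exact Finset.sum_congr rfl fun j _ => by rw [mul_pow, pow_mul]

/-- Expansion in `u` of a shifted function. -/
theorem exists_shift (π : ℕ+ → R) {f : SymFn R} {d : ℕ} (hf : Hom f d) :
    ∃ G : ℕ → SymFn R, (∀ k ∈ Finset.range (d + 1), Hom (G k) (d - k)) ∧ ∀ (χ : ℕ+ → R) (u : R),
      eval (fun k => χ k + u ^ (k : ℕ) * π k) f = ∑ k ∈ Finset.range (d + 1), u ^ k * eval χ (G k) := by
  classical
  have hmon : ∀ mu : Multiset ℕ+, ∃ G : ℕ → SymFn R, (∀ k ∈ Finset.range (wt mu + 1), Hom (G k) (wt mu - k)) ∧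
      ∀ (χ : ℕ+ → R) (u : R), mon (fun k => χ k + u ^ (k : ℕ) * π k) mu =
        ∑ k ∈ Finset.range (wt mu + 1), u ^ k * eval χ (G k) := by
    intro mu
    induction mu using Multiset.induction_on with
    | empty =>
      refine ⟨fun _ => 1, ?_, ?_⟩
      · intro k hk
        rw [wt_zero] at *
        rw [Nat.zero_sub]; exact hom_one
      · intro χ u; rw [wt_zero]; simp [mon]
    | cons a mu ih =>
      obtain ⟨G, hG, hs⟩ := ih
      have hw : wt (a ::ₘ mu) = a + wt mu := by simp [wt]
      refine ⟨fun k => (if k ≤ wt mu then X a * G k else 0) +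
        (if (a : ℕ) ≤ k then π a • G (k - a) else 0), ?_, ?_⟩
      · intro k hk
        rw [Finset.mem_range, hw] at hk
        rw [hw]
        apply Hom.add
        · split_ifs with h
          · have h1 : Hom (X a : SymFn R) (a : ℕ) := isWeightedHomogeneous_X _ _ _
            have := h1.mul (hG k (Finset.mem_range.2 (by omega)))
            rwa [show (a : ℕ) + (wt mu - k) = a + wt mu - k by omega] at this
          · exact hom_zero _
        · split_ifs with h
          · have := (hG (k - a) (Finset.mem_range.2 (by omega)))
            rw [show wt mu - (k - a) = a + wt mu - k by omega] at this
            exact Hom.smul _ this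
          · exact hom_zero _
      · intro χ u
        have hm : mon (fun k => χ k + u ^ (k : ℕ) * π k) (a ::ₘ mu) = (χ a + u ^ (a : ℕ) * π a) *
            mon (fun k => χ k + u ^ (k : ℕ) * π k) mu := by simp [mon]
        rw [hm, hs, hw, add_mul]
        simp only [_root_.map_add, mul_add, Finset.sum_add_distrib]
        congr 1
        · rw [Finset.mul_sum, show (a : ℕ) + wt mu + 1 = (wt mu + 1) + a by omega, Finset.sum_range_add _ (wt mu + 1)]
          rw [Finset.sum_eq_zero (s := Finset.range (a : ℕ)), add_zero]
          · refine Finset.sum_congr rfl fun k hk => ?_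
            have := Finset.mem_range.1 hk
            rw [if_pos (by omega), _root_.map_mul, eval_X]; ring
          · intro k _
            rw [if_neg (by omega), _root_.map_zero, mul_zero]
        · rw [Finset.mul_sum, show (a : ℕ) + wt mu + 1 = a + (wt mu + 1) by omega, Finset.sum_range_add _ (a : ℕ)]
          rw [Finset.sum_eq_zero (s := Finset.range (a : ℕ)), zero_add]
          · refine Finset.sum_congr rfl fun k hk => ?_
            rw [if_pos (by omega), smul_eval, show (a : ℕ) + k - a = k by omega, pow_add]; ring
          · intro k hk
            have := Finset.mem_range.1 hk
            rw [if_neg (by omega), _root_.map_zero, mul_zero]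
  choose G hG hs using hmon
  refine ⟨fun k => ∑ mu ∈ PS d, cf f mu • G mu k, ?_, ?_⟩
  · intro k hk
    refine Hom.sum _ _ fun mu hmu => Hom.smul _ ?_
    have h := hG mu k
    rw [mem_PS.1 hmu] at h
    exact h hk
  · intro χ u
    rw [eval_eq_sum hf]
    simp only [_root_.map_sum, smul_eval, Finset.mul_sum]
    rw [Finset.sum_comm]
    refine Finset.sum_congr rfl fun mu hmu => ?_
    rw [hs, mem_PS.1 hmu, Finset.mul_sum]
    exact Finset.sum_congr rfl fun k _ => by ring

end Blk
end HF
end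

open MvPolynomial

noncomputable section
set_option linter.unusedSectionVars false
namespace HF

/-! ### Branching with a block of roots of unity -/

section Br
variable {R : Type} [Field R] [CharZero R] {z q : R} {l n : ℕ} {P : Multiset ℕ+ → SymFn R}

theorem coeffs_zero (r : Polynomial R) (hr : r ≠ 0) (m : ℕ) (a : ℕ → R)
    (h : ∀ u, r.eval u * ∑ k ∈ Finset.range m, u ^ k * a k = 0) : ∀ k ∈ Finset.range m, a k = 0 := by
  have h1 : r * ∑ k ∈ Finset.range m, Polynomial.C (a k) * Polynomial.X ^ k = 0 := by
    apply Polynomial.funext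
    intro u
    rw [Polynomial.eval_mul, Polynomial.eval_zero, ← h u, Polynomial.eval_finsetSum]
    congr 1
    refine Finset.sum_congr rfl fun k _ => ?_
    rw [Polynomial.eval_mul, Polynomial.eval_C, Polynomial.eval_pow, Polynomial.eval_X, mul_comm]
  have h2 := (mul_eq_zero.1 h1).resolve_left hr
  intro k hk
  have h3 := congrArg (fun p => Polynomial.coeff p k) h2
  simpa [Polynomial.finsetSum_coeff, Polynomial.coeff_C_mul, Polynomial.coeff_X_pow, Finset.mem_range.1 hk] using h3

theorem coeffs_eq (m : ℕ) (a b : ℕ → R)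
    (h : ∀ u, ∑ k ∈ Finset.range m, u ^ k * a k = ∑ k ∈ Finset.range m, u ^ k * b k) :
    ∀ k ∈ Finset.range m, a k = b k := by
  intro k hk
  refine sub_eq_zero.1 (coeffs_zero 1 one_ne_zero m (fun k => a k - b k) (fun u => ?_) k hk)
  simp only [mul_sub, Finset.sum_sub_distrib, h u, sub_self, mul_zero]

theorem block_eig (hz : IsPrimitiveRoot z l) (hl : 0 < l) (hE : Eig q z P) (ν : Multiset ℕ+)
    (hn : Multiset.card ν ≤ n) (d : ℕ) (G : ℕ → SymFn R)
    (hG : ∀ (χ : ℕ+ → R) (u : R), eval (fun k => χ k + u ^ (k : ℕ) * pz z l k) (P ν) =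
      ∑ k ∈ Finset.range (d + 1), u ^ k * eval χ (G k)) (X : R) :
    ∀ k ∈ Finset.range (d + 1),
    (1 + X ^ l * cc z l * q ^ k) • DL R n q z X (G k) = Ev (n + l) q z ν X • AL R n (G k) := by
  intro k hk
  funext y
  rw [Pi.smul_apply, Pi.smul_apply, DL_apply, AL_apply, smul_eq_mul, smul_eq_mul]
  set r : Polynomial R := Polynomial.X * ∏ i : Fin n, (Polynomial.C (y i ^ l) - Polynomial.X ^ l) with hr
  have hr0 : r ≠ 0 := by
    rw [hr]
    refine mul_ne_zero Polynomial.X_ne_zero (Finset.prod_ne_zero_iff.2 fun i _ h0 => ?_)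
    have := congrArg (fun p => Polynomial.coeff p l) h0
    simp only [Polynomial.coeff_sub, Polynomial.coeff_C, Polynomial.coeff_X_pow, hl.ne', if_false, if_true,
      Polynomial.coeff_zero, zero_sub] at this
    exact one_ne_zero (neg_eq_zero.1 this)
  refine sub_eq_zero.1 (coeffs_zero r hr0 (d + 1) (fun k => (1 + X ^ l * cc z l * q ^ k) *
    aDf q z X (fn n (G k)) y - Ev (n + l) q z ν X * (av y * eval (pw y) (G k))) (fun u => ?_) k hk)
  have hre : r.eval u = u * ∏ i, (y i ^ l - u ^ l) := by
    rw [hr]; simp [Polynomial.eval_prod]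
  rw [hre]
  by_cases hu : u = 0
  · rw [hu, zero_mul, zero_mul]
  have h1 := congrFun (hE.2 (n + l) ν (by omega) X) (Fin.append y (wz z u l))
  rw [Pi.smul_apply, DL_apply, AL_apply, smul_eq_mul, aDf_append hz hl, av_append] at h1
  simp only [prod_wz hz hl] at h1
  have hf : ∀ (v : Fin n → R) (u : R), fn (n + l) (P ν) (Fin.append v (wz z u l)) =
      ∑ k ∈ Finset.range (d + 1), u ^ k * eval (pw v) (G k) := by
    intro v u
    rw [← hG]
    unfold fn
    rw [pw_append]
    simp only [pw_wz]
  have hf' : eval (pw (Fin.append y (wz z u l))) (P ν) =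
      ∑ k ∈ Finset.range (d + 1), u ^ k * eval (pw y) (G k) := hf y u
  simp only [hf, hf'] at h1
  have h2 : (∏ i, (y i ^ l - u ^ l)) * ((∑ s : Fin n → Bool, (∏ i, if s i then X else 1) * av (sc s z y) *
      (∑ k ∈ Finset.range (d + 1), u ^ k * eval (pw (sc s q y)) (G k) +
        X ^ l * cc z l * ∑ k ∈ Finset.range (d + 1), (q * u) ^ k * eval (pw (sc s q y)) (G k))) -
      Ev (n + l) q z ν X * (av y * ∑ k ∈ Finset.range (d + 1), u ^ k * eval (pw y) (G k))) = 0 := by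
    refine mul_left_cancel₀ (av_wz_ne hz hu) ?_
    rw [mul_zero]
    linear_combination h1
  have h3 : ∑ k ∈ Finset.range (d + 1), u ^ k * ((1 + X ^ l * cc z l * q ^ k) *
      aDf q z X (fn n (G k)) y - Ev (n + l) q z ν X * (av y * eval (pw y) (G k))) =
      ((∑ s : Fin n → Bool, (∏ i, if s i then X else 1) * av (sc s z y) *
      (∑ k ∈ Finset.range (d + 1), u ^ k * eval (pw (sc s q y)) (G k) +
        X ^ l * cc z l * ∑ k ∈ Finset.range (d + 1), (q * u) ^ k * eval (pw (sc s q y)) (G k))) -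
      Ev (n + l) q z ν X * (av y * ∑ k ∈ Finset.range (d + 1), u ^ k * eval (pw y) (G k))) := by
    simp only [mul_sub, Finset.sum_sub_distrib]
    congr 1
    · unfold aDf fn
      simp only [Finset.mul_sum, ← Finset.sum_add_distrib]
      rw [Finset.sum_comm]
      refine Finset.sum_congr rfl fun s _ => Finset.sum_congr rfl fun k _ => ?_
      ring
    · simp only [Finset.mul_sum]
      exact Finset.sum_congr rfl fun k _ => by ring
  rw [h3, mul_assoc, h2, mul_zero]

theorem block_branch (hz : IsPrimitiveRoot z l) (hl : 0 < l) (hg : Gen q z) (hE : Eig q z P)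
    (ν : Multiset ℕ+) :
    ∃ b : ℕ → Multiset ℕ+ → R, (∀ (i : ℕ+) (lam : Multiset ℕ+), wt ν = wt lam + l * i →
        b (l * i) lam ≠ 0 → ν = lam + Multiset.replicate l i) ∧
      ∀ (χ : ℕ+ → R) (u : R), eval (fun k => χ k + u ^ (k : ℕ) * pz z l k) (P ν) =
        ∑ k ∈ Finset.range (wt ν + 1), u ^ k * ∑ lam ∈ PS (wt ν - k), b k lam * eval χ (P lam) := by
  obtain ⟨G, hGh, hG⟩ := exists_shift (pz z l) (hE.1.hom ν)
  have hex : ∀ k : ℕ, ∃ b : Multiset ℕ+ → R, k ∈ Finset.range (wt ν + 1) →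
      G k = ∑ a ∈ PS (wt ν - k), b a • P a := by
    intro k
    by_cases hk : k ∈ Finset.range (wt ν + 1)
    · obtain ⟨b, hb⟩ := hE.1.expand (hGh k hk)
      exact ⟨b, fun _ => hb⟩
    · exact ⟨fun _ => 0, fun h => absurd h hk⟩
  choose b hb using hex
  refine ⟨b, ?_, ?_⟩
  · intro i lam hw hne
    have hk : l * (i : ℕ) ∈ Finset.range (wt ν + 1) := Finset.mem_range.2 (by omega)
    have hc : Multiset.card lam ≤ wt ν := (card_le_wt lam).trans (by omega)
    apply Ev_inj (n := wt ν + l) hg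
    · exact (card_le_wt ν).trans (by omega)
    · rw [Multiset.card_add, Multiset.card_replicate]; omega
    intro X
    have h1 := block_eig (n := wt ν) hz hl hE ν (card_le_wt ν) (wt ν) G hG X _ hk
    rw [hb _ hk] at h1
    have h2 := hE.coef (b (l * i)) X _ _ h1 lam (by rw [mem_PSn]; exact ⟨by omega, hc⟩)
    have h3 := (mul_eq_zero.1 h2).resolve_left hne
    rw [Ev_block q hz hl lam hc, sub_eq_zero.1 h3]
  · intro χ u
    rw [hG]
    refine Finset.sum_congr rfl fun k hk => ?_
    rw [hb k hk, _root_.map_sum]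
    simp only [smul_eval]

theorem HS_coeff_scale (ψ : ℕ+ → R) (u : R) (d : ℕ) :
    PowerSeries.coeff d (HS fun k => u ^ (k : ℕ) * ψ k) = u ^ d * PowerSeries.coeff d (HS ψ) := by
  rw [HS_coeff, HS_coeff, Finset.mul_sum]
  refine Finset.sum_congr rfl fun mu hmu => ?_
  have : mon (fun k => u ^ (k : ℕ) * ψ k) mu = u ^ d * mon ψ mu := by
    unfold mon
    rw [Multiset.prod_map_mul, ← mem_PS.1 hmu]
    congr 1
    unfold wt
    clear hmu
    induction mu using Multiset.induction_on with
    | empty => simp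
    | cons a s ih => rw [Multiset.map_cons, Multiset.prod_cons, ih, Multiset.map_cons, Multiset.sum_cons, pow_add]
  rw [this, mul_div_assoc]

theorem sum_swap_aux {ι : Type} (A B : Finset ι) (b : ι → ι → R) (f p g : ι → R) (r a : R) :
    ∑ m ∈ A, (∑ ν ∈ B, b ν m * f ν - g m * r) * (a * p m) =
      a * (∑ ν ∈ B, (∑ m ∈ A, b ν m * p m) * f ν - (∑ m ∈ A, p m * g m) * r) := by
  rw [mul_sub, Finset.mul_sum, Finset.sum_mul, Finset.mul_sum]
  simp only [sub_mul, Finset.sum_sub_distrib]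
  congr 1
  · simp only [Finset.sum_mul, Finset.mul_sum]
    rw [Finset.sum_comm]
    refine Finset.sum_congr rfl fun ν _ => Finset.sum_congr rfl fun mu _ => ?_
    ring
  · refine Finset.sum_congr rfl fun mu _ => ?_
    ring

theorem block_dual (hz : IsPrimitiveRoot z l) (hl : 0 < l) (hq : ∀ k : ℕ+, 1 - q ^ (k : ℕ) ≠ 0)
    (hg : Gen q z) (hE : Eig q z P)
    (N : Multiset ℕ+ → SymFn R) (hN : ∀ a, Hom (N a) (wt a))
    (hd : ∀ d, ∀ a ∈ PS d, ∀ b ∈ PS d, frm d (fun k => 1 - q ^ (k : ℕ)) (P a) (N b) = if a = b then 1 else 0)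
    (lam : Multiset ℕ+) (i : ℕ+) :
    ∃ κ : R, ∀ χ' : ℕ+ → R, κ * eval χ' (N (lam + Multiset.replicate l i)) =
      eval χ' (N lam) * PowerSeries.coeff (l * i) (HS fun k => pz z l k * χ' k / (1 - q ^ (k : ℕ))) := by
  choose b hb1 hb2 using fun ν => block_branch hz hl hg hE ν
  refine ⟨b (lam + Multiset.replicate l i) (l * i) lam, fun χ' => ?_⟩
  set d := wt lam + l * i with hdd
  have hker : ∀ d χ, ∑ a ∈ PS d, eval χ (P a) * eval χ' (N a) =
      PowerSeries.coeff d (HS fun k => χ k * χ' k / (1 - q ^ (k : ℕ))) := fun d χ =>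
    dual_kernel d (fun k : ℕ+ => 1 - q ^ (k : ℕ)) hq P N (fun a ha => hE.1.hom' ha)
      (fun a ha => by rw [← mem_PS.1 ha]; exact hN a) (hd d) χ χ'
  set Rr : ℕ → R := fun k => PowerSeries.coeff k (HS fun k => pz z l k * χ' k / (1 - q ^ (k : ℕ))) with hR
  have hmain : ∀ χ : ℕ+ → R, ∀ k ∈ Finset.range (d + 1),
      ∑ ν ∈ PS d, (∑ mu ∈ PS (d - k), b ν k mu * eval χ (P mu)) * eval χ' (N ν) =
      (∑ a ∈ PS (d - k), eval χ (P a) * eval χ' (N a)) * Rr k := by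
    intro χ
    apply coeffs_eq
    intro u
    have h1 := hker d (fun k => χ k + u ^ (k : ℕ) * pz z l k)
    have h2 : (HS fun k => (χ k + u ^ (k : ℕ) * pz z l k) * χ' k / (1 - q ^ (k : ℕ))) =
        HS (fun k => χ k * χ' k / (1 - q ^ (k : ℕ))) *
        HS (fun k => u ^ (k : ℕ) * (pz z l k * χ' k / (1 - q ^ (k : ℕ)))) := by
      rw [← HS_add]
      congr 1
      funext k
      ring
    rw [h2, PowerSeries.coeff_mul, ← Finset.Nat.sum_antidiagonal_swap,
      Finset.Nat.sum_antidiagonal_eq_sum_range_succ_mk] at h1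
    simp only [Prod.swap, HS_coeff_scale] at h1
    simp only [← hker (d - _) χ] at h1
    have h3 : ∑ ν ∈ PS d, eval (fun k => χ k + u ^ (k : ℕ) * pz z l k) (P ν) * eval χ' (N ν) =
        ∑ k ∈ Finset.range (d + 1), u ^ k *
          ∑ ν ∈ PS d, (∑ mu ∈ PS (d - k), b ν k mu * eval χ (P mu)) * eval χ' (N ν) := by
      simp only [Finset.mul_sum]
      rw [Finset.sum_comm]
      refine Finset.sum_congr rfl fun ν hν => ?_
      rw [hb2, mem_PS.1 hν, Finset.sum_mul]
      exact Finset.sum_congr rfl fun k _ => by ring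
    rw [← h3, h1]
    exact Finset.sum_congr rfl fun k _ => by rw [hR]; ring
  have hk : l * (i : ℕ) ∈ Finset.range (d + 1) := Finset.mem_range.2 (by omega)
  have hdl : d - l * i = wt lam := by omega
  have h0 := hE.1.indep (n := wt lam) (d := wt lam)
    (fun mu => ∑ ν ∈ PS d, b ν (l * i) mu * eval χ' (N ν) - eval χ' (N mu) * Rr (l * i)) ?_ lam
    (by rw [PSn_self]; exact mem_PS.2 rfl)
  · have h1 := sub_eq_zero.1 h0
    rw [← h1]
    symm
    refine Finset.sum_eq_single_of_mem _ ?_ ?_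
    · rw [mem_PS, wt_add, wt_replicate]
    · intro ν hν hne
      have : b ν (l * i) lam = 0 := by
        by_contra hc
        exact hne (hb1 ν i lam (by rw [mem_PS.1 hν]) hc)
      rw [this, zero_mul]
  · funext v
    rw [PSn_self, Finset.sum_apply]
    simp only [Pi.smul_apply, AL_apply, smul_eq_mul, Pi.zero_apply]
    have h1 := hmain (pw v) _ hk
    rw [hdl] at h1
    have h2 : ∑ mu ∈ PS (wt lam), (∑ ν ∈ PS d, b ν (l * i) mu * eval χ' (N ν) - eval χ' (N mu) * Rr (l * i)) *
        (av v * eval (pw v) (P mu)) = av v * (∑ ν ∈ PS d, (∑ mu ∈ PS (wt lam), b ν (l * i) mu *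
          eval (pw v) (P mu)) * eval χ' (N ν) -
          (∑ a ∈ PS (wt lam), eval (pw v) (P a) * eval χ' (N a)) * Rr (l * i)) := by
      exact sum_swap_aux _ _ _ _ _ _ _ _
    rw [h2, h1, sub_self, mul_zero]

theorem HS_block_ne (i l : ℕ+) :
    PowerSeries.coeff ((l : ℕ) * i) (HS fun k => if k = l then (1 : R) else 0) ≠ 0 := by
  rw [HS_coeff, Finset.sum_eq_single_of_mem (Multiset.replicate (i : ℕ) l)]
  · have : mon (fun k => if k = l then (1 : R) else 0) (Multiset.replicate (i : ℕ) l) = 1 := by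
      simp [mon]
    rw [this]
    exact one_div_ne_zero (zz_ne_zero _ (fun _ => one_ne_zero) _)
  · rw [mem_PS, wt_replicate, mul_comm]
  · intro mu hmu hne
    have hex : ∃ a ∈ mu, a ≠ l := by
      by_contra hc
      push Not at hc
      have h1 := Multiset.eq_replicate_card.2 hc
      have h2 := mem_PS.1 hmu
      rw [h1, wt_replicate, mul_comm] at h2
      have h3 := Nat.eq_of_mul_eq_mul_left l.2 h2
      rw [h3] at h1
      exact hne h1
    obtain ⟨a, ha, hal⟩ := hex
    have : mon (fun k => if k = l then (1 : R) else 0) mu = 0 := by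
      unfold mon
      exact Multiset.prod_eq_zero (Multiset.mem_map.2 ⟨a, ha, if_neg hal⟩)
    rw [this, zero_div]

theorem block_mul (hz : IsPrimitiveRoot z l) (hl : 0 < l) (hq : ∀ k : ℕ+, 1 - q ^ (k : ℕ) ≠ 0)
    (hg : Gen q z) (hE : Eig q z P)
    (H : Multiset ℕ+ → SymFn R) (hH : ∀ a, Hom (H a) (wt a))
    (ho : ∀ a, ∀ b ∈ PS (wt a), b ≠ a → frm (wt a) (fun k => 1 - q ^ (k : ℕ)) (P b) (H a) = 0)
    (h1 : ∀ a, eval (fun _ => 1) (H a) = 1)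
    (lam : Multiset ℕ+) (i : ℕ+) :
    H (lam + Multiset.replicate l i) = H lam * H (Multiset.replicate l i) := by
  classical
  set c : Multiset ℕ+ → R := fun a => frm (wt a) (fun k => 1 - q ^ (k : ℕ)) (P a) (H a) with hc
  have hc0 : ∀ a, c a ≠ 0 := by
    intro a h0
    have : H a = 0 := frm_nondeg hE.1 hq (hH a) fun b hb => by
      by_cases hba : b = a
      · rw [hba]; exact h0
      · exact ho a b hb hba
    have h2 := h1 a
    rw [this, _root_.map_zero] at h2
    exact zero_ne_one h2
  set Rr : (ℕ+ → R) → R := fun χ' => PowerSeries.coeff (l * i) (HS fun k => pz z l k * χ' k / (1 - q ^ (k : ℕ))) with hR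
  have key : ∀ lam : Multiset ℕ+, ∃ κ : R, ∀ χ' : ℕ+ → R,
      κ * eval χ' (H (lam + Multiset.replicate l i)) = eval χ' (H lam) * Rr χ' := by
    intro lam
    obtain ⟨κ, hκ⟩ := block_dual hz hl hq hg hE (fun a => (c a)⁻¹ • H a) (fun a => Hom.smul _ (hH a)) (by
      intro d a ha b hb
      rw [frm_smul_right]
      rw [mem_PS] at ha hb
      subst hb
      split_ifs with hab
      · rw [hab]; exact inv_mul_cancel₀ (hc0 b)
      · rw [ho b a (mem_PS.2 ha) hab, mul_zero]) lam i
    refine ⟨c lam * κ * (c (lam + Multiset.replicate l i))⁻¹, fun χ' => ?_⟩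
    have h2 := hκ χ'
    simp only [smul_eval] at h2
    have h3 := congrArg (fun x => c lam * x) h2
    beta_reduce at h3
    rw [← mul_assoc (c lam) ((c lam)⁻¹ * _), ← mul_assoc (c lam) (c lam)⁻¹, mul_inv_cancel₀ (hc0 lam), one_mul] at h3
    rw [← h3]; ring
  have key2 : ∀ lam : Multiset ℕ+, ∀ χ' : ℕ+ → R,
      Rr (fun _ => 1) * eval χ' (H (lam + Multiset.replicate l i)) = eval χ' (H lam) * Rr χ' := by
    intro lam χ'
    obtain ⟨κ, hκ⟩ := key lam
    have h2 := hκ (fun _ => 1)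
    rw [h1, h1, mul_one, one_mul] at h2
    rw [← h2, hκ]
  have hH0 : ∀ χ', eval χ' (H 0) = 1 := by
    intro χ'
    have hP0 : PS 0 = {0} := by
      ext mu
      rw [mem_PS, Finset.mem_singleton]
      exact ⟨eq_zero_of_wt, fun h => by rw [h, wt_zero]⟩
    have h2 := h1 0
    have h3 := hH 0
    rw [wt_zero] at h3
    rw [eval_eq_sum h3, hP0, Finset.sum_singleton] at h2 ⊢
    simpa [mon] using h2
  have hrho : Rr (fun _ => 1) ≠ 0 := by
    intro h0
    set L : ℕ+ := ⟨l, hl⟩ with hL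
    have h2 := key2 0 (fun k => if k = L then (1 - q ^ (k : ℕ)) / l else 0)
    rw [h0, zero_mul, hH0, one_mul] at h2
    have e : (fun k : ℕ+ => pz z l k * (if k = L then (1 - q ^ (k : ℕ)) / l else 0) / (1 - q ^ (k : ℕ))) =
        fun k => if k = L then (1 : R) else 0 := by
      funext k
      split_ifs with h
      · have hp : pz z l k = l := by
          unfold pz
          rw [h]
          have : ∀ j ∈ Finset.range l, z ^ (j * (L : ℕ)) = 1 := fun j _ => by
            rw [mul_comm, pow_mul]; simp only [hL, PNat.mk_coe, hz.pow_eq_one, one_pow]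
          rw [Finset.sum_congr rfl this]; simp
        have hl0 : (l : R) ≠ 0 := Nat.cast_ne_zero.2 hl.ne'
        rw [hp]
        have := hq k
        field_simp
      · simp
    rw [hR] at h2
    simp only [e] at h2
    exact HS_block_ne i L h2.symm
  apply MvPolynomial.funext
  intro χ'
  rw [_root_.map_mul]
  refine mul_left_cancel₀ hrho ?_
  have h3 := key2 0 χ'
  rw [zero_add, hH0, one_mul] at h3
  rw [key2, ← h3]; ring

end Br
end HF
end

open MvPolynomial

noncomputable section
set_option linter.unusedSectionVars false
namespace HF

/-! ### The parameters -/

theorem qK_pow_inj {a b : ℕ} {c d : ℂ} (hc : c ≠ 0) (h : RatFunc.C c * qK ^ a = RatFunc.C d * qK ^ b) : a = b := by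
  have h1 : algebraMap (Polynomial ℂ) KK (Polynomial.C c * Polynomial.X ^ a) =
      algebraMap (Polynomial ℂ) KK (Polynomial.C d * Polynomial.X ^ b) := by
    rw [_root_.map_mul, _root_.map_mul, _root_.map_pow, _root_.map_pow, RatFunc.algebraMap_X, RatFunc.algebraMap_C,
      RatFunc.algebraMap_C]
    exact h
  have h2 := RatFunc.algebraMap_injective ℂ h1
  have h3 := congrArg (fun p => Polynomial.coeff p a) h2
  by_contra hab
  simp only [Polynomial.coeff_C_mul, Polynomial.coeff_X_pow, if_true, mul_one, hab, if_false, mul_zero] at h3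
  exact hc h3

theorem qK_ne : qK ≠ 0 := RatFunc.X_ne_zero

theorem gen_root {c : ℂ} (hc : c ≠ 0) : Gen qK (RatFunc.C c) := by
  intro a b j k h
  rw [← _root_.map_pow, ← _root_.map_pow, mul_comm, mul_comm (qK ^ b)] at h
  exact qK_pow_inj (pow_ne_zero _ hc) h

theorem hqK (k : ℕ+) : 1 - qK ^ (k : ℕ) ≠ 0 := by
  intro h
  have : (0 : ℕ) = k := qK_pow_inj (c := 1) (d := 1) one_ne_zero (by
    rw [pow_zero, _root_.map_one, one_mul, one_mul]; exact sub_eq_zero.1 h)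
  exact k.2.ne this

theorem tF_ne : tF ≠ 0 := RatFunc.X_ne_zero

theorem inv_swap {F : Type} [Field F] {t A B : F} {j k : ℕ} (ht : t ≠ 0)
    (h : A * t⁻¹ ^ j = B * t⁻¹ ^ k) : A * t ^ k = B * t ^ j := by
  rw [inv_pow, inv_pow] at h
  have hj := pow_ne_zero j ht
  have hk := pow_ne_zero k ht
  field_simp at h
  linear_combination h

theorem inv_one_aux {F : Type} [Field F] {t : F} {k : ℕ} (h : 1 - t⁻¹ ^ k = 0) : 1 = t ^ k := by
  have h2 := sub_eq_zero.1 h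
  rw [inv_pow] at h2
  exact (inv_eq_one.1 h2.symm).symm

theorem gen_tF : Gen qF tF⁻¹ := by
  intro a b j k h
  have ht := tF_ne
  have h0 : qF ^ a * tF ^ k = qF ^ b * tF ^ j :=
    inv_swap ht h
  have h1 : algebraMap (Polynomial KK) FF (Polynomial.C (qK ^ a) * Polynomial.X ^ k) =
      algebraMap (Polynomial KK) FF (Polynomial.C (qK ^ b) * Polynomial.X ^ j) := by
    simp only [_root_.map_mul, _root_.map_pow, RatFunc.algebraMap_X, RatFunc.algebraMap_C]
    exact h0
  have h2 := RatFunc.algebraMap_injective KK h1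
  have h3 := congrArg (fun p => Polynomial.coeff p k) h2
  simp only [Polynomial.coeff_C_mul, Polynomial.coeff_X_pow, if_true, mul_one] at h3
  by_cases hkj : k = j
  · rw [if_pos hkj, mul_one] at h3
    exact qK_pow_inj (c := 1) (d := 1) one_ne_zero (by rw [h3])
  · rw [if_neg hkj, mul_zero] at h3
    exact absurd h3 (pow_ne_zero _ qK_ne)

theorem hqF (k : ℕ+) : 1 - qF ^ (k : ℕ) ≠ 0 := by
  intro h
  have := gen_tF 0 k 0 0 (by simpa using sub_eq_zero.1 h)
  exact k.2.ne this

theorem htF (k : ℕ+) : 1 - tF⁻¹ ^ (k : ℕ) ≠ 0 := by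
  intro h
  have h1 : (1 : FF) = tF ^ (k : ℕ) := by
    have h5 := @inv_one_aux FF _ tF (k : ℕ) h
    exact h5
  have h2 : algebraMap (Polynomial KK) FF 1 = algebraMap (Polynomial KK) FF (Polynomial.X ^ (k : ℕ)) := by
    rw [_root_.map_one, _root_.map_pow, RatFunc.algebraMap_X]; exact h1
  have h3 := congrArg (fun p => Polynomial.coeff p 0) (RatFunc.algebraMap_injective KK h2)
  have h4 : (0 : ℕ) ≠ k := k.2.ne
  simp [Polynomial.coeff_X_pow] at h3
  exact h4 h3

theorem specT_block {l : ℕ} (hl : 0 < l) {zeta : ℂ} (hzeta : IsPrimitiveRoot zeta l)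
    {P : Multiset ℕ+ → SymFn FF} (hP : IsMacdonaldBasis qF tF⁻¹ P) (lam : Multiset ℕ+) (i : ℕ+) :
    specT (RatFunc.C zeta) (Htilde qF tF P (lam + Multiset.replicate l i)) =
      specT (RatFunc.C zeta) (Htilde qF tF P lam) *
      specT (RatFunc.C zeta) (Htilde qF tF P (Multiset.replicate l i)) := by
  have hz0 : zeta ≠ 0 := hzeta.ne_zero hl.ne'
  have hc0 : (RatFunc.C zeta : KK) ≠ 0 := by
    rw [Ne, _root_.map_eq_zero]; exact hz0
  have hprim : IsPrimitiveRoot (RatFunc.C zeta⁻¹ : KK) l :=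
    hzeta.inv.map_of_injective (f := (RatFunc.C : ℂ →+* KK)) RatFunc.C_injective
  have hci : (RatFunc.C zeta⁻¹ : KK) = (RatFunc.C zeta)⁻¹ := map_inv₀ _ _
  have hg : Gen qK (RatFunc.C zeta⁻¹) := gen_root (inv_ne_zero hz0)
  have hT : Sp (RatFunc.C zeta : KK) tF⁻¹ (RatFunc.C zeta⁻¹) := by
    rw [hci]; exact Sp.var.inv hc0
  have hE : Eig qF tF⁻¹ P := mac_eig qF tF⁻¹ hqF htF hP
  obtain ⟨P', hE', hPP⟩ := spec_eig hT hg hE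
  choose H' h1 h2 h3 h4 using fun a => spec_dual (c := RatFunc.C zeta) hqK
    (hci ▸ inv_ne_zero hc0) hg (P := P) (H := Htilde qF tF P) hE' hPP
    (fun a => Htilde_hom hE.1 a) (fun a b hab => Htilde_orth hP a b hab)
    (fun a => Htilde_one tF_ne hqF htF gen_tF hP a) a
  rw [(h1 _).specT, (h1 _).specT, (h1 _).specT]
  exact block_mul hprim hl hqK hg hE' H' h2 h3 h4 lam i

/-- The positive integer `i + 1`. -/
def pn (i : ℕ) : ℕ+ := ⟨i + 1, Nat.succ_pos i⟩

theorem specT_blocks {l : ℕ} (hl : 0 < l) {zeta : ℂ} (hzeta : IsPrimitiveRoot zeta l)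
    {P : Multiset ℕ+ → SymFn FF} (hP : IsMacdonaldBasis qF tF⁻¹ P) (lam : Multiset ℕ+) (f : ℕ → ℕ) (n : ℕ) :
    specT (RatFunc.C zeta) (Htilde qF tF P (lam + ∑ i ∈ Finset.range n,
        Multiset.replicate (l * f i) (pn i))) =
      (∏ i ∈ Finset.range n, (specT (RatFunc.C zeta) (Htilde qF tF P
        (Multiset.replicate l (pn i)))) ^ f i) *
      specT (RatFunc.C zeta) (Htilde qF tF P lam) := by
  induction n with
  | zero => simp
  | succ n ih =>
    rw [Finset.sum_range_succ, Finset.prod_range_succ, ← add_assoc, mul_right_comm, ← ih]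
    generalize lam + ∑ i ∈ Finset.range n,
      Multiset.replicate (l * f i) (pn i) = kap
    induction f n with
    | zero => simp
    | succ m ih2 =>
      rw [Nat.mul_succ, Multiset.replicate_add, ← add_assoc, specT_block hl hzeta hP, ih2, pow_succ, mul_assoc]

theorem multiset_blocks (mu : Multiset ℕ+) (n : ℕ) (hmu : wt mu = n) (l : ℕ) :
    mu = (∑ i ∈ Finset.range n,
        Multiset.replicate (Multiset.count (pn i) mu % l)
              (pn i)) + ∑ i ∈ Finset.range n,
        Multiset.replicate (l * (Multiset.count (pn i) mu / l))
          (pn i) := by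
  classical
  rw [← Finset.sum_add_distrib]
  simp only [← Multiset.replicate_add, Nat.mod_add_div]
  refine Multiset.ext.2 fun (a : ℕ+) => ?_
  rw [Multiset.count_sum']
  simp only [Multiset.count_replicate]
  by_cases ha : a ∈ mu
  · have hle : (a : ℕ) ≤ n := by
      rw [← hmu]
      exact Multiset.single_le_sum (fun _ _ => Nat.zero_le _) _ (Multiset.mem_map_of_mem _ ha)
    have hpos : 0 < (a : ℕ) := a.2
    have he : pn ((a : ℕ) - 1) = a := by
      apply PNat.eq
      change (a : ℕ) - 1 + 1 = a
      omega
    rw [Finset.sum_eq_single_of_mem ((a : ℕ) - 1) (Finset.mem_range.2 (by omega))]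
    · rw [he, if_pos rfl]
    · intro b _ hb
      rw [if_neg]
      intro h
      have := congrArg (fun x : ℕ+ => (x : ℕ)) h
      change b + 1 = (a : ℕ) at this
      omega
  · rw [Multiset.count_eq_zero_of_notMem ha, Finset.sum_eq_zero]
    intro i _
    split_ifs with h
    · rw [h]; exact Multiset.count_eq_zero_of_notMem ha
    · rfl

theorem main {l : ℕ} (hl : 0 < l) {zeta : ℂ} (hzeta : IsPrimitiveRoot zeta l)
    {P : Multiset ℕ+ → SymFn FF} (hP : IsMacdonaldBasis qF tF⁻¹ P)
    (mu : Multiset ℕ+) (n : ℕ) (hmu : wt mu = n) :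
    specT (RatFunc.C zeta) (Htilde qF tF P mu) =
      (∏ i ∈ Finset.range n, (specT (RatFunc.C zeta) (Htilde qF tF P
        (Multiset.replicate l (pn i)))) ^ (Multiset.count (pn i) mu / l)) *
      specT (RatFunc.C zeta) (Htilde qF tF P
        (∑ i ∈ Finset.range n, Multiset.replicate (Multiset.count (pn i) mu % l) (pn i))) := by
  have e := multiset_blocks mu n hmu l
  have h := specT_blocks hl hzeta hP
    (∑ i ∈ Finset.range n, Multiset.replicate (Multiset.count (pn i) mu % l) (pn i))
    (fun i => Multiset.count (pn i) mu / l) n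
  refine Eq.trans ?_ h
  exact congrArg (fun x => specT (RatFunc.C zeta) (Htilde qF tF P x)) e

end HF
end

noncomputable section

open MvPolynomial

/-- **Factorization of `H̃_μ` at a primitive root of unity** (Corollary 5.2 of the paper).
Let `l > 0`, `ζ` a primitive `l`-th root of unity and `μ = (1^{m_1} 2^{m_2} ⋯ n^{m_n})` a
partition of `n > 0`.  Writing `m_i = l·q_i + r_i` with `0 ≤ r_i ≤ l-1` and
`μ̄ = (1^{r_1} 2^{r_2} ⋯ n^{r_n})`, one has
`H̃_μ(x;q,ζ) = ∏_{i=1}^n (H̃_{(i^l)}(x;q,ζ))^{q_i} · H̃_{μ̄}(x;q,ζ)`.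
Here `P` is the Macdonald basis at parameters `(q, t⁻¹)`, from which `H̃` is built. -/
theorem Htilde_factorization_root_of_unity
    (l : ℕ) (hl : 0 < l) (zeta : ℂ) (hzeta : IsPrimitiveRoot zeta l)
    (n : ℕ) (hn : 0 < n) (mu : Multiset ℕ+) (hmu : wt mu = n)
    (P : Multiset ℕ+ → SymFn FF) (hP : IsMacdonaldBasis qF tF⁻¹ P) :
    specT (RatFunc.C zeta) (Htilde qF tF P mu) =
      (∏ i ∈ Finset.range n,
        (specT (RatFunc.C zeta)
            (Htilde qF tF P
              (Multiset.replicate l (⟨i + 1, Nat.succ_pos i⟩ : ℕ+)))) ^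
          (Multiset.count (⟨i + 1, Nat.succ_pos i⟩ : ℕ+) mu / l)) *
      specT (RatFunc.C zeta)
        (Htilde qF tF P
          (∑ i ∈ Finset.range n,
            Multiset.replicate (Multiset.count (⟨i + 1, Nat.succ_pos i⟩ : ℕ+) mu % l)
              (⟨i + 1, Nat.succ_pos i⟩ : ℕ+))) := by
  exact HF.main hl hzeta hP mu n hmu
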